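/- There exist constants C, c > 0 depending only on Ω such that for all ε ∈ (0, 1]: sup_{θ⋆ ∈ D} P( sup_{λ ∈ [λ_min, λ_max]} ( (1/N)‖v̂_λ‖² − κ⋆(λ) )² ≥ ε ) ≤ (C/ε²) N^q e^{−cnε²}, where v̂_λ = (1/λ) Xᵀ(y − Xθ̂_λ) and κ⋆(λ) = (β⋆(λ)²/λ²)(1 + δ − 2 s⋆(λ) − δ σ²/τ⋆(λ)²). -/

import Mathlib

open MeasureTheory ProbabilityTheory
open scoped ENNReal NNReal

noncomputable section

/-- Standard Gaussian density φ. -/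
def gphi (x : ℝ) : ℝ := Real.exp (-x ^ 2 / 2) / Real.sqrt (2 * Real.pi)

/-- Standard Gaussian CDF Φ. -/
def gPhi (x : ℝ) : ℝ := ∫ t in Set.Iic x, gphi t

/-- Soft thresholding η(x; b) = sign(x)(|x| − b)₊. -/
def eta (x b : ℝ) : ℝ := Real.sign x * max (|x| - b) 0

/-- Derivative in x of soft thresholding: η′(x; b) = 1_{|x| > b}. -/
def eta' (x b : ℝ) : ℝ := if b < |x| then 1 else 0

/-- The ℓ_p ball F_p(ξ) = {x : (1/N) ∑ |xᵢ|^p ≤ ξ^p}. -/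
def Fball (N : ℕ) (p ξ : ℝ) : Set (Fin N → ℝ) :=
  {x | (1 / (N : ℝ)) * ∑ i, |x i| ^ p ≤ ξ ^ p}

/-- Number of nonzero entries ‖x‖₀. -/
def l0 {N : ℕ} (x : Fin N → ℝ) : ℕ := (Finset.univ.filter fun i => x i ≠ 0).card

/-- The ℓ₀ ball F_0(s) = {x : ‖x‖₀ ≤ sN}. -/
def F0ball (N : ℕ) (s : ℝ) : Set (Fin N → ℝ) := {x | (l0 x : ℝ) ≤ s * N}

/-- The critical sparsity s_max(δ). -/
def smax (δ : ℝ) : ℝ :=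
  δ * sSup ((fun α : ℝ =>
      (1 - (2 / δ) * ((1 + α ^ 2) * gPhi (-α) - α * gphi α)) /
      (1 + α ^ 2 - 2 * ((1 + α ^ 2) * gPhi (-α) - α * gphi α))) '' Set.Ici 0)

/-- Empirical distribution of the entries of a vector. -/
def empDist {N : ℕ} (θ : Fin N → ℝ) : Measure ℝ :=
  ((N : ℝ≥0∞))⁻¹ • ∑ i : Fin N, Measure.dirac (θ i)

/-- Empirical distribution of pairs of entries of two vectors. -/
def empDist2 {N : ℕ} (u v : Fin N → ℝ) : Measure (ℝ × ℝ) :=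
  ((N : ℝ≥0∞))⁻¹ • ∑ i : Fin N, Measure.dirac (u i, v i)

/-- Squared order-2 Wasserstein distance between measures on ℝ². -/
def W2sq (μ ν : Measure (ℝ × ℝ)) : ℝ :=
  sInf {r : ℝ | ∃ γ : Measure ((ℝ × ℝ) × (ℝ × ℝ)),
    γ.map Prod.fst = μ ∧ γ.map Prod.snd = ν ∧
    r = ∫ q, ((q.1.1 - q.2.1) ^ 2 + (q.1.2 - q.2.2) ^ 2) ∂γ}

/-- Order-2 Wasserstein distance. -/
def W2 (μ ν : Measure (ℝ × ℝ)) : ℝ := Real.sqrt (W2sq μ ν)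

/-- Standard Gaussian measure on ℝ. -/
def stdG : Measure ℝ := gaussianReal 0 1

/-- The state-evolution fixed point equations (for (Θ,Z) ∼ μ ⊗ N(0,1)),
together with positivity of (β, τ). -/
def StateEvo (δ σ : ℝ) (μ : Measure ℝ) (lam β τ : ℝ) : Prop :=
  0 < β ∧ 0 < τ ∧
  τ ^ 2 = σ ^ 2 + (1 / δ) *
    ∫ q : ℝ × ℝ, (eta (q.1 + τ * q.2) (τ * lam / β) - q.1) ^ 2 ∂(μ.prod stdG) ∧
  β = τ * (1 - (1 / δ) *
    ∫ q : ℝ × ℝ, eta' (q.1 + τ * q.2) (τ * lam / β) ∂(μ.prod stdG))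

/-- s⋆ = P(|Θ + τZ| ≥ ατ) for (Θ,Z) ∼ μ ⊗ N(0,1). -/
def sStar (μ : Measure ℝ) (τ α : ℝ) : ℝ :=
  ((μ.prod stdG) {q : ℝ × ℝ | α * τ ≤ |q.1 + τ * q.2|}).toReal

/-- The limit law μ⋆: law of (η(Θ + τZ; ατ), Θ) for (Θ,Z) ∼ μ ⊗ N(0,1). -/
def muStar (μ : Measure ℝ) (τ α : ℝ) : Measure (ℝ × ℝ) :=
  (μ.prod stdG).map (fun q => (eta (q.1 + τ * q.2) (α * τ), q.1))

/-- The limit law for the debiased Lasso: law of (Θ + τZ, Θ). -/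
def muStarD (μ : Measure ℝ) (τ : ℝ) : Measure (ℝ × ℝ) :=
  (μ.prod stdG).map (fun q => (q.1 + τ * q.2, q.1))

/-- Law of the design matrix: i.i.d. N(0, 1/n) entries. -/
def PX (n N : ℕ) : Measure (Fin n → Fin N → ℝ) :=
  Measure.pi fun _ => Measure.pi fun _ => gaussianReal 0 ((n : ℝ≥0))⁻¹

/-- Law of the noise: i.i.d. standard Gaussian entries. -/
def Pz (n : ℕ) : Measure (Fin n → ℝ) :=
  Measure.pi fun _ => gaussianReal 0 1

/-- Joint law of (X, z). -/
def Pmodel (n N : ℕ) : Measure ((Fin n → Fin N → ℝ) × (Fin n → ℝ)) :=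
  (PX n N).prod (Pz n)

/-- The response y = Xθ⋆ + σz. -/
def yvec {n N : ℕ} (σ : ℝ) (θstar : Fin N → ℝ) (X : Fin n → Fin N → ℝ)
    (z : Fin n → ℝ) : Fin n → ℝ :=
  fun i => (∑ j, X i j * θstar j) + σ * z i

/-- The Lasso cost (1/(2n))‖y − Xθ‖² + (λ/n)‖θ‖₁. -/
def lassoCost {n N : ℕ} (X : Fin n → Fin N → ℝ) (y : Fin n → ℝ) (lam : ℝ)
    (θ : Fin N → ℝ) : ℝ :=
  (1 / (2 * (n : ℝ))) * ∑ i, (y i - ∑ j, X i j * θ j) ^ 2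
    + (lam / (n : ℝ)) * ∑ j, |θ j|

/-- The uniformity class: D is either an ℓ_p ball F_p(ξ) or an ℓ₀ ball F_0(s) with
s below the critical sparsity, with the corresponding exponent q. -/
def DFamSpec (δ : ℝ) (Dfam : (M : ℕ) → Set (Fin M → ℝ)) (q : ℝ) : Prop :=
  (∃ p ξ : ℝ, 0 < p ∧ 0 < ξ ∧ (∀ M, Dfam M = Fball M p ξ) ∧ q = max (1 / p - 1) 0) ∨
  (∃ s : ℝ, 0 ≤ s ∧ s < smax δ ∧ (∀ M, Dfam M = F0ball M s) ∧ q = 0)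

instance stdG_isProbabilityMeasure : IsProbabilityMeasure stdG := by
  unfold stdG; infer_instance

lemma stdG_integral_eq (f : ℝ → ℝ) :
    ∫ x, f x ∂stdG = ∫ x, gaussianPDFReal 0 1 x * f x := by
  unfold stdG
  rw [integral_gaussianReal_eq_integral_smul one_ne_zero]
  rfl

lemma stdG_integrable_iff (f : ℝ → ℝ) :
    Integrable f stdG ↔ Integrable (fun x => gaussianPDFReal 0 1 x * f x) := by
  unfold stdG
  rw [gaussianReal_of_var_ne_zero 0 one_ne_zero, gaussianPDF_def]
  rw [integrable_withDensity_iff_integrable_smul₀' (by fun_prop) (by simp)]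
  simp [ENNReal.toReal_ofReal, gaussianPDFReal_nonneg]

lemma gaussianPDFReal_std (x : ℝ) :
    gaussianPDFReal 0 1 x = (Real.sqrt (2 * Real.pi))⁻¹ * Real.exp (-x ^ 2 / 2) := by
  simp [gaussianPDFReal_def]

lemma stdG_integrable_exp_sq : Integrable (fun x => Real.exp (x ^ 2 / 4)) stdG := by
  rw [stdG_integrable_iff]
  refine ((integrable_exp_neg_mul_sq (b := 1/4) (by norm_num)).const_mul
    (Real.sqrt (2 * Real.pi))⁻¹).congr (Filter.Eventually.of_forall fun x => ?_)
  simp only [gaussianPDFReal_std]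
  rw [mul_assoc, ← Real.exp_add]
  ring_nf

lemma one_add_sq_le_exp (x : ℝ) : 1 + x ^ 2 ≤ 4 * Real.exp (x ^ 2 / 4) := by
  nlinarith [Real.add_one_le_exp (x ^ 2 / 4), sq_nonneg x]

/-- A measurable function of at most quadratic growth is integrable under the Gaussian law. -/
lemma stdG_integrable_of_quadratic {f : ℝ → ℝ} (hf : AEStronglyMeasurable f stdG) (C : ℝ)
    (hC : ∀ x, |f x| ≤ C * (1 + x ^ 2)) : Integrable f stdG := by
  refine (stdG_integrable_exp_sq.const_mul (C * 4)).mono' hf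
    (Filter.Eventually.of_forall fun x => ?_)
  have h0 : 0 ≤ C := by
    have := (abs_nonneg _).trans (hC 0)
    simpa using this
  rw [Real.norm_eq_abs]
  refine (hC x).trans ?_
  rw [mul_assoc]
  exact mul_le_mul_of_nonneg_left (one_add_sq_le_exp x) h0

lemma hasDerivAt_gaussianPDFReal_std (x : ℝ) :
    HasDerivAt (gaussianPDFReal 0 1) (-x * gaussianPDFReal 0 1 x) x := by
  have h : gaussianPDFReal 0 1 =
      fun x => (Real.sqrt (2 * Real.pi))⁻¹ * Real.exp (-x ^ 2 / 2) := by
    ext x; exact gaussianPDFReal_std x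
  rw [h]
  have h1 : HasDerivAt (fun x : ℝ => -x ^ 2 / 2) (-x) x := by
    exact ((hasDerivAt_pow 2 x).neg.div_const 2).congr_deriv (by norm_num; ring)
  refine (h1.exp.const_mul _).congr_deriv ?_
  ring

lemma gaussianPDFReal_std_linear_bound (x : ℝ) :
    (1 + |x|) * gaussianPDFReal 0 1 x ≤ 4 / (1 + |x|) := by
  rw [gaussianPDFReal_std]
  have h1 : (Real.sqrt (2 * Real.pi))⁻¹ ≤ 1 := by
    apply inv_le_one_of_one_le₀
    rw [Real.one_le_sqrt]
    nlinarith [Real.pi_gt_three]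
  have h2 : Real.exp (-x ^ 2 / 2) ≤ (1 + x ^ 2 / 2)⁻¹ := by
    rw [neg_div, Real.exp_neg]
    apply inv_anti₀ (by positivity)
    linarith [Real.add_one_le_exp (x ^ 2 / 2)]
  have h3 : (Real.sqrt (2 * Real.pi))⁻¹ * Real.exp (-x ^ 2 / 2) ≤ 1 * (1 + x ^ 2 / 2)⁻¹ :=
    mul_le_mul h1 h2 (by positivity) zero_le_one
  have h0 := abs_nonneg x
  calc _ ≤ (1 + |x|) * (1 * (1 + x ^ 2 / 2)⁻¹) := by gcongr
    _ ≤ _ := by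
      rw [one_mul, ← div_eq_mul_inv, div_le_div_iff₀ (by positivity) (by positivity)]
      nlinarith [sq_abs x, sq_nonneg (|x| - 1)]

/-- Gaussian integration by parts. -/
lemma stdG_integral_mul_eq_deriv {f f' : ℝ → ℝ} {S : Set ℝ} (hS : S.Countable)
    (hf : Continuous f) (hd : ∀ x ∉ S, HasDerivAt f (f' x) x) (hf' : Measurable f')
    (C : ℝ) (hb : ∀ x, |f x| ≤ C * (1 + |x|)) (hb' : ∀ x, |f' x| ≤ C) :
    ∫ x, x * f x ∂stdG = ∫ x, f' x ∂stdG := by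
  have hC : 0 ≤ C := (abs_nonneg _).trans (hb' 0)
  have i1 : Integrable (fun x => x * f x) stdG := by
    refine stdG_integrable_of_quadratic (by fun_prop) (2 * C) fun x => ?_
    rw [abs_mul]
    have := hb x
    have h0 := abs_nonneg x
    calc |x| * |f x| ≤ |x| * (C * (1 + |x|)) := by gcongr
      _ = C * (|x| + |x| ^ 2) := by ring
      _ ≤ C * (2 * (1 + x ^ 2)) := by
        rw [sq_abs]
        gcongr
        nlinarith [sq_abs x, sq_nonneg (|x| - 1)]
      _ = _ := by ring
  have i2 : Integrable f' stdG := by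
    refine stdG_integrable_of_quadratic hf'.aestronglyMeasurable C fun x => (hb' x).trans ?_
    nlinarith [sq_nonneg x]
  have key : ∫ x, (f' x - x * f x) ∂stdG = 0 := by
    have i3 := (stdG_integrable_iff _).1 (i2.sub i1)
    rw [stdG_integral_eq]
    simp only [Pi.sub_apply] at i3
    have ht := intervalIntegral_tendsto_integral i3 Filter.tendsto_neg_atTop_atBot Filter.tendsto_id
    have hF : ∀ M : ℝ, ∫ x in (-M)..(id M), gaussianPDFReal 0 1 x * (f' x - x * f x)
        = gaussianPDFReal 0 1 M * f M - gaussianPDFReal 0 1 (-M) * f (-M) := by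
      intro M
      have hc : Continuous (gaussianPDFReal 0 1) :=
        continuous_iff_continuousAt.2 fun x => (hasDerivAt_gaussianPDFReal_std x).continuousAt
      refine integral_eq_of_hasDerivAt_off_countable (fun x => gaussianPDFReal 0 1 x * f x) _ hS
        (hc.mul hf).continuousOn (fun x hx => ?_) (i3.intervalIntegrable)
      refine ((hasDerivAt_gaussianPDFReal_std x).mul (hd x hx.2)).congr_deriv ?_
      ring
    simp only [hF] at ht
    refine tendsto_nhds_unique ht ?_
    have hlim : Filter.Tendsto (fun M : ℝ => 2 * C * (4 / (1 + |M|))) Filter.atTop (nhds 0) := by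
      have : Filter.Tendsto (fun M : ℝ => 4 / (1 + |M|)) Filter.atTop (nhds 0) :=
        Filter.Tendsto.div_atTop tendsto_const_nhds
          (Filter.tendsto_atTop_add_const_left _ _ Filter.tendsto_abs_atTop_atTop)
      simpa using this.const_mul (2 * C)
    refine squeeze_zero_norm (fun M => ?_) hlim
    have e : ∀ x, |gaussianPDFReal 0 1 x * f x| ≤ C * (4 / (1 + |x|)) := by
      intro x
      have hp := gaussianPDFReal_nonneg 0 1 x
      rw [abs_mul, abs_of_nonneg hp]
      calc _ ≤ gaussianPDFReal 0 1 x * (C * (1 + |x|)) := by gcongr; exact hb x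
        _ = C * ((1 + |x|) * gaussianPDFReal 0 1 x) := by ring
        _ ≤ _ := by gcongr; exact gaussianPDFReal_std_linear_bound x
    have e1 := e M
    have e2 := e (-M)
    rw [abs_neg] at e2
    rw [Real.norm_eq_abs]
    refine (abs_sub _ _).trans ?_
    linarith
  rw [integral_sub i2 i1] at key
  linarith

lemma stdG_integral_id : ∫ x, x ∂stdG = 0 := by
  unfold stdG
  simp

lemma stdG_integral_sq : ∫ x, x ^ 2 ∂stdG = 1 := by
  have := stdG_integral_mul_eq_deriv (f := fun x => x) (f' := fun _ => 1) (S := ∅) (by simp)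
    continuous_id (fun x _ => hasDerivAt_id x) measurable_const 1
    (fun x => by nlinarith [abs_nonneg x]) (by simp)
  simp only [← pow_two] at this
  rw [this]; simp

lemma integral_comp_measurePreserving {X Y : Type*} [MeasurableSpace X] [MeasurableSpace Y]
    {μ : Measure X} {ν : Measure Y} {f : X → Y} (mp : MeasurePreserving f μ ν) {g : Y → ℝ}
    (hg : AEStronglyMeasurable g ν) : ∫ x, g (f x) ∂μ = ∫ y, g y ∂ν := by
  rw [← mp.map_eq] at hg ⊢
  rw [integral_map mp.measurable.aemeasurable hg]

/-- The standard Gaussian law on a finite product. -/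
def stdPi (K : Type*) [Fintype K] : Measure (K → ℝ) := Measure.pi fun _ => stdG

instance stdPi_isProbabilityMeasure (K : Type*) [Fintype K] : IsProbabilityMeasure (stdPi K) := by
  unfold stdPi; infer_instance

lemma measurePreserving_update {K : Type*} [Fintype K] [DecidableEq K] (k : K) :
    MeasurePreserving (fun p : (K → ℝ) × ℝ => Function.update p.1 k p.2)
      ((stdPi K).prod stdG) (stdPi K) := by
  have hm : Measurable (fun p : (K → ℝ) × ℝ => Function.update p.1 k p.2) := by
    rw [measurable_pi_iff]
    intro i
    by_cases h : i = k
    · subst h; simpa using measurable_snd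
    · simp only [Function.update_of_ne h]; fun_prop
  refine ⟨hm, (Measure.pi_eq fun s hs => ?_).symm⟩
  rw [Measure.map_apply hm (MeasurableSet.univ_pi hs)]
  have : (fun p : (K → ℝ) × ℝ => Function.update p.1 k p.2) ⁻¹' Set.univ.pi s
      = (Set.univ.pi (Function.update s k Set.univ)) ×ˢ (s k) := by
    ext ⟨ω, x⟩
    simp only [Set.mem_preimage, Set.mem_pi, Set.mem_univ, true_implies, Set.mem_prod]
    constructor
    · intro h
      refine ⟨fun i => ?_, by simpa using h k⟩
      by_cases hi : i = k
      · subst hi; simp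
      · simpa [hi] using h i
    · rintro ⟨h1, h2⟩ i
      by_cases hi : i = k
      · subst hi; simpa using h2
      · simpa [hi] using h1 i
  rw [this, Measure.prod_prod]
  unfold stdPi
  rw [Measure.pi_pi]
  rw [← Finset.prod_erase_mul _ _ (Finset.mem_univ k),
    ← Finset.prod_erase_mul Finset.univ (fun i => stdG (s i)) (Finset.mem_univ k)]
  congr 1
  simp only [Function.update_self, measure_univ, mul_one]
  refine Finset.prod_congr rfl fun i hi => ?_
  rw [Function.update_of_ne (Finset.ne_of_mem_erase hi)]

lemma stdPi_integrable_eval {K : Type*} [Fintype K] (k : K) :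
    Integrable (fun ω : K → ℝ => ω k) (stdPi K) := by
  have h : Integrable (fun x : ℝ => x) stdG :=
    stdG_integrable_of_quadratic (by fun_prop) 1 fun x => by
      nlinarith [sq_abs x, sq_nonneg (|x| - 1)]
  have := (measurePreserving_eval (fun _ : K => stdG) k).integrable_comp_of_integrable h
  exact this

/-- Gaussian integration by parts in one coordinate of a product. -/
lemma stdPi_integral_eval_mul {K : Type*} [Fintype K] [DecidableEq K] (k : K)
    {F F' : (K → ℝ) → ℝ} (hF : Continuous F) (hF' : Continuous F') (C : ℝ)
    (hd : ∀ ω x, HasDerivAt (fun t => F (Function.update ω k t)) (F' (Function.update ω k x)) x)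
    (hb : ∀ ω, |F ω| ≤ C) (hb' : ∀ ω, |F' ω| ≤ C) :
    ∫ ω, ω k * F ω ∂(stdPi K) = ∫ ω, F' ω ∂(stdPi K) := by
  have mp := measurePreserving_update k
  have C0 : 0 ≤ C := (abs_nonneg _).trans (hb 0)
  have i1 : Integrable (fun ω : K → ℝ => ω k * F ω) (stdPi K) :=
    (stdPi_integrable_eval k).mul_bdd (c := C) hF.aestronglyMeasurable (ae_of_all _ hb)
  have i2 : Integrable F' (stdPi K) :=
    Integrable.of_bound hF'.aestronglyMeasurable C (ae_of_all _ hb')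
  have e1 : ∫ ω, ω k * F ω ∂(stdPi K) = ∫ p, (fun ω : K → ℝ => ω k * F ω)
      (Function.update p.1 k p.2) ∂((stdPi K).prod stdG) := by
    exact (integral_comp_measurePreserving mp i1.aestronglyMeasurable).symm
  have e2 : ∫ ω, F' ω ∂(stdPi K) = ∫ p, F' (Function.update p.1 k p.2)
      ∂((stdPi K).prod stdG) := by
    exact (integral_comp_measurePreserving mp i2.aestronglyMeasurable).symm
  have j1 : Integrable (fun p : (K → ℝ) × ℝ => (fun ω : K → ℝ => ω k * F ω)
      (Function.update p.1 k p.2)) ((stdPi K).prod stdG) := mp.integrable_comp_of_integrable i1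
  have j2 : Integrable (fun p : (K → ℝ) × ℝ => F' (Function.update p.1 k p.2))
      ((stdPi K).prod stdG) := mp.integrable_comp_of_integrable i2
  rw [e1, e2, integral_prod _ j1, integral_prod _ j2]
  congr 1
  ext ω
  simp only [Function.update_self]
  have hu : Continuous fun t : ℝ => Function.update ω k t := by fun_prop
  refine stdG_integral_mul_eq_deriv (S := ∅) (by simp) (hF.comp hu) (fun x _ => hd ω x)
    (hF'.comp hu).measurable C (fun x => (hb _).trans ?_) (fun x => hb' _)
  nlinarith [mul_nonneg C0 (abs_nonneg x)]

/-- A linear Gaussian combination of fixed vectors. -/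
def gaussComb {V K : Type*} [NormedAddCommGroup V] [NormedSpace ℝ V] [Fintype K]
    (D : K → V) (ω : K → ℝ) : V := ∑ k, ω k • D k

lemma continuous_gaussComb {V K : Type*} [NormedAddCommGroup V] [NormedSpace ℝ V] [Fintype K]
    (D : K → V) : Continuous (gaussComb D) := by
  unfold gaussComb; fun_prop

lemma gaussComb_update {V K : Type*} [NormedAddCommGroup V] [NormedSpace ℝ V] [Fintype K]
    [DecidableEq K] (D : K → V) (ω : K → ℝ) (k : K) (t : ℝ) :
    gaussComb D (Function.update ω k t) = gaussComb D (Function.update ω k 0) + t • D k := by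
  unfold gaussComb
  rw [← Finset.sum_erase_add _ _ (Finset.mem_univ k),
    ← Finset.sum_erase_add Finset.univ (fun i => Function.update ω k 0 i • D i)
      (Finset.mem_univ k)]
  simp only [Function.update_self, zero_smul, add_zero]
  congr 1
  refine Finset.sum_congr rfl fun i hi => ?_
  rw [Function.update_of_ne (Finset.ne_of_mem_erase hi),
    Function.update_of_ne (Finset.ne_of_mem_erase hi)]

/-- Gaussian comparison: the process with the larger sum of second derivatives has the larger
expectation. -/
lemma gaussian_comparison {V A B : Type*} [NormedAddCommGroup V] [NormedSpace ℝ V]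
    [Fintype A] [Fintype B] (DA : A → V) (DB : B → V)
    (Φ : V → ℝ) (Φ' : V → V →L[ℝ] ℝ) (ΦA : V → A → ℝ) (ΦB : V → B → ℝ)
    (h1 : ∀ x, HasFDerivAt Φ (Φ' x) x)
    (hc : ∀ d, Continuous fun x => Φ' x d)
    (hA : ∀ x k, HasDerivAt (fun t : ℝ => Φ' (x + t • DA k) (DA k)) (ΦA x k) 0)
    (hB : ∀ x k, HasDerivAt (fun t : ℝ => Φ' (x + t • DB k) (DB k)) (ΦB x k) 0)
    (cA : ∀ k, Continuous fun x => ΦA x k) (cB : ∀ k, Continuous fun x => ΦB x k)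
    (C : ℝ) (b0 : ∀ x, |Φ x| ≤ C)
    (bA : ∀ x k, |Φ' x (DA k)| ≤ C) (bB : ∀ x k, |Φ' x (DB k)| ≤ C)
    (bA' : ∀ x k, |ΦA x k| ≤ C) (bB' : ∀ x k, |ΦB x k| ≤ C)
    (hcmp : ∀ x, ∑ k, ΦB x k ≤ ∑ k, ΦA x k) :
    ∫ ω, Φ (gaussComb DB ω) ∂(stdPi B) ≤ ∫ ω, Φ (gaussComb DA ω) ∂(stdPi A) := by
  classical
  have C0 : 0 ≤ C := (abs_nonneg _).trans (b0 0)
  have cΦ : Continuous Φ := continuous_iff_continuousAt.2 fun x => (h1 x).continuousAt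
  let D : A ⊕ B → V := Sum.elim DA DB
  let Φ'' : V → A ⊕ B → ℝ := fun x => Sum.elim (ΦA x) (ΦB x)
  let c : ℝ → A ⊕ B → ℝ := fun θ => Sum.elim (fun _ => Real.cos θ) (fun _ => Real.sin θ)
  let c' : ℝ → A ⊕ B → ℝ := fun θ => Sum.elim (fun _ => -Real.sin θ) (fun _ => Real.cos θ)
  have hD : ∀ x k, HasDerivAt (fun t : ℝ => Φ' (x + t • D k) (D k)) (Φ'' x k) 0 := by
    rintro x (k | k)
    · exact hA x k
    · exact hB x k
  have cD : ∀ k, Continuous fun x => Φ'' x k := by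
    rintro (k | k)
    · exact cA k
    · exact cB k
  have bD : ∀ x k, |Φ' x (D k)| ≤ C := by
    rintro x (k | k)
    · exact bA x k
    · exact bB x k
  have bD' : ∀ x k, |Φ'' x k| ≤ C := by
    rintro x (k | k)
    · exact bA' x k
    · exact bB' x k
  have hcc : ∀ θ k, HasDerivAt (fun θ => c θ k) (c' θ k) θ := by
    rintro θ (k | k)
    · exact Real.hasDerivAt_cos θ
    · exact Real.hasDerivAt_sin θ
  have bc : ∀ θ k, |c θ k| ≤ 1 := by
    rintro θ (k | k)
    · exact Real.abs_cos_le_one θ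
    · exact Real.abs_sin_le_one θ
  have bc' : ∀ θ k, |c' θ k| ≤ 1 := by
    rintro θ (k | k)
    · simpa [c'] using Real.abs_sin_le_one θ
    · exact Real.abs_cos_le_one θ
  let x : ℝ → (A ⊕ B → ℝ) → V := fun θ ω => gaussComb (fun k => c θ k • D k) ω
  have cx : ∀ θ, Continuous (x θ) := fun θ => continuous_gaussComb _
  let H : ℝ → ℝ := fun θ => ∫ ω, Φ (x θ ω) ∂(stdPi (A ⊕ B))
  have hx : ∀ θ ω, HasDerivAt (fun θ => x θ ω) (∑ k, ω k • c' θ k • D k) θ := by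
    intro θ ω
    simp only [x, gaussComb]
    refine HasDerivAt.fun_sum fun k _ => ?_
    exact ((hcc θ k).smul_const (D k)).const_smul (ω k)
  have hΦx : ∀ θ ω, HasDerivAt (fun θ => Φ (x θ ω))
      (∑ k, c' θ k * (ω k * Φ' (x θ ω) (D k))) θ := by
    intro θ ω
    refine ((h1 (x θ ω)).comp_hasDerivAt θ (hx θ ω)).congr_deriv ?_
    rw [map_sum]
    refine Finset.sum_congr rfl fun k _ => ?_
    simp only [map_smul, smul_eq_mul]
    ring
  have ibd : ∀ θ k, Integrable (fun ω : A ⊕ B → ℝ => ω k * Φ' (x θ ω) (D k))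
      (stdPi (A ⊕ B)) := fun θ k =>
    (stdPi_integrable_eval k).mul_bdd (c := C)
      ((hc (D k)).comp (cx θ)).aestronglyMeasurable (ae_of_all _ fun ω => bD _ k)
  have hH : ∀ θ, HasDerivAt H
      (∫ ω, ∑ k, c' θ k * (ω k * Φ' (x θ ω) (D k)) ∂(stdPi (A ⊕ B))) θ := by
    intro θ
    refine (hasDerivAt_integral_of_dominated_loc_of_deriv_le (s := Set.univ)
      (bound := fun ω => ∑ k, |ω k| * C) Filter.univ_mem
      (Filter.Eventually.of_forall fun θ' => (cΦ.comp (cx θ')).aestronglyMeasurable)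
      (Integrable.of_bound (cΦ.comp (cx θ)).aestronglyMeasurable C (ae_of_all _ fun ω => b0 _))
      ?_ (ae_of_all _ fun ω θ' _ => ?_) ?_ (ae_of_all _ fun ω θ' _ => hΦx θ' ω)).2
    · refine Continuous.aestronglyMeasurable ?_
      refine continuous_finsetSum _ fun k _ => ?_
      exact continuous_const.mul ((continuous_apply k).mul ((hc (D k)).comp (cx θ)))
    · rw [Real.norm_eq_abs]
      refine (Finset.abs_sum_le_sum_abs _ _).trans (Finset.sum_le_sum fun k _ => ?_)
      rw [abs_mul, abs_mul]
      calc _ ≤ 1 * (|ω k| * C) := by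
            gcongr
            · exact bc' θ' k
            · exact bD _ k
        _ = _ := one_mul _
    · exact integrable_finsetSum _ fun k _ => ((stdPi_integrable_eval k).abs.mul_const C)
  have stein : ∀ θ k, ∫ ω, ω k * Φ' (x θ ω) (D k) ∂(stdPi (A ⊕ B))
      = ∫ ω, c θ k * Φ'' (x θ ω) k ∂(stdPi (A ⊕ B)) := by
    intro θ k
    refine stdPi_integral_eval_mul k ((hc (D k)).comp (cx θ))
      (continuous_const.mul ((cD k).comp (cx θ))) C (fun ω y => ?_) (fun ω => bD _ k)
      (fun ω => ?_)
    · have e : ∀ t, x θ (Function.update ω k t)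
          = x θ (Function.update ω k y) + (c θ k * (t - y)) • D k := by
        intro t
        simp only [x]
        rw [gaussComb_update, gaussComb_update _ ω k y, add_assoc, smul_smul, smul_smul,
          ← add_smul]
        congr 2
        ring
      have e' : (fun t => Φ' (x θ (Function.update ω k t)) (D k))
          = fun t => Φ' (x θ (Function.update ω k y) + (c θ k * (t - y)) • D k) (D k) := by
        ext t; rw [e t]
      show HasDerivAt (fun t => Φ' (x θ (Function.update ω k t)) (D k)) _ _
      rw [e']
      have hin : HasDerivAt (fun t => c θ k * (t - y)) (c θ k) y := by
        simpa using ((hasDerivAt_id y).sub_const y).const_mul (c θ k)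
      have h0 : c θ k * (y - y) = 0 := by simp
      have hD0 := hD (x θ (Function.update ω k y)) k
      rw [← h0] at hD0
      refine (hD0.comp y hin).congr_deriv ?_
      exact mul_comm _ _
    · rw [abs_mul]
      calc _ ≤ 1 * C := by
            gcongr
            · exact bc θ k
            · exact bD' _ k
        _ = C := one_mul C
  have idd : ∀ θ k, Integrable (fun ω => c θ k * Φ'' (x θ ω) k) (stdPi (A ⊕ B)) := fun θ k =>
    (Integrable.of_bound ((cD k).comp (cx θ)).aestronglyMeasurable C
      (ae_of_all _ fun ω => bD' _ k)).const_mul _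
  have hH' : ∀ θ, ∫ ω, ∑ k, c' θ k * (ω k * Φ' (x θ ω) (D k)) ∂(stdPi (A ⊕ B))
      = ∫ ω, Real.sin θ * Real.cos θ * (∑ k, ΦB (x θ ω) k - ∑ k, ΦA (x θ ω) k)
        ∂(stdPi (A ⊕ B)) := by
    intro θ
    rw [integral_finsetSum _ fun k _ => (ibd θ k).const_mul _]
    simp_rw [integral_const_mul, stein, ← integral_const_mul]
    rw [← integral_finsetSum _ fun k _ => (idd θ k).const_mul _]
    congr 1
    ext ω
    simp only [Fintype.sum_sum_type, c, c', Φ'', Sum.elim_inl, Sum.elim_inr, mul_sub,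
      Finset.mul_sum]
    rw [add_comm, sub_eq_add_neg, ← Finset.sum_neg_distrib]
    congr 1 <;> exact Finset.sum_congr rfl fun k _ => by ring
  have anti : AntitoneOn H (Set.Icc 0 (Real.pi / 2)) := by
    refine antitoneOn_of_deriv_nonpos (convex_Icc _ _)
      (fun θ _ => (hH θ).continuousAt.continuousWithinAt)
      (fun θ _ => (hH θ).differentiableAt.differentiableWithinAt) fun θ hθ => ?_
    rw [interior_Icc] at hθ
    rw [(hH θ).deriv, hH']
    refine integral_nonpos fun ω => ?_
    have s1 : 0 ≤ Real.sin θ := Real.sin_nonneg_of_nonneg_of_le_pi hθ.1.le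
      (by linarith [hθ.2, Real.pi_pos])
    have s2 : 0 ≤ Real.cos θ := Real.cos_nonneg_of_neg_pi_div_two_le_of_le
      (by linarith [hθ.1, Real.pi_pos]) hθ.2.le
    have := hcmp (x θ ω)
    exact mul_nonpos_of_nonneg_of_nonpos (mul_nonneg s1 s2) (by linarith)
  have hpi : (0 : ℝ) ≤ Real.pi / 2 := by positivity
  have key := anti (Set.left_mem_Icc.2 hpi) (Set.right_mem_Icc.2 hpi) hpi
  have mp := measurePreserving_sumPiEquivProdPi (fun _ : A ⊕ B => stdG)
  have e0 : H 0 = ∫ ω, Φ (gaussComb DA ω) ∂(stdPi A) := by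
    have hfst : MeasurePreserving (fun ω : A ⊕ B → ℝ => fun k => ω (Sum.inl k))
        (stdPi (A ⊕ B)) (stdPi A) := measurePreserving_fst.comp mp
    refine Eq.trans ?_ (integral_comp_measurePreserving hfst
      (cΦ.comp (continuous_gaussComb DA)).aestronglyMeasurable)
    simp only [H, x, gaussComb, c, D, Fintype.sum_sum_type]
    simp
  have e1 : H (Real.pi / 2) = ∫ ω, Φ (gaussComb DB ω) ∂(stdPi B) := by
    have hsnd : MeasurePreserving (fun ω : A ⊕ B → ℝ => fun k => ω (Sum.inr k))
        (stdPi (A ⊕ B)) (stdPi B) := measurePreserving_snd.comp mp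
    refine Eq.trans ?_ (integral_comp_measurePreserving hsnd
      (cΦ.comp (continuous_gaussComb DB)).aestronglyMeasurable)
    simp only [H, x, gaussComb, c, D, Fintype.sum_sum_type]
    simp
  rw [e0, e1] at key
  exact key

/-- The Gibbs weights of a family of functions. -/
def gibbs {ι K : Type*} (a t : ℝ) (R : ι → (K → ℝ) → ℝ) (x : ι → K → ℝ) (i : ι) : ℝ :=
  Real.exp (-a * (R i (x i) - t))

/-- A smooth surrogate for the indicator that all the values exceed `t`. -/
def softInd {ι K : Type*} [Fintype ι] (a t : ℝ) (R : ι → (K → ℝ) → ℝ) (x : ι → K → ℝ) : ℝ :=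
  (1 + ∑ i, gibbs a t R x i)⁻¹

lemma gibbs_pos {ι K : Type*} (a t : ℝ) (R : ι → (K → ℝ) → ℝ) (x : ι → K → ℝ) (i : ι) :
    0 < gibbs a t R x i := Real.exp_pos _

lemma gibbs_sum_nonneg {ι K : Type*} [Fintype ι] (a t : ℝ) (R : ι → (K → ℝ) → ℝ)
    (x : ι → K → ℝ) : 0 ≤ ∑ i, gibbs a t R x i :=
  Finset.sum_nonneg fun i _ => (gibbs_pos a t R x i).le

/-- The second derivative of `softInd` in the direction with components `c i • e_k`. -/
def softHess {ι K : Type*} [Fintype ι] (a t : ℝ) (R : ι → (K → ℝ) → ℝ)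
    (G Hs : ι → (K → ℝ) → K → ℝ) (x : ι → K → ℝ) (k : K) (c : ι → ℝ) : ℝ :=
  2 * ((1 + ∑ i, gibbs a t R x i)⁻¹) ^ 3 *
      (∑ i, gibbs a t R x i * (-a * (G i (x i) k * c i))) ^ 2
    - ((1 + ∑ i, gibbs a t R x i)⁻¹) ^ 2 * ∑ i, gibbs a t R x i *
      ((a * (G i (x i) k * c i)) ^ 2 - a * (Hs i (x i) k * c i ^ 2))

lemma softInd_hasFDerivAt {ι K : Type*} [Fintype ι] [Fintype K] (a t : ℝ)
    (R : ι → (K → ℝ) → ℝ) (G : ι → (K → ℝ) → K → ℝ)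
    (hR : ∀ i x, HasFDerivAt (R i) (∑ k, G i x k • ContinuousLinearMap.proj (R := ℝ)
      (φ := fun _ : K => ℝ) k) x) (x : ι → K → ℝ) :
    HasFDerivAt (softInd a t R)
      (-((1 + ∑ i, gibbs a t R x i)⁻¹) ^ 2 • ∑ i, (gibbs a t R x i * (-a)) •
        ((∑ k, G i (x i) k • ContinuousLinearMap.proj (R := ℝ) (φ := fun _ : K => ℝ) k).comp
          (ContinuousLinearMap.proj (R := ℝ) (φ := fun _ : ι => K → ℝ) i))) x := by
  have h1 : ∀ i, HasFDerivAt (fun x => gibbs a t R x i) ((gibbs a t R x i * (-a)) •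
        ((∑ k, G i (x i) k • ContinuousLinearMap.proj (R := ℝ) (φ := fun _ : K => ℝ) k).comp
          (ContinuousLinearMap.proj (R := ℝ) (φ := fun _ : ι => K → ℝ) i))) x := by
    intro i
    have := (((hR i (x i)).comp x (ContinuousLinearMap.hasFDerivAt
      (ContinuousLinearMap.proj (R := ℝ) (φ := fun _ : ι => K → ℝ) i))).sub_const t).const_mul (-a)
    have := this.exp
    refine this.congr_fderiv ?_
    rw [smul_smul]
    rfl
  have h2 : HasFDerivAt (fun x => 1 + ∑ i, gibbs a t R x i) _ x :=
    (HasFDerivAt.fun_sum (u := Finset.univ) fun i _ => h1 i).const_add 1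
  have h3 : 1 + ∑ i, gibbs a t R x i ≠ 0 := by
    have := gibbs_sum_nonneg a t R x
    positivity
  have h4 := (hasDerivAt_inv h3).comp_hasFDerivAt x h2
  refine h4.congr_fderiv ?_
  rw [inv_pow]

/-- The direction with components `c i • e_k`. -/
def dirVec {ι K : Type*} [DecidableEq K] (c : ι → ℝ) (k : K) : ι → K → ℝ :=
  fun i => c i • Pi.single k 1

lemma softInd_deriv_apply {ι K : Type*} [Fintype ι] [Fintype K] [DecidableEq K] (g : ι → ℝ)
    (p : ℝ) (gr : ι → K → ℝ) (c : ι → ℝ) (k : K) :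
    (p • ∑ i, g i •
        ((∑ k, gr i k • ContinuousLinearMap.proj (R := ℝ) (φ := fun _ : K => ℝ) k).comp
          (ContinuousLinearMap.proj (R := ℝ) (φ := fun _ : ι => K → ℝ) i)))
      (dirVec c k) = p * ∑ i, g i * (gr i k * c i) := by
  simp [dirVec, Pi.single_apply, mul_comm (c _)]

lemma softInd_hasDerivAt_direction {ι K : Type*} [Fintype ι] [Fintype K] [DecidableEq K]
    (a t : ℝ) (R : ι → (K → ℝ) → ℝ) (G Hs : ι → (K → ℝ) → K → ℝ)
    (hR : ∀ i x, HasFDerivAt (R i) (∑ k, G i x k • ContinuousLinearMap.proj (R := ℝ)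
      (φ := fun _ : K => ℝ) k) x)
    (hG : ∀ i x k, HasDerivAt (fun s : ℝ => G i (x + s • Pi.single k 1) k) (Hs i x k) 0)
    (x : ι → K → ℝ) (k : K) (c : ι → ℝ) :
    HasDerivAt (fun s : ℝ =>
      -((1 + ∑ i, gibbs a t R (x + s • dirVec c k) i)⁻¹) ^ 2 *
        ∑ i, gibbs a t R (x + s • dirVec c k) i * (-a) *
          (G i ((x + s • dirVec c k) i) k * c i))
      (softHess a t R G Hs x k c) 0 := by
  let D : ι → K → ℝ := dirVec c k
  have hg : ∀ i, HasDerivAt (fun s : ℝ => gibbs a t R (x + s • D) i)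
      (gibbs a t R x i * (-a * (G i (x i) k * c i))) 0 := by
    intro i
    have hl : HasDerivAt (fun s : ℝ => (x + s • D) i) (D i) 0 := by
      have : HasDerivAt (fun s : ℝ => x i + s • D i) ((1 : ℝ) • D i) 0 :=
        ((hasDerivAt_id (0 : ℝ)).smul_const (D i)).const_add (x i)
      rw [one_smul] at this
      exact this
    have hR0 := hR i ((x + (0 : ℝ) • D) i)
    have h1 := (((hR0.comp_hasDerivAt (0 : ℝ) hl).sub_const t).const_mul (-a)).exp
    refine h1.congr_deriv ?_
    simp only [zero_smul, add_zero, Function.comp_apply]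
    unfold gibbs
    congr 2
    simp [D, dirVec, Pi.single_apply, mul_comm (c _)]
  have hGd : ∀ i, HasDerivAt (fun s : ℝ => G i ((x + s • D) i) k) (Hs i (x i) k * c i) 0 := by
    intro i
    have h0 := hG i (x i) k
    have e : (0 : ℝ) * c i = 0 := zero_mul _
    rw [← e] at h0
    have h1 := h0.comp (0 : ℝ) ((hasDerivAt_id (0 : ℝ)).mul_const (c i))
    rw [one_mul] at h1
    refine h1.congr_of_eventuallyEq (Filter.Eventually.of_forall fun s => ?_)
    simp only [D, dirVec, Function.comp_apply, id, Pi.add_apply, Pi.smul_apply, smul_smul]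
  have hS : HasDerivAt (fun s : ℝ => 1 + ∑ i, gibbs a t R (x + s • D) i)
      (∑ i, gibbs a t R x i * (-a * (G i (x i) k * c i))) 0 :=
    (HasDerivAt.fun_sum (u := Finset.univ) fun i _ => hg i).const_add 1
  have hS0 : 1 + ∑ i, gibbs a t R (x + (0 : ℝ) • D) i ≠ 0 := by
    have := gibbs_sum_nonneg a t R (x + (0 : ℝ) • D)
    positivity
  have hT : HasDerivAt (fun s : ℝ => ∑ i, gibbs a t R (x + s • D) i * (-a) *
          (G i ((x + s • D) i) k * c i))
      (∑ i, gibbs a t R x i *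
        ((a * (G i (x i) k * c i)) ^ 2 - a * (Hs i (x i) k * c i ^ 2))) 0 := by
    refine HasDerivAt.fun_sum fun i _ => ?_
    refine (((hg i).mul_const (-a)).mul ((hGd i).mul_const (c i))).congr_deriv ?_
    simp only [zero_smul, add_zero]
    ring
  refine ((((hS.inv hS0).pow 2).neg).mul hT).congr_deriv ?_
  simp only [zero_smul, add_zero, softHess, Pi.inv_apply, Pi.neg_apply, Pi.pow_apply] at hS0 ⊢
  have e1 : ∑ i, gibbs a t R x i * (-a) * (G i (x i) k * c i)
      = ∑ i, gibbs a t R x i * (-a * (G i (x i) k * c i)) :=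
    Finset.sum_congr rfl fun i _ => by ring
  rw [e1]
  generalize ∑ i, gibbs a t R x i * (-a * (G i (x i) k * c i)) = T1
  generalize ∑ i, gibbs a t R x i *
    ((a * (G i (x i) k * c i)) ^ 2 - a * (Hs i (x i) k * c i ^ 2)) = T2
  generalize 1 + ∑ i, gibbs a t R x i = S at hS0 ⊢
  field_simp
  have hc := mul_inv_cancel₀ hS0
  linear_combination (2 * T1 ^ 2) * hc

lemma abs_gibbs_sum_le {ι K : Type*} [Fintype ι] (a t : ℝ) (R : ι → (K → ℝ) → ℝ)
    (x : ι → K → ℝ) (u : ι → ℝ) (C : ℝ) (hu : ∀ i, |u i| ≤ C) :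
    |∑ i, gibbs a t R x i * u i| ≤ (∑ i, gibbs a t R x i) * C := by
  rw [Finset.sum_mul]
  refine (Finset.abs_sum_le_sum_abs _ _).trans (Finset.sum_le_sum fun i _ => ?_)
  rw [abs_mul, abs_of_pos (gibbs_pos a t R x i)]
  exact mul_le_mul_of_nonneg_left (hu i) (gibbs_pos a t R x i).le

lemma softInd_comparison {ι K A B : Type*} [Fintype ι] [Fintype K] [DecidableEq K]
    [Fintype A] [Fintype B]
    (a t : ℝ) (ha : 0 ≤ a) (R : ι → (K → ℝ) → ℝ) (G Hs : ι → (K → ℝ) → K → ℝ)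
    (hR : ∀ i x, HasFDerivAt (R i) (∑ k, G i x k • ContinuousLinearMap.proj (R := ℝ)
      (φ := fun _ : K => ℝ) k) x)
    (hG : ∀ i x k, HasDerivAt (fun s : ℝ => G i (x + s • Pi.single k 1) k) (Hs i x k) 0)
    (hGc : ∀ i k, Continuous fun x => G i x k) (hHc : ∀ i k, Continuous fun x => Hs i x k)
    (m : ℝ) (m0 : 0 ≤ m) (bG : ∀ i x k, |G i x k| ≤ m) (bH : ∀ i x k, |Hs i x k| ≤ m)
    (kA : A → K) (cA : A → ι → ℝ) (kB : B → K) (cB : B → ι → ℝ)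
    (bA : ∀ j i, |cA j i| ≤ m) (bB : ∀ j i, |cB j i| ≤ m)
    (hcmp : ∀ x, ∑ j, softHess a t R G Hs x (kB j) (cB j)
      ≤ ∑ j, softHess a t R G Hs x (kA j) (cA j)) :
    ∫ ω, softInd a t R (gaussComb (fun j => dirVec (cB j) (kB j)) ω) ∂(stdPi B)
      ≤ ∫ ω, softInd a t R (gaussComb (fun j => dirVec (cA j) (kA j)) ω) ∂(stdPi A) := by
  have hRc : ∀ i, Continuous (R i) := fun i =>
    continuous_iff_continuousAt.2 fun x => (hR i x).continuousAt
  have gc : ∀ i, Continuous fun x => gibbs a t R x i := fun i => by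
    unfold gibbs
    exact Real.continuous_exp.comp (continuous_const.mul
      (((hRc i).comp (continuous_apply i)).sub continuous_const))
  have Gc : ∀ i k, Continuous fun x : ι → K → ℝ => G i (x i) k := fun i k =>
    (hGc i k).comp (continuous_apply i)
  have Hc : ∀ i k, Continuous fun x : ι → K → ℝ => Hs i (x i) k := fun i k =>
    (hHc i k).comp (continuous_apply i)
  have Sc : Continuous fun x => (1 + ∑ i, gibbs a t R x i)⁻¹ := by
    refine Continuous.inv₀ (by fun_prop) fun x => ?_
    have := gibbs_sum_nonneg a t R x
    positivity
  have inv1 : ∀ x, (1 + ∑ i, gibbs a t R x i)⁻¹ * (1 + ∑ i, gibbs a t R x i) = 1 := fun x => by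
    have := gibbs_sum_nonneg a t R x
    exact inv_mul_cancel₀ (by positivity)
  have apply_eq : ∀ (x : ι → K → ℝ) (k : K) (c : ι → ℝ),
      (-((1 + ∑ i, gibbs a t R x i)⁻¹) ^ 2 • ∑ i, (gibbs a t R x i * (-a)) •
        ((∑ k, G i (x i) k • ContinuousLinearMap.proj (R := ℝ) (φ := fun _ : K => ℝ) k).comp
          (ContinuousLinearMap.proj (R := ℝ) (φ := fun _ : ι => K → ℝ) i))) (dirVec c k)
      = -((1 + ∑ i, gibbs a t R x i)⁻¹) ^ 2 *
        ∑ i, gibbs a t R x i * (-a) * (G i (x i) k * c i) := fun x k c =>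
    softInd_deriv_apply (fun i => gibbs a t R x i * (-a)) _ (fun i => G i (x i)) c k
  have hb1 : ∀ (x : ι → K → ℝ) (k : K) (c : ι → ℝ), (∀ i, |c i| ≤ m) →
      ∀ i, |-a * (G i (x i) k * c i)| ≤ a * m ^ 2 := by
    intro x k c hc i
    rw [abs_mul, abs_mul, abs_neg, abs_of_nonneg ha, pow_two]
    gcongr
    · exact bG i _ k
    · exact hc i
  have hderiv : ∀ (x : ι → K → ℝ) (k : K) (c : ι → ℝ), (∀ i, |c i| ≤ m) →
      |-((1 + ∑ i, gibbs a t R x i)⁻¹) ^ 2 *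
        ∑ i, gibbs a t R x i * (-a) * (G i (x i) k * c i)| ≤ a * m ^ 2 := by
    intro x k c hc
    have h1 := abs_gibbs_sum_le a t R x _ _ (hb1 x k c hc)
    have e1 : ∑ i, gibbs a t R x i * (-a) * (G i (x i) k * c i)
        = ∑ i, gibbs a t R x i * (-a * (G i (x i) k * c i)) :=
      Finset.sum_congr rfl fun i _ => by ring
    rw [e1, abs_mul, abs_neg, abs_pow]
    have h2 := inv1 x
    have h3 := gibbs_sum_nonneg a t R x
    have h4 : 0 < (1 + ∑ i, gibbs a t R x i)⁻¹ := by positivity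
    rw [abs_of_pos h4]
    generalize (1 + ∑ i, gibbs a t R x i)⁻¹ = p at *
    generalize ∑ i, gibbs a t R x i = S at *
    have hp : p ≤ 1 := by nlinarith
    have hpS : p * S ≤ 1 := by nlinarith
    have hK : 0 ≤ a * m ^ 2 := by positivity
    calc p ^ 2 * _ ≤ p ^ 2 * (S * (a * m ^ 2)) := by gcongr
      _ = p * (p * S) * (a * m ^ 2) := by ring
      _ ≤ 1 * 1 * (a * m ^ 2) := by gcongr
      _ = _ := by ring
  have hhess : ∀ (x : ι → K → ℝ) (k : K) (c : ι → ℝ), (∀ i, |c i| ≤ m) →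
      |softHess a t R G Hs x k c| ≤ 2 * (a * m ^ 2) ^ 2 + ((a * m ^ 2) ^ 2 + a * m ^ 3) := by
    intro x k c hc
    have h1 := abs_gibbs_sum_le a t R x _ _ (hb1 x k c hc)
    have h5 := abs_gibbs_sum_le a t R x (fun i =>
      ((a * (G i (x i) k * c i)) ^ 2 - a * (Hs i (x i) k * c i ^ 2)))
        ((a * m ^ 2) ^ 2 + a * m ^ 3) fun i => by
      refine (abs_sub _ _).trans ?_
      have h6 := hb1 x k c hc i
      rw [neg_mul, abs_neg] at h6
      rw [abs_pow]
      have h7 : |a * (Hs i (x i) k * c i ^ 2)| ≤ a * m ^ 3 := by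
        rw [abs_mul, abs_mul, abs_pow, abs_of_nonneg ha]
        calc a * (|Hs i (x i) k| * |c i| ^ 2) ≤ a * (m * m ^ 2) := by
              gcongr
              · exact bH i _ k
              · exact hc i
          _ = _ := by ring
      gcongr
    have h2 := inv1 x
    have h3 := gibbs_sum_nonneg a t R x
    have h4 : 0 < (1 + ∑ i, gibbs a t R x i)⁻¹ := by positivity
    unfold softHess
    have hm : 0 ≤ (a * m ^ 2) ^ 2 + a * m ^ 3 := by positivity
    generalize (1 + ∑ i, gibbs a t R x i)⁻¹ = p at *
    generalize ∑ i, gibbs a t R x i = S at *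
    have hp : p ≤ 1 := by nlinarith
    have hpS : p * S ≤ 1 := by nlinarith
    have hpS0 : 0 ≤ p * S := by positivity
    have hK : 0 ≤ a * m ^ 2 := by positivity
    refine (abs_sub _ _).trans (add_le_add ?_ ?_)
    · rw [abs_mul, abs_of_nonneg (by positivity : 0 ≤ 2 * p ^ 3), abs_pow]
      calc 2 * p ^ 3 * _ ^ 2 ≤ 2 * p ^ 3 * (S * (a * m ^ 2)) ^ 2 := by gcongr
        _ = 2 * (p * (p * S) ^ 2) * (a * m ^ 2) ^ 2 := by ring
        _ ≤ 2 * (1 * 1 ^ 2) * (a * m ^ 2) ^ 2 := by gcongr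
        _ = _ := by ring
    · rw [abs_mul, abs_of_nonneg (by positivity : 0 ≤ p ^ 2)]
      calc p ^ 2 * _ ≤ p ^ 2 * (S * ((a * m ^ 2) ^ 2 + a * m ^ 3)) := by gcongr
        _ = p * (p * S) * ((a * m ^ 2) ^ 2 + a * m ^ 3) := by ring
        _ ≤ 1 * 1 * ((a * m ^ 2) ^ 2 + a * m ^ 3) := by gcongr
        _ = _ := by ring
  refine gaussian_comparison _ _ (softInd a t R) _
    (fun x j => softHess a t R G Hs x (kA j) (cA j))
    (fun x j => softHess a t R G Hs x (kB j) (cB j))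
    (softInd_hasFDerivAt a t R G hR) (fun d => ?_) (fun x j => ?_) (fun x j => ?_)
    (fun j => ?_) (fun j => ?_)
    (1 + a * m ^ 2 + (2 * (a * m ^ 2) ^ 2 + ((a * m ^ 2) ^ 2 + a * m ^ 3))) (fun x => ?_)
    (fun x j => ?_) (fun x j => ?_) (fun x j => ?_) (fun x j => ?_) hcmp
  · simp only [smul_apply, sum_apply, ContinuousLinearMap.comp_apply,
      ContinuousLinearMap.proj_apply]
    fun_prop
  · simp only [apply_eq]
    exact softInd_hasDerivAt_direction a t R G Hs hR hG x (kA j) (cA j)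
  · simp only [apply_eq]
    exact softInd_hasDerivAt_direction a t R G Hs hR hG x (kB j) (cB j)
  · unfold softHess; fun_prop
  · unfold softHess; fun_prop
  · have h := gibbs_sum_nonneg a t R x
    unfold softInd
    rw [abs_of_nonneg (by positivity)]
    have : (1 + ∑ i, gibbs a t R x i)⁻¹ ≤ 1 := inv_le_one_of_one_le₀ (by linarith)
    have : 0 ≤ a * m ^ 2 + (2 * (a * m ^ 2) ^ 2 + ((a * m ^ 2) ^ 2 + a * m ^ 3)) := by positivity
    linarith
  · rw [apply_eq]
    refine (hderiv x _ _ (bA j)).trans ?_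
    have : 0 ≤ 2 * (a * m ^ 2) ^ 2 + ((a * m ^ 2) ^ 2 + a * m ^ 3) := by positivity
    linarith
  · rw [apply_eq]
    refine (hderiv x _ _ (bB j)).trans ?_
    have : 0 ≤ 2 * (a * m ^ 2) ^ 2 + ((a * m ^ 2) ^ 2 + a * m ^ 3) := by positivity
    linarith
  · refine (hhess x _ _ (bA j)).trans ?_
    have : 0 ≤ a * m ^ 2 := by positivity
    linarith
  · refine (hhess x _ _ (bB j)).trans ?_
    have : 0 ≤ a * m ^ 2 := by positivity
    linarith

lemma sum_sq_expand {ι P : Type*} [Fintype ι] [Fintype P] (x : ι → P → ℝ) :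
    ∑ p, (∑ i, x i p) ^ 2 = ∑ i, ∑ l, ∑ p, x i p * x l p := by
  simp_rw [pow_two, Finset.sum_mul_sum]
  rw [Finset.sum_comm]
  exact Finset.sum_congr rfl fun i _ => Finset.sum_comm

lemma inner_le_of_sq_sum {J : Type*} [Fintype J] (u v : J → ℝ) {a b : ℝ} (ha : 0 ≤ a)
    (hb : 0 ≤ b) (hu : ∑ j, u j ^ 2 ≤ a ^ 2) (hv : ∑ j, v j ^ 2 ≤ b ^ 2) :
    ∑ j, u j * v j ≤ a * b := by
  refine le_of_sq_le_sq ?_ (by positivity)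
  calc (∑ j, u j * v j) ^ 2 ≤ (∑ j, u j ^ 2) * ∑ j, v j ^ 2 :=
        Finset.sum_mul_sq_le_sq_mul_sq _ _ _
    _ ≤ a ^ 2 * b ^ 2 := by gcongr
    _ = _ := by ring

lemma gordon_algebra {ι I J : Type*} [Fintype ι] [Fintype I] [Fintype J] (g nw : ι → ℝ)
    (G : ι → I → ℝ) (w : ι → J → ℝ) (ρ : ℝ) (hρ : 0 ≤ ρ) (hg : ∀ i, 0 ≤ g i)
    (hnw : ∀ i, 0 ≤ nw i) (hw : ∀ i, ∑ j, w i j ^ 2 = nw i ^ 2)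
    (hG : ∀ i, ∑ k, G i k ^ 2 ≤ ρ ^ 2) :
    ∑ k, (∑ i, g i * (G i k * nw i)) ^ 2 + ∑ j, (∑ i, g i * (ρ * w i j)) ^ 2
      ≤ ∑ p : I × J, (∑ i, g i * (G i p.1 * w i p.2)) ^ 2 + (∑ i, g i * (ρ * nw i)) ^ 2 := by
  have e4 : (∑ i, g i * (ρ * nw i)) ^ 2
      = ∑ i, ∑ l, (g i * (ρ * nw i)) * (g l * (ρ * nw l)) := by
    rw [pow_two, Finset.sum_mul_sum]
  rw [sum_sq_expand, sum_sq_expand, sum_sq_expand, e4, ← Finset.sum_add_distrib,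
    ← Finset.sum_add_distrib]
  refine Finset.sum_le_sum fun i _ => ?_
  rw [← Finset.sum_add_distrib, ← Finset.sum_add_distrib]
  refine Finset.sum_le_sum fun l _ => ?_
  have h1 : ∑ k, g i * (G i k * nw i) * (g l * (G l k * nw l))
      = g i * g l * (∑ k, G i k * G l k) * (nw i * nw l) := by
    simp only [Finset.mul_sum, Finset.sum_mul]
    exact Finset.sum_congr rfl fun k _ => by ring
  have h2 : ∑ j, g i * (ρ * w i j) * (g l * (ρ * w l j))
      = g i * g l * (∑ j, w i j * w l j) * ρ ^ 2 := by
    simp only [Finset.mul_sum, Finset.sum_mul]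
    exact Finset.sum_congr rfl fun k _ => by ring
  have h3 : ∑ p : I × J, g i * (G i p.1 * w i p.2) * (g l * (G l p.1 * w l p.2))
      = g i * g l * ((∑ k, G i k * G l k) * ∑ j, w i j * w l j) := by
    rw [Fintype.sum_prod_type, Finset.sum_mul_sum, Finset.mul_sum]
    refine Finset.sum_congr rfl fun k _ => ?_
    rw [Finset.mul_sum]
    exact Finset.sum_congr rfl fun j _ => by ring
  rw [h1, h2, h3]
  have c1 := inner_le_of_sq_sum (G i) (G l) hρ hρ (hG i) (hG l)
  have c2 := inner_le_of_sq_sum (w i) (w l) (hnw i) (hnw l) (hw i).le (hw l).le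
  have c3 := mul_nonneg (mul_nonneg (hg i) (hg l))
    (mul_nonneg (sub_nonneg.2 c1) (sub_nonneg.2 c2))
  nlinarith [c3]

/-- The comparison of expectations behind Gordon's inequality. -/
lemma gordon_softInd {ι I J : Type*} [Fintype ι] [Fintype I] [DecidableEq I] [Fintype J]
    (a t : ℝ) (ha : 0 ≤ a) (w : ι → J → ℝ) (nw : ι → ℝ) (hnw : ∀ i, 0 ≤ nw i)
    (hw : ∀ i, ∑ j, w i j ^ 2 = nw i ^ 2) (ρ : ℝ) (hρ : 0 ≤ ρ)
    (r : ι → (I → ℝ) → ℝ) (gr hs : ι → (I → ℝ) → I → ℝ)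
    (hr : ∀ i x, HasFDerivAt (r i) (∑ k, gr i x k • ContinuousLinearMap.proj (R := ℝ)
      (φ := fun _ : I => ℝ) k) x)
    (hg : ∀ i x k, HasDerivAt (fun s : ℝ => gr i (x + s • Pi.single k 1) k) (hs i x k) 0)
    (hgc : ∀ i k, Continuous fun x => gr i x k) (hhc : ∀ i k, Continuous fun x => hs i x k)
    (bg : ∀ i x, ∑ k, gr i x k ^ 2 ≤ ρ ^ 2) (m : ℝ) (bh : ∀ i x k, |hs i x k| ≤ m) :
    ∫ ω : I ⊕ J → ℝ, (1 + ∑ i, Real.exp (-a * (r i (fun k => nw i * ω (Sum.inl k))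
        + ρ * ∑ j, w i j * ω (Sum.inr j) - t)))⁻¹ ∂(stdPi (I ⊕ J))
      ≤ ∫ ω : (I × J) ⊕ Unit → ℝ, (1 + ∑ i, Real.exp (-a *
        (r i (fun k => ∑ j, w i j * ω (Sum.inl (k, j)))
        + ρ * (nw i * ω (Sum.inr ())) - t)))⁻¹ ∂(stdPi ((I × J) ⊕ Unit)) := by
  classical
  let R : ι → (Option I → ℝ) → ℝ := fun i x => r i (fun k => x (some k)) + ρ * x none
  let G : ι → (Option I → ℝ) → Option I → ℝ := fun i x k =>
    k.elim ρ fun k => gr i (fun k => x (some k)) k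
  let Hs : ι → (Option I → ℝ) → Option I → ℝ := fun i x k =>
    k.elim 0 fun k => hs i (fun k => x (some k)) k
  let P : (Option I → ℝ) →L[ℝ] (I → ℝ) := ContinuousLinearMap.pi fun k =>
    ContinuousLinearMap.proj (some k)
  have hR : ∀ i x, HasFDerivAt (R i) (∑ k, G i x k • ContinuousLinearMap.proj (R := ℝ)
      (φ := fun _ : Option I => ℝ) k) x := by
    intro i x
    have h1 := (hr i (P x)).comp x P.hasFDerivAt
    have h2 := ((ContinuousLinearMap.proj (R := ℝ)
      (φ := fun _ : Option I => ℝ) none).hasFDerivAt (x := x)).const_mul ρ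
    refine (h1.add h2).congr_fderiv ?_
    ext v
    simp [P, G, Fintype.sum_option, sum_apply, add_comm]
  have hG : ∀ i x k, HasDerivAt (fun s : ℝ => G i (x + s • Pi.single k 1) k) (Hs i x k) 0 := by
    rintro i x (_ | k)
    · exact hasDerivAt_const _ _
    · have h := hg i (fun k => x (some k)) k
      simp only [G, Hs, Option.elim]
      refine h.congr_of_eventuallyEq (Filter.Eventually.of_forall fun s => ?_)
      show gr i _ k = gr i _ k
      congr 1
      ext l
      simp [Pi.single_apply]
  have hGc : ∀ i k, Continuous fun x => G i x k := by
    rintro i (_ | k)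
    · exact continuous_const
    · exact (hgc i k).comp P.continuous
  have hHc : ∀ i k, Continuous fun x => Hs i x k := by
    rintro i (_ | k)
    · exact continuous_const
    · exact (hhc i k).comp P.continuous
  have bw : ∀ i j, |w i j| ≤ nw i := by
    intro i j
    refine abs_le_of_sq_le_sq ?_ (hnw i)
    rw [← hw i]
    exact Finset.single_le_sum (f := fun j => w i j ^ 2) (fun j _ => sq_nonneg _)
      (Finset.mem_univ j)
  let kA : (I × J) ⊕ Unit → Option I := Sum.elim (fun p => some p.1) fun _ => none
  let cA : (I × J) ⊕ Unit → ι → ℝ := Sum.elim (fun p i => w i p.2) fun _ => nw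
  let kB : I ⊕ J → Option I := Sum.elim some fun _ => none
  let cB : I ⊕ J → ι → ℝ := Sum.elim (fun _ => nw) fun j i => w i j
  let M : ℝ := ρ + |m| + ∑ i, nw i
  have hnM : ∀ i, nw i ≤ ∑ i, nw i := fun i =>
    Finset.single_le_sum (fun i _ => hnw i) (Finset.mem_univ i)
  have hn0 : 0 ≤ ∑ i, nw i := Finset.sum_nonneg fun i _ => hnw i
  have hm0 := abs_nonneg m
  have key := softInd_comparison a t ha R G Hs hR hG hGc hHc M (by positivity) ?_ ?_ kA cA kB cB
    ?_ ?_ ?_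
  · have eB : ∀ ω : I ⊕ J → ℝ, softInd a t R (gaussComb (fun j => dirVec (cB j) (kB j)) ω)
        = (1 + ∑ i, Real.exp (-a * (r i (fun k => nw i * ω (Sum.inl k))
        + ρ * ∑ j, w i j * ω (Sum.inr j) - t)))⁻¹ := by
      intro ω
      unfold softInd gibbs
      congr 2
      refine Finset.sum_congr rfl fun i _ => ?_
      congr 3
      simp only [R]
      congr 2
      · ext k
        simp [gaussComb, dirVec, kB, cB, Pi.single_apply, Finset.sum_apply, mul_comm]
      · simp [gaussComb, dirVec, kB, cB, Pi.single_apply, Finset.sum_apply, mul_comm]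
    have eA : ∀ ω : (I × J) ⊕ Unit → ℝ,
        softInd a t R (gaussComb (fun j => dirVec (cA j) (kA j)) ω)
        = (1 + ∑ i, Real.exp (-a *
        (r i (fun k => ∑ j, w i j * ω (Sum.inl (k, j)))
        + ρ * (nw i * ω (Sum.inr ())) - t)))⁻¹ := by
      intro ω
      unfold softInd gibbs
      congr 2
      refine Finset.sum_congr rfl fun i _ => ?_
      congr 3
      simp only [R]
      congr 2
      · ext k
        simp [gaussComb, dirVec, kA, cA, Pi.single_apply, Finset.sum_apply, mul_comm,
          Fintype.sum_prod_type]
      · simp [gaussComb, dirVec, kA, cA, Pi.single_apply, Finset.sum_apply, mul_comm]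
    simp only [eA, eB] at key
    exact key
  · rintro i x (_ | k)
    · simp only [G, Option.elim, M, abs_of_nonneg hρ]
      linarith
    · have : |gr i (fun k => x (some k)) k| ≤ ρ := by
        refine abs_le_of_sq_le_sq ?_ hρ
        refine le_trans ?_ (bg i fun k => x (some k))
        exact Finset.single_le_sum (f := fun k' => gr i (fun k => x (some k)) k' ^ 2)
          (fun j _ => sq_nonneg _) (Finset.mem_univ k)
      simp only [G, Option.elim, M]
      linarith
  · rintro i x (_ | k)
    · simp only [Hs, Option.elim, M, abs_zero]; positivity
    · have := bh i (fun k => x (some k)) k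
      simp only [Hs, Option.elim, M]
      linarith [le_abs_self m]
  · rintro (p | _) i
    · have := bw i p.2
      have := hnM i
      simp only [cA, Sum.elim_inl, M]; linarith
    · have := hnM i
      simp only [cA, Sum.elim_inr, M, abs_of_nonneg (hnw i)]; linarith
  · rintro (p | j) i
    · have := hnM i
      simp only [cB, Sum.elim_inl, M, abs_of_nonneg (hnw i)]; linarith
    · have := bw i j
      have := hnM i
      simp only [cB, Sum.elim_inr, M]; linarith
  · intro x
    have hp : 0 ≤ (1 + ∑ i, gibbs a t R x i)⁻¹ := by
      have := gibbs_sum_nonneg a t R x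
      positivity
    have hQ := gordon_algebra (fun i => gibbs a t R x i) nw
      (fun i k => gr i (fun k => x i (some k)) k) w ρ hρ (fun i => (gibbs_pos a t R x i).le) hnw hw
      (fun i => bg i _)
    have hS : ∀ k c, softHess a t R G Hs x k c =
        2 * ((1 + ∑ i, gibbs a t R x i)⁻¹) ^ 3 * a ^ 2 *
          (∑ i, gibbs a t R x i * (G i (x i) k * c i)) ^ 2
        - ((1 + ∑ i, gibbs a t R x i)⁻¹) ^ 2 * ∑ i, gibbs a t R x i *
          (a ^ 2 * G i (x i) k ^ 2 - a * Hs i (x i) k) * c i ^ 2 := by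
      intro k c
      unfold softHess
      have e1 : ∑ i, gibbs a t R x i * (-a * (G i (x i) k * c i))
          = -a * ∑ i, gibbs a t R x i * (G i (x i) k * c i) := by
        rw [Finset.mul_sum]
        exact Finset.sum_congr rfl fun i _ => by ring
      rw [e1]
      congr 1
      · ring
      · congr 1
        exact Finset.sum_congr rfl fun i _ => by ring
    have hT : ∑ j, ∑ i, gibbs a t R x i *
          (a ^ 2 * G i (x i) (kB j) ^ 2 - a * Hs i (x i) (kB j)) * cB j i ^ 2
        = ∑ j, ∑ i, gibbs a t R x i *
          (a ^ 2 * G i (x i) (kA j) ^ 2 - a * Hs i (x i) (kA j)) * cA j i ^ 2 := by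
      rw [Finset.sum_comm, Finset.sum_comm (s := (Finset.univ : Finset ((I × J) ⊕ Unit)))]
      refine Finset.sum_congr rfl fun i _ => ?_
      simp only [Fintype.sum_sum_type, Fintype.sum_prod_type, kA, kB, cA, cB, Sum.elim_inl,
        Sum.elim_inr, ← Finset.mul_sum, hw, Finset.univ_unique, Finset.sum_singleton]
    simp only [hS, Finset.sum_sub_distrib, ← Finset.mul_sum] at hT ⊢
    rw [hT]
    refine sub_le_sub_right (mul_le_mul_of_nonneg_left ?_ (by positivity)) _
    simp only [Fintype.sum_sum_type, kA, kB, cA, cB, G, Sum.elim_inl, Option.elim,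
        Sum.elim_inr, Finset.univ_unique, Finset.sum_singleton]
    exact hQ

lemma measure_real_le_of_softInd {X Y ι : Type*} [MeasurableSpace X] [MeasurableSpace Y]
    [Fintype ι] (μ : Measure X) (ν : Measure Y) [IsProbabilityMeasure μ] [IsProbabilityMeasure ν]
    (f : ι → X → ℝ) (g : ι → Y → ℝ) (hf : ∀ i, Measurable (f i)) (hg : ∀ i, Measurable (g i))
    (t η : ℝ) (hη : 0 < η)
    (h : ∀ a : ℝ, 0 ≤ a → ∫ y, (1 + ∑ i, Real.exp (-a * (g i y - t)))⁻¹ ∂ν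
      ≤ ∫ x, (1 + ∑ i, Real.exp (-a * (f i x - t)))⁻¹ ∂μ) :
    μ.real {x | ∃ i, f i x ≤ t - η} ≤ ν.real {y | ∃ i, g i y < t + η} := by
  set A := {x | ∃ i, f i x ≤ t - η}
  set B := {y | ∃ i, g i y < t + η}
  have mA : MeasurableSet A := by
    have : A = ⋃ i, {x | f i x ≤ t - η} := by ext; simp [A]
    rw [this]
    exact MeasurableSet.iUnion fun i => measurableSet_le (hf i) measurable_const
  have mB : MeasurableSet B := by
    have : B = ⋃ i, {x | g i x < t + η} := by ext; simp [B]
    rw [this]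
    exact MeasurableSet.iUnion fun i => measurableSet_lt (hg i) measurable_const
  have main : ∀ a : ℝ, 0 ≤ a → μ.real A - ν.real B
      ≤ (Fintype.card ι + 1) * Real.exp (-(a * η)) := by
    intro a ha
    have hp : 0 < Real.exp (-(a * η)) := Real.exp_pos _
    have hsum : ∀ u : ι → ℝ, 0 ≤ ∑ i, Real.exp (u i) := fun u =>
      Finset.sum_nonneg fun i _ => (Real.exp_pos _).le
    have iA : Integrable (fun x => 1 - A.indicator 1 x + Real.exp (-(a * η))) μ :=
      ((integrable_const 1).sub ((integrable_const (1 : ℝ)).indicator mA)).add (integrable_const _)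
    have iB : Integrable (fun x => 1 - B.indicator 1 x
        - Fintype.card ι * Real.exp (-(a * η))) ν :=
      ((integrable_const 1).sub ((integrable_const (1 : ℝ)).indicator mB)).sub (integrable_const _)
    have b0 : ∀ u : ι → ℝ, 0 ≤ (1 + ∑ i, Real.exp (u i))⁻¹ ∧
        (1 + ∑ i, Real.exp (u i))⁻¹ ≤ 1 := fun u => by
      have := hsum u
      exact ⟨by positivity, inv_le_one_of_one_le₀ (by linarith)⟩
    have iF : Integrable (fun x => (1 + ∑ i, Real.exp (-a * (f i x - t)))⁻¹) μ := by
      refine Integrable.of_bound (Measurable.aestronglyMeasurable (by fun_prop)) 1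
        (ae_of_all _ fun x => ?_)
      rw [Real.norm_eq_abs, abs_of_nonneg (b0 _).1]
      exact (b0 _).2
    have iG : Integrable (fun x => (1 + ∑ i, Real.exp (-a * (g i x - t)))⁻¹) ν := by
      refine Integrable.of_bound (Measurable.aestronglyMeasurable (by fun_prop)) 1
        (ae_of_all _ fun x => ?_)
      rw [Real.norm_eq_abs, abs_of_nonneg (b0 _).1]
      exact (b0 _).2
    have h1 : ∫ x, (1 + ∑ i, Real.exp (-a * (f i x - t)))⁻¹ ∂μ
        ≤ 1 - μ.real A + Real.exp (-(a * η)) := by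
      have e : ∫ x, (1 - A.indicator 1 x + Real.exp (-(a * η))) ∂μ
          = 1 - μ.real A + Real.exp (-(a * η)) := by
        rw [integral_add
          (by exact (integrable_const 1).sub ((integrable_const (1 : ℝ)).indicator mA))
          (integrable_const _), integral_sub (integrable_const 1)
          (by exact (integrable_const (1 : ℝ)).indicator mA), integral_indicator_one mA]
        simp
      rw [← e]
      refine integral_mono iF iA fun x => ?_
      by_cases hx : x ∈ A
      · simp only [Set.indicator_of_mem hx, Pi.one_apply]
        obtain ⟨i, hi⟩ := hx
        have h2 : Real.exp (a * η) ≤ ∑ i, Real.exp (-a * (f i x - t)) := by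
          refine le_trans ?_ (Finset.single_le_sum (f := fun i => Real.exp (-a * (f i x - t)))
            (fun i _ => (Real.exp_pos _).le) (Finset.mem_univ i))
          rw [Real.exp_le_exp]
          nlinarith
        rw [sub_self, zero_add, Real.exp_neg]
        exact inv_anti₀ (Real.exp_pos _) (by linarith)
      · simp only [Set.indicator_of_notMem hx]
        have := (b0 fun i => -a * (f i x - t)).2
        linarith
    have h2 : 1 - ν.real B - Fintype.card ι * Real.exp (-(a * η))
        ≤ ∫ y, (1 + ∑ i, Real.exp (-a * (g i y - t)))⁻¹ ∂ν := by
      have e : ∫ x, (1 - B.indicator 1 x - Fintype.card ι * Real.exp (-(a * η))) ∂ν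
          = 1 - ν.real B - Fintype.card ι * Real.exp (-(a * η)) := by
        rw [integral_sub
          (by exact (integrable_const 1).sub ((integrable_const (1 : ℝ)).indicator mB))
          (integrable_const _), integral_sub (integrable_const 1)
          (by exact (integrable_const (1 : ℝ)).indicator mB), integral_indicator_one mB]
        simp
      rw [← e]
      refine integral_mono iB iG fun x => ?_
      by_cases hx : x ∈ B
      · simp only [Set.indicator_of_mem hx, Pi.one_apply]
        have := (b0 fun i => -a * (g i x - t)).1
        have : 0 ≤ Fintype.card ι * Real.exp (-(a * η)) := by positivity
        linarith
      · simp only [Set.indicator_of_notMem hx]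
        have hx' : ∀ i, t + η ≤ g i x := by
          intro i
          by_contra hcon
          exact hx ⟨i, not_le.1 hcon⟩
        have h3 : ∑ i, Real.exp (-a * (g i x - t)) ≤ Fintype.card ι * Real.exp (-(a * η)) := by
          have : ∑ i, Real.exp (-a * (g i x - t)) ≤ ∑ _i : ι, Real.exp (-(a * η)) := by
            refine Finset.sum_le_sum fun i _ => ?_
            rw [Real.exp_le_exp]
            nlinarith [hx' i]
          simpa using this
        have h4 : ∀ S : ℝ, 0 ≤ S → 1 - S ≤ (1 + S)⁻¹ := by
          intro S hS
          rw [← one_div, le_div_iff₀ (by positivity)]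
          nlinarith
        have := h4 _ (hsum fun i => -a * (g i x - t))
        linarith
    have := h a ha
    linarith
  have lim : Filter.Tendsto (fun a : ℝ => ((Fintype.card ι : ℝ) + 1) * Real.exp (-(a * η)))
      Filter.atTop (nhds (((Fintype.card ι : ℝ) + 1) * 0)) := by
    refine Filter.Tendsto.const_mul _ ?_
    exact Real.tendsto_exp_neg_atTop_nhds_zero.comp
      (Filter.tendsto_id.atTop_mul_const hη)
  rw [mul_zero] at lim
  have := ge_of_tendsto lim ((Filter.eventually_ge_atTop 0).mono main)
  linarith

lemma stdG_Iic_zero : (1 / 2 : ℝ) ≤ stdG.real (Set.Iic 0) := by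
  have h1 : stdG.real (Set.Ici 0) = stdG.real (Set.Iic 0) := by
    have h : stdG.map (fun x => -x) = stdG := by
      unfold stdG
      rw [gaussianReal_map_neg]; simp
    conv_lhs => rw [← h]
    rw [map_measureReal_apply measurable_neg measurableSet_Ici]
    congr 1
    ext x; simp
  have h2 : stdG.real (Set.Iic 0 ∪ Set.Ici 0) ≤ _ := measureReal_union_le _ _
  rw [Set.Iic_union_Ici, probReal_univ] at h2
  linarith

/-- Gordon's inequality for a finite family. -/
lemma gordon_finite {ι I J : Type*} [Fintype ι] [Fintype I] [Fintype J]
    (w : ι → J → ℝ) (nw : ι → ℝ) (hnw : ∀ i, 0 ≤ nw i)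
    (hw : ∀ i, ∑ j, w i j ^ 2 = nw i ^ 2) (ρ : ℝ) (hρ : 0 ≤ ρ)
    (r : ι → (I → ℝ) → ℝ) (gr hs : ι → (I → ℝ) → I → ℝ)
    (hr : ∀ i x, HasFDerivAt (r i) (∑ k, gr i x k • ContinuousLinearMap.proj (R := ℝ)
      (φ := fun _ : I => ℝ) k) x)
    (hg : ∀ [DecidableEq I], ∀ i x k,
      HasDerivAt (fun s : ℝ => gr i (x + s • Pi.single k 1) k) (hs i x k) 0)
    (hgc : ∀ i k, Continuous fun x => gr i x k) (hhc : ∀ i k, Continuous fun x => hs i x k)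
    (bg : ∀ i x, ∑ k, gr i x k ^ 2 ≤ ρ ^ 2) (m : ℝ) (bh : ∀ i x k, |hs i x k| ≤ m)
    (s u : ℝ) (hsu : s < u) :
    (stdPi (I × J)).real {ω | ∃ i, r i (fun k => ∑ j, w i j * ω (k, j)) ≤ s}
      ≤ 2 * (stdPi (I ⊕ J)).real {ω | ∃ i, r i (fun k => nw i * ω (Sum.inl k))
        + ρ * ∑ j, w i j * ω (Sum.inr j) < u} := by
  classical
  have hrc : ∀ i, Continuous (r i) := fun i =>
    continuous_iff_continuousAt.2 fun x => (hr i x).continuousAt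
  have c1 : ∀ i, Continuous fun ω : (I × J) ⊕ Unit → ℝ =>
      r i (fun k => ∑ j, w i j * ω (Sum.inl (k, j))) := fun i => (hrc i).comp (by fun_prop)
  have c2 : ∀ i, Continuous fun ω : I ⊕ J → ℝ =>
      r i (fun k => nw i * ω (Sum.inl k)) := fun i => (hrc i).comp (by fun_prop)
  have key := measure_real_le_of_softInd (stdPi ((I × J) ⊕ Unit)) (stdPi (I ⊕ J))
    (fun i ω => r i (fun k => ∑ j, w i j * ω (Sum.inl (k, j))) + ρ * (nw i * ω (Sum.inr ())))
    (fun i ω => r i (fun k => nw i * ω (Sum.inl k)) + ρ * ∑ j, w i j * ω (Sum.inr j))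
    (fun i => ((c1 i).add (by fun_prop)).measurable)
    (fun i => ((c2 i).add (by fun_prop)).measurable)
    ((s + u) / 2) ((u - s) / 2) (by linarith)
    (fun a ha => gordon_softInd a _ ha w nw hnw hw ρ hρ r gr hs hr hg hgc hhc bg m bh)
  have e1 : (s + u) / 2 - (u - s) / 2 = s := by ring
  have e2 : (s + u) / 2 + (u - s) / 2 = u := by ring
  rw [e1, e2] at key
  have mp := measurePreserving_sumPiEquivProdPi (fun _ : (I × J) ⊕ Unit => stdG)
  set A : Set (I × J → ℝ) := {ω | ∃ i, r i (fun k => ∑ j, w i j * ω (k, j)) ≤ s}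
  have mA : MeasurableSet A := by
    have : A = ⋃ i, {ω | r i (fun k => ∑ j, w i j * ω (k, j)) ≤ s} := by ext; simp [A]
    rw [this]
    exact MeasurableSet.iUnion fun i =>
      measurableSet_le ((hrc i).comp (by fun_prop)).measurable measurable_const
  have hN : MeasurePreserving (fun ω : Unit → ℝ => ω ()) (stdPi Unit) stdG :=
    measurePreserving_eval (fun _ : Unit => stdG) ()
  have hN0 : (1 / 2 : ℝ) ≤ (stdPi Unit).real ((fun ω : Unit → ℝ => ω ()) ⁻¹' Set.Iic 0) := by
    rw [measureReal_def, hN.measure_preimage measurableSet_Iic.nullMeasurableSet]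
    exact stdG_Iic_zero
  have mprod : (stdPi ((I × J) ⊕ Unit)).real {ω | (fun p => ω (Sum.inl p)) ∈ A ∧
      ω (Sum.inr ()) ≤ 0}
      = (stdPi (I × J)).real A *
        (stdPi Unit).real ((fun ω : Unit → ℝ => ω ()) ⁻¹' Set.Iic 0) := by
    rw [measureReal_def, measureReal_def, measureReal_def, ← ENNReal.toReal_mul]
    congr 1
    have hm : MeasurableSet (A ×ˢ ((fun ω : Unit → ℝ => ω ()) ⁻¹' Set.Iic 0)) :=
      mA.prod (hN.measurable measurableSet_Iic)
    have h3 := mp.measure_preimage hm.nullMeasurableSet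
    rw [Measure.prod_prod] at h3
    exact h3
  have hsub : (stdPi ((I × J) ⊕ Unit)).real {ω | (fun p => ω (Sum.inl p)) ∈ A ∧
      ω (Sum.inr ()) ≤ 0} ≤ (stdPi ((I × J) ⊕ Unit)).real {ω | ∃ i,
      r i (fun k => ∑ j, w i j * ω (Sum.inl (k, j))) + ρ * (nw i * ω (Sum.inr ())) ≤ s} := by
    refine measureReal_mono ?_
    rintro ω ⟨⟨i, hi⟩, h0⟩
    refine ⟨i, ?_⟩
    have := mul_nonpos_of_nonneg_of_nonpos (mul_nonneg hρ (hnw i)) h0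
    linarith
  have hA0 : 0 ≤ (stdPi (I × J)).real A := measureReal_nonneg
  nlinarith

/-- Gordon's inequality for a separable index set. -/
theorem gordon {W I J : Type*} [TopologicalSpace W] [TopologicalSpace.SeparableSpace W]
    [Fintype I] [Fintype J]
    (w : W → J → ℝ) (nw : W → ℝ) (hnw : ∀ i, 0 ≤ nw i)
    (hw : ∀ i, ∑ j, w i j ^ 2 = nw i ^ 2) (ρ : ℝ) (hρ : 0 ≤ ρ)
    (r : W → (I → ℝ) → ℝ) (gr hs : W → (I → ℝ) → I → ℝ)
    (hr : ∀ i x, HasFDerivAt (r i) (∑ k, gr i x k • ContinuousLinearMap.proj (R := ℝ)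
      (φ := fun _ : I => ℝ) k) x)
    (hg : ∀ [DecidableEq I], ∀ i x k,
      HasDerivAt (fun s : ℝ => gr i (x + s • Pi.single k 1) k) (hs i x k) 0)
    (hgc : ∀ i k, Continuous fun x => gr i x k) (hhc : ∀ i k, Continuous fun x => hs i x k)
    (bg : ∀ i x, ∑ k, gr i x k ^ 2 ≤ ρ ^ 2) (m : ℝ) (bh : ∀ i x k, |hs i x k| ≤ m)
    (hcont : ∀ ω : I × J → ℝ, Continuous fun i => r i (fun k => ∑ j, w i j * ω (k, j)))
    (s u : ℝ) (hsu : s < u) :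
    (stdPi (I × J)).real {ω | ∃ i, r i (fun k => ∑ j, w i j * ω (k, j)) < s}
      ≤ 2 * (stdPi (I ⊕ J)).real {ω | ∃ i, r i (fun k => nw i * ω (Sum.inl k))
        + ρ * ∑ j, w i j * ω (Sum.inr j) < u} := by
  rcases isEmpty_or_nonempty W with hW | hW
  · simp
  let d := TopologicalSpace.denseSeq W
  let E : ℕ → Set (I × J → ℝ) := fun n =>
    {ω | ∃ i : Fin n, r (d i) (fun k => ∑ j, w (d i) j * ω (k, j)) ≤ s}
  have hmono : Monotone E := by
    rintro n n' hn ω ⟨i, hi⟩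
    exact ⟨Fin.castLE hn i, hi⟩
  have hsub : {ω | ∃ i, r i (fun k => ∑ j, w i j * ω (k, j)) < s} ⊆ ⋃ n, E n := by
    rintro ω ⟨i, hi⟩
    have ho : IsOpen {i | r i (fun k => ∑ j, w i j * ω (k, j)) < s} :=
      isOpen_lt (hcont ω) continuous_const
    obtain ⟨n, hn⟩ := (TopologicalSpace.denseRange_denseSeq W).exists_mem_open ho ⟨i, hi⟩
    exact Set.mem_iUnion.2 ⟨n + 1, ⟨⟨n, by omega⟩, le_of_lt hn⟩⟩
  refine (measureReal_mono hsub).trans ?_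
  rw [measureReal_def]
  have hlim := tendsto_measure_iUnion_atTop (μ := stdPi (I × J)) hmono
  have hlim' := (ENNReal.tendsto_toReal (measure_ne_top _ _)).comp hlim
  refine le_of_tendsto hlim' (Filter.Eventually.of_forall fun n => ?_)
  have := gordon_finite (fun i : Fin n => w (d i)) (fun i => nw (d i)) (fun i => hnw _)
    (fun i => hw _) ρ hρ (fun i => r (d i)) (fun i => gr (d i)) (fun i => hs (d i))
    (fun i => hr _) (fun i => hg _) (fun i => hgc _) (fun i => hhc _) (fun i => bg _) m
    (fun i => bh _) s u hsu
  refine this.trans ?_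
  refine mul_le_mul_of_nonneg_left (measureReal_mono ?_) (by norm_num)
  rintro ω ⟨i, hi⟩
  exact ⟨d i, hi⟩

section SmoothNorm

variable {I : Type*} [Fintype I] (κ e : ℝ) (m c p : I → ℝ)

/-- The smoothed Euclidean norm of `m x - p`. -/
def smoothNorm (x : I → ℝ) : ℝ := √(∑ k, (m k * x k - p k) ^ 2 + e ^ 2)

lemma smoothNorm_pos (he : 0 < e) (x : I → ℝ) : 0 < smoothNorm e m p x :=
  Real.sqrt_pos.2 (add_pos_of_nonneg_of_pos (Finset.sum_nonneg fun _ _ => sq_nonneg _)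
    (pow_pos he 2))

lemma smoothNorm_sq (x : I → ℝ) :
    smoothNorm e m p x ^ 2 = ∑ k, (m k * x k - p k) ^ 2 + e ^ 2 :=
  Real.sq_sqrt (add_nonneg (Finset.sum_nonneg fun _ _ => sq_nonneg _) (sq_nonneg _))

lemma le_smoothNorm (x : I → ℝ) : e ≤ smoothNorm e m p x :=
  Real.le_sqrt_of_sq_le (le_add_of_nonneg_left (Finset.sum_nonneg fun _ _ => sq_nonneg _))

lemma sqrt_le_smoothNorm (x : I → ℝ) :
    √(∑ k, (m k * x k - p k) ^ 2) ≤ smoothNorm e m p x :=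
  Real.sqrt_le_sqrt (le_add_of_nonneg_right (sq_nonneg _))

lemma smoothNorm_le (he : 0 < e) (x : I → ℝ) :
    smoothNorm e m p x ≤ √(∑ k, (m k * x k - p k) ^ 2) + e := by
  refine Real.sqrt_le_iff.2 ⟨by positivity, ?_⟩
  have h := Real.sq_sqrt (Finset.sum_nonneg fun k (_ : k ∈ Finset.univ) =>
    sq_nonneg (m k * x k - p k))
  have := Real.sqrt_nonneg (∑ k, (m k * x k - p k) ^ 2)
  nlinarith

lemma continuous_smoothNorm : Continuous (smoothNorm e m p) := by
  unfold smoothNorm; fun_prop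

/-- Gradient of `κ * smoothNorm + c · x`. -/
def smoothNormGrad (x : I → ℝ) (k : I) : ℝ :=
  κ * (m k * (m k * x k - p k)) / smoothNorm e m p x + c k

/-- Diagonal of the Hessian of `κ * smoothNorm`. -/
def smoothNormHess (x : I → ℝ) (k : I) : ℝ :=
  κ * m k ^ 2 * (1 / smoothNorm e m p x - (m k * x k - p k) ^ 2 / smoothNorm e m p x ^ 3)

lemma hasFDerivAt_smoothNorm (he : 0 < e) (ψ : ℝ) (x : I → ℝ) :
    HasFDerivAt (fun x => κ * smoothNorm e m p x + ∑ k, c k * x k + ψ)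
      (∑ k, smoothNormGrad κ e m c p x k • ContinuousLinearMap.proj (R := ℝ)
      (φ := fun _ : I => ℝ) k) x := by
  have hS := smoothNorm_pos e m p he x
  have hp : ∀ k, HasFDerivAt (fun x : I → ℝ => x k)
      (ContinuousLinearMap.proj (R := ℝ) (φ := fun _ : I => ℝ) k) x := fun k =>
    (ContinuousLinearMap.proj (R := ℝ) (φ := fun _ : I => ℝ) k).hasFDerivAt
  have h1 : HasFDerivAt (fun x : I → ℝ => ∑ k, (m k * x k - p k) ^ 2 + e ^ 2) _ x :=
    (HasFDerivAt.fun_sum fun k _ => (((hp k).const_mul (m k)).sub_const (p k)).pow 2).add_const _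
  have h2 := h1.sqrt (by rw [← smoothNorm_sq]; positivity)
  have h3 : HasFDerivAt (fun x : I → ℝ => ∑ k, c k * x k) _ x :=
    HasFDerivAt.fun_sum fun k _ => (hp k).const_mul (c k)
  have h4 := ((h2.const_mul κ).add h3).add_const ψ
  refine h4.congr_fderiv ?_
  have : √(∑ k, (m k * x k - p k) ^ 2 + e ^ 2) = smoothNorm e m p x := rfl
  rw [this, Finset.smul_sum, Finset.smul_sum, ← Finset.sum_add_distrib]
  refine Finset.sum_congr rfl fun k _ => ?_
  rw [smul_smul, smul_smul, smul_smul, ← add_smul]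
  congr 1
  unfold smoothNormGrad
  field_simp
  try simp
  try ring

lemma hasDerivAt_smoothNormGrad [DecidableEq I] (he : 0 < e) (x : I → ℝ) (k : I) :
    HasDerivAt (fun s : ℝ => smoothNormGrad κ e m c p (x + s • Pi.single k 1) k)
      (smoothNormHess κ e m p x k) 0 := by
  have hS := smoothNorm_pos e m p he x
  have hx : ∀ i, HasDerivAt (fun s : ℝ => m i * (x + s • (Pi.single k 1 : I → ℝ)) i - p i)
      (m i * (Pi.single k 1 : I → ℝ) i) 0 := by
    intro i
    have h0 : HasDerivAt (fun s : ℝ => x i + s * (Pi.single k 1 : I → ℝ) i)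
      (1 * (Pi.single k 1 : I → ℝ) i) 0 := ((hasDerivAt_id' 0).mul_const _).const_add _
    simpa using (h0.const_mul (m i)).sub_const (p i)
  have h1 : HasDerivAt (fun s : ℝ => ∑ i, (m i * (x + s • (Pi.single k 1 : I → ℝ)) i - p i) ^ 2
      + e ^ 2) _ 0 := (HasDerivAt.fun_sum fun i _ => (hx i).pow 2).add_const _
  have e0 : ∑ i, (m i * (x + (0 : ℝ) • (Pi.single k 1 : I → ℝ)) i - p i) ^ 2 + e ^ 2
      = smoothNorm e m p x ^ 2 := by rw [smoothNorm_sq]; simp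
  have h2 := h1.sqrt (by rw [e0]; positivity)
  rw [e0, Real.sqrt_sq hS.le] at h2
  have h3 := ((((hx k).const_mul (m k)).const_mul κ).div h2 (by
    rw [e0, Real.sqrt_sq hS.le]; exact hS.ne')).add_const (c k)
  rw [e0, Real.sqrt_sq hS.le] at h3
  refine h3.congr_deriv ?_
  have hs : ∑ i, (2 : ℕ) * (m i * (x + (0 : ℝ) • (Pi.single k 1 : I → ℝ)) i - p i) ^ (2 - 1) *
      (m i * (Pi.single k 1 : I → ℝ) i) = 2 * (m k * x k - p k) * m k := by
    rw [Finset.sum_eq_single k]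
    · simp
    · intro i _ hi
      simp [Pi.single_eq_of_ne hi]
    · simp
  rw [hs]
  unfold smoothNormHess
  simp only [Pi.single_eq_same, Pi.add_apply, zero_smul, Pi.zero_apply, add_zero, mul_one]
  field_simp

lemma sum_smoothNormGrad_sq_le (he : 0 < e) (M ρ : ℝ) (hmc : ∀ k, m k * c k = 0)
    (hM : ∀ k, (κ * m k) ^ 2 ≤ M) (hρ : M + ∑ k, c k ^ 2 ≤ ρ ^ 2) (hM0 : 0 ≤ M) (x : I → ℝ) :
    ∑ k, smoothNormGrad κ e m c p x k ^ 2 ≤ ρ ^ 2 := by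
  have hS := smoothNorm_pos e m p he x
  refine le_trans ?_ hρ
  have h1 : ∀ k, smoothNormGrad κ e m c p x k ^ 2
      ≤ M / smoothNorm e m p x ^ 2 * (m k * x k - p k) ^ 2 + c k ^ 2 := by
    intro k
    have e1 : smoothNormGrad κ e m c p x k ^ 2 = (κ * m k) ^ 2 / smoothNorm e m p x ^ 2
        * (m k * x k - p k) ^ 2 + c k ^ 2
        + 2 * κ * (m k * c k) * (m k * x k - p k) / smoothNorm e m p x := by
      unfold smoothNormGrad
      field_simp
      ring
    rw [e1, hmc]
    have := hM k
    simp only [mul_zero, zero_mul, zero_div, add_zero]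
    gcongr
  refine (Finset.sum_le_sum fun k _ => h1 k).trans ?_
  rw [Finset.sum_add_distrib, ← Finset.mul_sum]
  have h2 : ∑ k, (m k * x k - p k) ^ 2 ≤ smoothNorm e m p x ^ 2 := by
    rw [smoothNorm_sq]; nlinarith [sq_nonneg e]
  have h3 : M / smoothNorm e m p x ^ 2 * ∑ k, (m k * x k - p k) ^ 2
      ≤ M / smoothNorm e m p x ^ 2 * smoothNorm e m p x ^ 2 := by gcongr
  have h4 : M / smoothNorm e m p x ^ 2 * smoothNorm e m p x ^ 2 = M := by field_simp
  linarith

lemma abs_smoothNormHess_le (hκ : 0 ≤ κ) (he : 0 < e) (x : I → ℝ) (k : I) :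
    |smoothNormHess κ e m p x k| ≤ κ * (∑ i, m i ^ 2) / e := by
  have hS := smoothNorm_pos e m p he x
  have hSe := le_smoothNorm e m p x
  have h1 : (m k * x k - p k) ^ 2 ≤ smoothNorm e m p x ^ 2 := by
    rw [smoothNorm_sq]
    have := Finset.single_le_sum (f := fun k => (m k * x k - p k) ^ 2)
      (fun i _ => sq_nonneg _) (Finset.mem_univ k)
    nlinarith [sq_nonneg e]
  have h2 : (m k * x k - p k) ^ 2 / smoothNorm e m p x ^ 3 ≤ 1 / smoothNorm e m p x := by
    rw [div_le_div_iff₀ (by positivity) hS]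
    nlinarith
  have h3 : 0 ≤ (m k * x k - p k) ^ 2 / smoothNorm e m p x ^ 3 := by positivity
  have h4 : 1 / smoothNorm e m p x ≤ 1 / e := one_div_le_one_div_of_le he hSe
  have h5 : m k ^ 2 ≤ ∑ i, m i ^ 2 :=
    Finset.single_le_sum (f := fun k => m k ^ 2) (fun i _ => sq_nonneg _) (Finset.mem_univ k)
  have h6 : 0 ≤ κ * m k ^ 2 := by positivity
  unfold smoothNormHess
  rw [abs_of_nonneg (mul_nonneg h6 (by linarith))]
  calc _ ≤ κ * m k ^ 2 * (1 / e) := by gcongr; linarith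
    _ ≤ κ * (∑ i, m i ^ 2) * (1 / e) := by gcongr
    _ = _ := by ring

end SmoothNorm

/-- Gordon's inequality for Euclidean norms of affine images of the Gaussian matrix. -/
theorem gordon_norm {W I J : Type*} [TopologicalSpace W] [TopologicalSpace.SeparableSpace W]
    [Fintype I] [Fintype J]
    (w : W → J → ℝ) (nw : W → ℝ) (hnw : ∀ i, 0 ≤ nw i)
    (hw : ∀ i, ∑ j, w i j ^ 2 = nw i ^ 2) (κ ρ M : ℝ) (hκ : 0 ≤ κ) (hρ : 0 ≤ ρ)
    (m c : I → ℝ) (p : W → I → ℝ) (ψ : W → ℝ)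
    (hwc : ∀ j, Continuous fun i => w i j) (hpc : ∀ k, Continuous fun i => p i k)
    (hψ : Continuous ψ) (hmc : ∀ k, m k * c k = 0) (hM : ∀ k, (κ * m k) ^ 2 ≤ M) (hM0 : 0 ≤ M)
    (hMρ : M + ∑ k, c k ^ 2 ≤ ρ ^ 2) (s u : ℝ) (hsu : s < u) :
    (stdPi (I × J)).real {ω | ∃ i, κ * √(∑ k, (m k * ∑ j, w i j * ω (k, j) - p i k) ^ 2)
        + ∑ k, c k * ∑ j, w i j * ω (k, j) + ψ i < s}
      ≤ 2 * (stdPi (I ⊕ J)).real {ω | ∃ i, κ * √(∑ k, (m k * (nw i * ω (Sum.inl k)) - p i k) ^ 2)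
        + ∑ k, c k * (nw i * ω (Sum.inl k)) + ψ i + ρ * ∑ j, w i j * ω (Sum.inr j) < u} := by
  set e : ℝ := (u - s) / (2 * (κ + 1)) with he
  have he0 : 0 < e := div_pos (by linarith) (by linarith)
  have hke : κ * e ≤ (u - s) / 2 := by
    rw [he, ← mul_div_assoc, div_le_div_iff₀ (by linarith) (by norm_num)]
    nlinarith
  have hcS : ∀ i, Continuous (smoothNorm e m (p i)) := fun i => continuous_smoothNorm _ _ _
  have hnS : ∀ i x, smoothNorm e m (p i) x ≠ 0 := fun i x => (smoothNorm_pos e m (p i) he0 x).ne'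
  have key := gordon w nw hnw hw ρ hρ
    (fun i x => κ * smoothNorm e m (p i) x + ∑ k, c k * x k + ψ i)
    (fun i => smoothNormGrad κ e m c (p i)) (fun i => smoothNormHess κ e m (p i))
    (fun i x => hasFDerivAt_smoothNorm κ e m c (p i) he0 (ψ i) x)
    (fun i x k => hasDerivAt_smoothNormGrad κ e m c (p i) he0 x k)
    (fun i k => by
      unfold smoothNormGrad
      have := hcS i
      exact Continuous.add (Continuous.div (by fun_prop) this (hnS i)) continuous_const)
    (fun i k => by
      unfold smoothNormHess
      have := hcS i
      exact continuous_const.mul ((Continuous.div continuous_const this (hnS i)).sub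
        (Continuous.div (by fun_prop) (this.pow 3) (fun x => pow_ne_zero _ (hnS i x)))))
    (fun i x => sum_smoothNormGrad_sq_le κ e m c (p i) he0 M ρ hmc hM hMρ hM0 x)
    (κ * (∑ i, m i ^ 2) / e) (fun i x k => abs_smoothNormHess_le κ e m (p i) hκ he0 x k)
    (fun ω => by unfold smoothNorm; fun_prop) ((s + u) / 2) u (by linarith)
  refine (measureReal_mono ?_).trans (key.trans ?_)
  · rintro ω ⟨i, hi⟩
    refine ⟨i, ?_⟩
    have := mul_le_mul_of_nonneg_left (smoothNorm_le e m (p i) he0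
      (fun k => ∑ j, w i j * ω (k, j))) hκ
    simp only at this ⊢
    linarith
  · refine mul_le_mul_of_nonneg_left (measureReal_mono ?_) (by norm_num)
    rintro ω ⟨i, hi⟩
    refine ⟨i, ?_⟩
    have := mul_le_mul_of_nonneg_left (sqrt_le_smoothNorm e m (p i)
      (fun k => nw i * ω (Sum.inl k))) hκ
    simp only at this hi ⊢
    linarith

lemma exp_le_one_add_add_sq_mul_exp_abs (x : ℝ) :
    Real.exp x ≤ 1 + x + x ^ 2 * Real.exp |x| := by
  have h := Complex.norm_exp_sub_sum_le_norm_mul_exp (x : ℂ) 2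
  rw [Finset.sum_range_succ, Finset.sum_range_one] at h
  simp only [pow_zero, Nat.factorial, Nat.cast_one, div_one, pow_one, Complex.norm_real,
    Real.norm_eq_abs, sq_abs] at h
  have h1 : (Complex.exp x - (1 + x / ((0 + 1) * 1 : ℕ)) : ℂ)
      = ((Real.exp x - (1 + x) : ℝ) : ℂ) := by push_cast; simp
  rw [h1, Complex.norm_real, Real.norm_eq_abs] at h
  linarith [le_abs_self (Real.exp x - (1 + x))]

lemma sq_mul_exp_le {a s y x : ℝ} (ha : 0 < a) (hy : |y| ≤ a * (1 + x ^ 2))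
    (hs : |s| ≤ 1 / (8 * a)) :
    y ^ 2 * Real.exp |s * y| ≤ 256 * a ^ 2 * Real.exp (1 / 4) * Real.exp (x ^ 2 / 4) := by
  have hx : 0 < 1 + x ^ 2 := by positivity
  have h1 : y ^ 2 ≤ a ^ 2 * (1 + x ^ 2) ^ 2 := by
    rw [← mul_pow, ← sq_abs y]; gcongr
  have h2 : (1 + x ^ 2) ^ 2 ≤ 256 * Real.exp ((1 + x ^ 2) / 8) := by
    have h3 : (1 + x ^ 2) / 16 ≤ Real.exp ((1 + x ^ 2) / 16) := by
      linarith [Real.add_one_le_exp ((1 + x ^ 2) / 16)]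
    have h4 : ((1 + x ^ 2) / 16) ^ 2 ≤ Real.exp ((1 + x ^ 2) / 16) ^ 2 := by gcongr
    rw [← Real.exp_nat_mul] at h4
    have : ((2 : ℕ) : ℝ) * ((1 + x ^ 2) / 16) = (1 + x ^ 2) / 8 := by push_cast; ring
    rw [this] at h4
    nlinarith
  have h5 : |s * y| ≤ (1 + x ^ 2) / 8 := by
    rw [abs_mul]
    calc |s| * |y| ≤ 1 / (8 * a) * (a * (1 + x ^ 2)) := by gcongr
      _ = _ := by field_simp
  calc y ^ 2 * Real.exp |s * y|
      ≤ a ^ 2 * (256 * Real.exp ((1 + x ^ 2) / 8)) * Real.exp ((1 + x ^ 2) / 8) := by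
        gcongr
        exact h1.trans (by gcongr)
    _ = 256 * a ^ 2 * (Real.exp ((1 + x ^ 2) / 8) * Real.exp ((1 + x ^ 2) / 8)) := by ring
    _ = _ := by rw [← Real.exp_add, mul_assoc _ (Real.exp (1 / 4)), ← Real.exp_add]; ring_nf

lemma abs_stdG_integral_le {A : ℝ} {F : ℝ → ℝ}
    (hA : ∀ x, |F x| ≤ A * (1 + x ^ 2)) : |∫ x, F x ∂stdG| ≤ 2 * A := by
  have i2 : Integrable (fun x : ℝ => x ^ 2) stdG :=
    stdG_integrable_of_quadratic (by fun_prop) 1 fun x => by rw [abs_of_nonneg] <;> nlinarith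
  have : ∫ x, A * (1 + x ^ 2) ∂stdG = 2 * A := by
    rw [integral_const_mul, integral_add (integrable_const _) i2, stdG_integral_sq]
    simp; ring
  rw [← this, ← Real.norm_eq_abs]
  exact norm_integral_le_of_norm_le (((integrable_const 1).add i2).const_mul A)
    (ae_of_all _ hA)

/-- Sub-exponential bound for functions of quadratic growth of a Gaussian. -/
lemma stdG_centered_mgf_le (A : ℝ) (hA : 0 < A) : ∃ s0 K : ℝ, 0 < s0 ∧ 0 < K ∧
    ∀ F : ℝ → ℝ, Measurable F → (∀ x, |F x| ≤ A * (1 + x ^ 2)) → ∀ s, |s| ≤ s0 →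
      Integrable (fun x => Real.exp (s * (F x - ∫ y, F y ∂stdG))) stdG ∧
      ∫ x, Real.exp (s * (F x - ∫ y, F y ∂stdG)) ∂stdG ≤ Real.exp (K * s ^ 2) := by
  set a := 3 * A
  have ha : 0 < a := by positivity
  set B := 256 * a ^ 2 * Real.exp (1 / 4)
  have hB : 0 < B := by positivity
  have hE : 0 < ∫ x, Real.exp (x ^ 2 / 4) ∂stdG := integral_exp_pos stdG_integrable_exp_sq
  refine ⟨1 / (8 * a), B * ∫ x, Real.exp (x ^ 2 / 4) ∂stdG, by positivity, by positivity, ?_⟩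
  intro F hF hFA s hs
  set μ := ∫ y, F y ∂stdG
  have hμ : |μ| ≤ 2 * A := abs_stdG_integral_le hFA
  have hY : ∀ x, |F x - μ| ≤ a * (1 + x ^ 2) := by
    intro x
    have := abs_sub (F x) μ
    have := hFA x
    nlinarith [sq_nonneg x, mul_nonneg hA.le (sq_nonneg x)]
  have hpt : ∀ x, Real.exp (s * (F x - μ)) ≤ 1 + s * (F x - μ)
      + s ^ 2 * (B * Real.exp (x ^ 2 / 4)) := by
    intro x
    have h1 := exp_le_one_add_add_sq_mul_exp_abs (s * (F x - μ))
    have h2 := sq_mul_exp_le ha (hY x) hs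
    have h3 := mul_le_mul_of_nonneg_left h2 (sq_nonneg s)
    rw [mul_pow, mul_assoc] at h1
    linarith
  have iF : Integrable F stdG := stdG_integrable_of_quadratic hF.aestronglyMeasurable A hFA
  have iY : Integrable (fun x => F x - μ) stdG := iF.sub (integrable_const _)
  have iR : Integrable (fun x => 1 + s * (F x - μ) + s ^ 2 * (B * Real.exp (x ^ 2 / 4))) stdG :=
    ((integrable_const 1).add (iY.const_mul s)).add ((stdG_integrable_exp_sq.const_mul B).const_mul _)
  have iL : Integrable (fun x => Real.exp (s * (F x - μ))) stdG := by
    refine iR.mono' (by fun_prop) (ae_of_all _ fun x => ?_)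
    rw [Real.norm_eq_abs, abs_of_pos (Real.exp_pos _)]
    exact hpt x
  refine ⟨iL, ?_⟩
  have h0 : ∫ x, (F x - μ) ∂stdG = 0 := by
    rw [integral_sub iF (integrable_const _)]; simp [μ]
  calc ∫ x, Real.exp (s * (F x - μ)) ∂stdG
      ≤ ∫ x, (1 + s * (F x - μ) + s ^ 2 * (B * Real.exp (x ^ 2 / 4))) ∂stdG :=
        integral_mono iL iR hpt
    _ = 1 + s ^ 2 * (B * ∫ x, Real.exp (x ^ 2 / 4) ∂stdG) := by
        rw [integral_add (by exact (integrable_const 1).add (iY.const_mul s))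
          (by exact (stdG_integrable_exp_sq.const_mul B).const_mul _),
          integral_add (integrable_const _) (by exact iY.const_mul s), integral_const_mul,
          integral_const_mul, integral_const_mul, h0]
        simp
    _ ≤ _ := by
        have := Real.add_one_le_exp ((B * ∫ x, Real.exp (x ^ 2 / 4) ∂stdG) * s ^ 2)
        linarith

lemma stdPi_upper_tail (A : ℝ) (hA : 0 < A) : ∃ c : ℝ, 0 < c ∧
    ∀ {K B : Type} [Fintype K] [Fintype B] (e : B → K), e.Injective →
    ∀ F : B → ℝ → ℝ, (∀ b, Measurable (F b)) → (∀ b x, |F b x| ≤ A * (1 + x ^ 2)) →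
    ∀ t : ℝ, 0 ≤ t → t ≤ 1 →
    (stdPi K).real {ω | t * Fintype.card B ≤ ∑ b, F b (ω (e b)) - ∑ b, ∫ x, F b x ∂stdG}
      ≤ Real.exp (-c * t ^ 2 * Fintype.card B) := by
  obtain ⟨s0, K0, hs0, hK0, H⟩ := stdG_centered_mgf_le A hA
  set r := min s0 (1 / (2 * K0))
  have hr : 0 < r := lt_min hs0 (by positivity)
  refine ⟨r / 2, by positivity, ?_⟩
  intro K B _ _ e he F hF hFA t ht0 ht1
  set s := t * r
  have hsn : 0 ≤ s := by positivity
  have hs : |s| ≤ s0 := by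
    rw [abs_of_nonneg hsn]
    calc t * r ≤ 1 * r := by gcongr
      _ ≤ s0 := by rw [one_mul]; exact min_le_left _ _
  set X : B → (K → ℝ) → ℝ := fun b ω => F b (ω (e b)) - ∫ x, F b x ∂stdG
  have hX : ∀ b, Measurable (X b) := fun b => by
    have := hF b
    fun_prop
  have hind : iIndepFun X (stdPi K) := by
    have h1 : iIndepFun (fun (k : K) (ω : K → ℝ) => id (ω k)) (stdPi K) :=
      iIndepFun_pi (X := fun _ : K => (id : ℝ → ℝ)) (fun _ => aemeasurable_id)
    have h2 := h1.precomp he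
    exact h2.comp (fun b x => F b x - ∫ x, F b x ∂stdG) fun b => (hF b).sub_const _
  have hmp : ∀ b, MeasurePreserving (fun ω : K → ℝ => ω (e b)) (stdPi K) stdG := fun b =>
    measurePreserving_eval (fun _ : K => stdG) (e b)
  have hmgf : ∀ b, mgf (X b) (stdPi K) s ≤ Real.exp (K0 * s ^ 2) := by
    intro b
    have h1 := (H (F b) (hF b) (hFA b) s hs)
    have h2 := integral_comp_measurePreserving (hmp b)
      (g := fun x => Real.exp (s * (F b x - ∫ y, F b y ∂stdG)))
    refine le_trans (le_of_eq ?_) h1.2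
    exact h2 h1.1.aestronglyMeasurable
  have hintg : ∀ b, Integrable (fun ω => Real.exp (s * X b ω)) (stdPi K) := fun b =>
    (hmp b).integrable_comp_of_integrable (H (F b) (hF b) (hFA b) s hs).1
  have h3 := measure_ge_le_exp_mul_mgf (X := ∑ b, X b) (μ := stdPi K) (t * Fintype.card B) hsn
    (hind.integrable_exp_mul_sum hX fun b _ => hintg b)
  rw [hind.mgf_sum hX] at h3
  have h4 : ∏ b, mgf (X b) (stdPi K) s ≤ Real.exp (K0 * s ^ 2) ^ Fintype.card B := by
    refine (Finset.prod_le_prod (fun b _ => mgf_nonneg) fun b _ => hmgf b).trans ?_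
    simp
  have e1 : {ω | t * Fintype.card B ≤ ∑ b, F b (ω (e b)) - ∑ b, ∫ x, F b x ∂stdG}
      = {ω | t * Fintype.card B ≤ (∑ b, X b) ω} := by
    ext ω
    simp [X, Finset.sum_sub_distrib]
  rw [e1]
  refine h3.trans ?_
  calc _ ≤ Real.exp (-s * (t * Fintype.card B)) * Real.exp (K0 * s ^ 2) ^ Fintype.card B := by
        gcongr
    _ = Real.exp (-s * (t * Fintype.card B) + Fintype.card B * (K0 * s ^ 2)) := by
        rw [← Real.exp_nat_mul, ← Real.exp_add]
    _ ≤ _ := by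
        rw [Real.exp_le_exp]
        have h5 : r * K0 ≤ 1 / 2 := by
          have : r ≤ 1 / (2 * K0) := min_le_right _ _
          rw [le_div_iff₀ (by positivity)] at this
          linarith
        have h6 : 0 ≤ t ^ 2 * r * Fintype.card B := by positivity
        simp only [s]
        nlinarith

/-- Two-sided concentration of sums of functions of quadratic growth. -/
lemma stdPi_concentration (A : ℝ) (hA : 0 < A) : ∃ c : ℝ, 0 < c ∧
    ∀ {K B : Type} [Fintype K] [Fintype B] (e : B → K), e.Injective →
    ∀ F : B → ℝ → ℝ, (∀ b, Measurable (F b)) → (∀ b x, |F b x| ≤ A * (1 + x ^ 2)) →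
    ∀ t : ℝ, 0 ≤ t → t ≤ 1 →
    (stdPi K).real {ω | t * Fintype.card B ≤ |∑ b, F b (ω (e b)) - ∑ b, ∫ x, F b x ∂stdG|}
      ≤ 2 * Real.exp (-c * t ^ 2 * Fintype.card B) := by
  obtain ⟨c, hc, H⟩ := stdPi_upper_tail A hA
  refine ⟨c, hc, ?_⟩
  intro K B _ _ e he F hF hFA t ht0 ht1
  have h1 := H e he F hF hFA t ht0 ht1
  have h2 := H e he (fun b x => -F b x) (fun b => (hF b).neg)
    (fun b x => by rw [abs_neg]; exact hFA b x) t ht0 ht1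
  refine (measureReal_mono (s₂ := {ω | t * Fintype.card B ≤ ∑ b, F b (ω (e b))
      - ∑ b, ∫ x, F b x ∂stdG} ∪ {ω | t * Fintype.card B ≤ ∑ b, -F b (ω (e b))
      - ∑ b, ∫ x, -F b x ∂stdG}) ?_).trans ((measureReal_union_le _ _).trans (by linarith))
  intro ω hω
  rw [Set.mem_ofPred_eq] at hω
  rcases le_abs.1 hω with h | h
  · exact Or.inl h
  · right
    simp only [Set.mem_ofPred_eq, integral_neg, Finset.sum_neg_distrib]
    linarith

lemma stdPi_single_tail : ∃ C : ℝ, 0 < C ∧ ∀ {K : Type} [Fintype K] (k : K) (x : ℝ),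
    (stdPi K).real {ω | x ≤ ω k ^ 2} ≤ C * Real.exp (-(x / 4)) := by
  have hE : 0 < ∫ x, Real.exp (x ^ 2 / 4) ∂stdG := integral_exp_pos stdG_integrable_exp_sq
  refine ⟨_, hE, ?_⟩
  intro K _ k x
  have hmp : MeasurePreserving (fun ω : K → ℝ => ω k) (stdPi K) stdG :=
    measurePreserving_eval (fun _ : K => stdG) k
  have h2 := integral_comp_measurePreserving hmp (g := fun x => Real.exp (x ^ 2 / 4))
  have h3 := measure_ge_le_exp_mul_mgf (X := fun ω : K → ℝ => ω k ^ 2 / 4) (μ := stdPi K) (x / 4)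
    zero_le_one (by
      simp only [one_mul]
      exact hmp.integrable_comp_of_integrable (g := fun x => Real.exp (x ^ 2 / 4))
        stdG_integrable_exp_sq)
  have e1 : mgf (fun ω : K → ℝ => ω k ^ 2 / 4) (stdPi K) 1 = ∫ x, Real.exp (x ^ 2 / 4) ∂stdG := by
    simp only [mgf, one_mul]
    exact h2 (by fun_prop)
  rw [e1] at h3
  have e2 : {ω : K → ℝ | x ≤ ω k ^ 2} = {ω | x / 4 ≤ ω k ^ 2 / 4} := by
    ext ω
    simp only [Set.mem_ofPred_eq]
    constructor <;> intro h <;> linarith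
  rw [e2]
  refine h3.trans (le_of_eq ?_)
  rw [mul_comm]; simp

lemma eta_eq_sub_clamp (x : ℝ) {b : ℝ} (hb : 0 ≤ b) : eta x b = x - max (-b) (min x b) := by
  unfold eta
  rcases lt_trichotomy x 0 with h | h | h
  · rw [Real.sign_of_neg h, abs_of_neg h, min_eq_left (by linarith)]
    rcases le_total (-x - b) 0 with h1 | h1
    · rw [max_eq_right h1, max_eq_right (by linarith)]; ring
    · rw [max_eq_left h1, max_eq_left (by linarith)]; ring
  · subst h
    rw [Real.sign_zero, zero_mul, min_eq_left hb, max_eq_right (by linarith)]; simp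
  · rw [Real.sign_of_pos h, abs_of_pos h]
    rcases le_total (x - b) 0 with h1 | h1
    · rw [max_eq_right h1, min_eq_left (by linarith), max_eq_right (by linarith)]; ring
    · rw [max_eq_left h1, min_eq_right (by linarith), max_eq_right (by linarith)]; ring

lemma abs_sub_eta_le (x : ℝ) {b : ℝ} (hb : 0 ≤ b) : |x - eta x b| ≤ b := by
  rw [eta_eq_sub_clamp x hb, sub_sub_cancel, abs_le]
  exact ⟨le_max_left _ _, max_le (by linarith) (min_le_right _ _)⟩

lemma sub_eta_mul_eta (x : ℝ) {b : ℝ} (hb : 0 ≤ b) :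
    (x - eta x b) * eta x b = b * |eta x b| := by
  rw [eta_eq_sub_clamp x hb, sub_sub_cancel]
  rcases le_total x b with h | h
  · rw [min_eq_left h]
    rcases le_total (-b) x with h1 | h1
    · rw [max_eq_right h1]; simp
    · rw [max_eq_left h1, abs_of_nonpos (by linarith)]; ring
  · rw [min_eq_right h, max_eq_right (by linarith), abs_of_nonneg (by linarith)]

lemma continuous_eta {b : ℝ} (hb : 0 ≤ b) : Continuous fun x => eta x b := by
  simp only [eta_eq_sub_clamp _ hb]
  fun_prop

lemma hasDerivAt_eta {x b : ℝ} (hb : 0 ≤ b) (h1 : x ≠ b) (h2 : x ≠ -b) :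
    HasDerivAt (fun x => eta x b) (eta' x b) x := by
  simp only [eta_eq_sub_clamp _ hb]
  unfold eta'
  rcases lt_or_gt_of_ne h1 with h | h
  · rcases lt_or_gt_of_ne h2 with h' | h'
    · rw [if_pos (by rw [lt_abs]; right; linarith)]
      refine (((hasDerivAt_id x).add_const b).congr_of_eventuallyEq ?_)
      filter_upwards [Iio_mem_nhds h'] with y hy
      rw [Set.mem_Iio] at hy
      rw [min_eq_left (by linarith), max_eq_left (by linarith)]; simp
    · rw [if_neg (by rw [not_lt, abs_le]; exact ⟨h'.le, h.le⟩)]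
      refine ((hasDerivAt_const x (0 : ℝ)).congr_of_eventuallyEq ?_)
      filter_upwards [Ioo_mem_nhds h' h] with y hy
      rw [min_eq_left hy.2.le, max_eq_right hy.1.le]; simp
  · rw [if_pos (by rw [lt_abs]; left; linarith)]
    refine (((hasDerivAt_id x).sub_const b).congr_of_eventuallyEq ?_)
    filter_upwards [Ioi_mem_nhds h] with y hy
    rw [Set.mem_Ioi] at hy
    rw [min_eq_right (by linarith), max_eq_right (by linarith)]; simp

lemma measurable_eta' (b : ℝ) : Measurable fun x => eta' x b := by
  unfold eta'
  exact Measurable.ite (measurableSet_lt measurable_const measurable_norm) measurable_const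
    measurable_const

/-- The error of soft thresholding at `a + τ z` as an estimate of `a`. -/
def softErr (τ b a z : ℝ) : ℝ := eta (a + τ * z) b - a

lemma continuous_softErr (τ a : ℝ) {b : ℝ} (hb : 0 ≤ b) : Continuous (softErr τ b a) := by
  unfold softErr
  exact ((continuous_eta hb).comp (by fun_prop)).sub continuous_const

lemma abs_mul_sub_softErr_le (τ a z : ℝ) {b : ℝ} (hb : 0 ≤ b) :
    |τ * z - softErr τ b a z| ≤ b := by
  have := abs_sub_eta_le (a + τ * z) hb
  unfold softErr
  rwa [show τ * z - (eta (a + τ * z) b - a) = a + τ * z - eta (a + τ * z) b by ring]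

lemma softErr_subgradient_eq (τ a z : ℝ) {b : ℝ} (hb : 0 ≤ b) :
    (τ * z - softErr τ b a z) * (softErr τ b a z + a) = b * |softErr τ b a z + a| := by
  have := sub_eta_mul_eta (a + τ * z) hb
  unfold softErr
  rw [show τ * z - (eta (a + τ * z) b - a) = a + τ * z - eta (a + τ * z) b by ring,
    sub_add_cancel, this]

lemma abs_softErr_le {τ : ℝ} (hτ : 0 ≤ τ) (a z : ℝ) {b : ℝ} (hb : 0 ≤ b) :
    |softErr τ b a z| ≤ τ * |z| + b := by
  have h := abs_mul_sub_softErr_le τ a z hb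
  have h2 := abs_sub_abs_le_abs_sub (softErr τ b a z) (τ * z)
  rw [abs_sub_comm] at h2
  rw [abs_mul, abs_of_nonneg hτ] at h2
  linarith

lemma softErr_sq_le {τ : ℝ} (hτ : 0 ≤ τ) (a z : ℝ) {b : ℝ} (hb : 0 ≤ b) :
    softErr τ b a z ^ 2 ≤ (2 * (τ ^ 2 + b ^ 2)) * (1 + z ^ 2) := by
  have h := abs_softErr_le hτ a z hb
  rw [← sq_abs]
  calc |softErr τ b a z| ^ 2 ≤ (τ * |z| + b) ^ 2 := by gcongr
    _ ≤ 2 * (τ ^ 2 * |z| ^ 2 + b ^ 2) := by nlinarith [sq_nonneg (τ * |z| - b)]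
    _ ≤ _ := by rw [sq_abs]; nlinarith [sq_nonneg (b * z), sq_nonneg τ]

lemma abs_softErr_le_quadratic {τ : ℝ} (hτ : 0 ≤ τ) (a z : ℝ) {b : ℝ} (hb : 0 ≤ b) :
    |softErr τ b a z| ≤ (τ + b) * (1 + z ^ 2) := by
  have h := abs_softErr_le hτ a z hb
  have h1 : |z| ≤ 1 + z ^ 2 := by rw [← sq_abs]; nlinarith [sq_nonneg (|z| - 1), abs_nonneg z]
  nlinarith [sq_nonneg z, mul_le_mul_of_nonneg_left h1 hτ, mul_nonneg hb (sq_nonneg z)]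

lemma abs_mul_softErr_le {τ : ℝ} (hτ : 0 ≤ τ) (a z : ℝ) {b : ℝ} (hb : 0 ≤ b) :
    |z * softErr τ b a z| ≤ (τ + b) * (1 + z ^ 2) := by
  have h := abs_softErr_le hτ a z hb
  rw [abs_mul]
  have h1 : |z| ≤ 1 + z ^ 2 := by rw [← sq_abs]; nlinarith [sq_nonneg (|z| - 1), abs_nonneg z]
  have h2 := mul_le_mul_of_nonneg_left h (abs_nonneg z)
  rw [← sq_abs z] at *
  nlinarith [mul_le_mul_of_nonneg_left h1 hb]

lemma integral_mul_softErr {τ : ℝ} (hτ : 0 < τ) (a : ℝ) {b : ℝ} (hb : 0 ≤ b) :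
    ∫ z, z * softErr τ b a z ∂stdG = τ * ∫ z, eta' (a + τ * z) b ∂stdG := by
  rw [← integral_const_mul]
  refine stdG_integral_mul_eq_deriv (S := {(b - a) / τ, (-b - a) / τ}) (by simp)
    (continuous_softErr τ a hb) ?_
    (((measurable_eta' b).comp (by fun_prop)).const_mul τ) (τ + b) ?_ ?_
  · intro x hx
    simp only [Set.mem_insert_iff, Set.mem_singleton_iff, not_or] at hx
    have h1 : HasDerivAt (fun z => a + τ * z) τ x := by
      simpa using ((hasDerivAt_id x).const_mul τ).const_add a
    have h2 := (hasDerivAt_eta (x := a + τ * x) hb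
      (fun h => hx.1 (by rw [eq_div_iff hτ.ne']; linarith))
      (fun h => hx.2 (by rw [eq_div_iff hτ.ne']; linarith))).comp x h1
    rw [mul_comm]
    exact h2.sub_const a
  · intro x
    have := abs_softErr_le hτ.le a x hb
    nlinarith [abs_nonneg x]
  · intro x
    unfold eta'
    split_ifs <;> simp [abs_of_pos hτ, hb]
    positivity

lemma integral_empDist_prod {N : ℕ} (θ : Fin N → ℝ) (hN : 0 < N) (f : ℝ × ℝ → ℝ)
    (hf : Measurable f) (hi : ∀ a, Integrable (fun z => f (a, z)) stdG) :
    ∫ q, f q ∂((empDist θ).prod stdG) = (1 / (N : ℝ)) * ∑ j, ∫ z, f (θ j, z) ∂stdG := by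
  have hintg : ∀ g : ℝ → ℝ, Integrable g (empDist θ) := by
    intro g
    unfold empDist
    refine Integrable.smul_measure ?_ (by simp [hN.ne'])
    exact integrable_finsetSum_measure.2 fun i _ => integrable_dirac (by simp)
  have hfin : IsFiniteMeasure (empDist θ) := by
    have := (hintg fun _ => (1 : ℝ))
    rw [integrable_const_iff] at this
    simpa using this
  have h1 : Integrable f ((empDist θ).prod stdG) := by
    rw [integrable_prod_iff hf.aestronglyMeasurable]
    exact ⟨ae_of_all _ fun a => hi a, hintg _⟩
  rw [integral_prod _ h1]
  unfold empDist
  rw [integral_smul_measure, integral_finsetSum_measure fun i _ => integrable_dirac (by simp)]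
  simp [integral_dirac]

lemma stdG_measure_abs_eq {τ : ℝ} (hτ : 0 < τ) (a b : ℝ) :
    ∀ᵐ z ∂stdG, |a + τ * z| ≠ b := by
  have : NullSingletonClass stdG := by
    unfold stdG; exact nullSingletonClass_gaussianReal one_ne_zero
  have hc : ({(b - a) / τ, (-b - a) / τ} : Set ℝ).Countable := by simp
  have := hc.ae_notMem stdG
  filter_upwards [this] with z hz h
  simp only [Set.mem_insert_iff, Set.mem_singleton_iff, not_or] at hz
  rcases eq_or_eq_neg_of_abs_eq h with h | h
  · exact hz.1 (by rw [eq_div_iff hτ.ne']; linarith)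
  · exact hz.2 (by rw [eq_div_iff hτ.ne']; linarith)

section StateEvolution

variable {N : ℕ} {θ : Fin N → ℝ} {δ σ lam β τ : ℝ}

lemma StateEvo.threshold_nonneg (h : StateEvo δ σ (empDist θ) lam β τ) (hl : 0 ≤ lam) :
    0 ≤ τ * lam / β := by
  have := h.1; have := h.2.1
  positivity

lemma integrable_eta'_comp (τ a b : ℝ) : Integrable (fun z => eta' (a + τ * z) b) stdG := by
  refine Integrable.of_bound ((measurable_eta' b).comp (by fun_prop)).aestronglyMeasurable 1
    (ae_of_all _ fun z => ?_)
  unfold eta'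
  split_ifs <;> simp

lemma StateEvo.sum_integral_sq (h : StateEvo δ σ (empDist θ) lam β τ) (hN : 0 < N) (hδ : 0 < δ)
    (hl : 0 ≤ lam) :
    ∑ j, ∫ z, softErr τ (τ * lam / β) (θ j) z ^ 2 ∂stdG = N * δ * (τ ^ 2 - σ ^ 2) := by
  have hb := h.threshold_nonneg hl
  have hc := continuous_eta hb
  have h1 := h.2.2.1
  have hN' : (0 : ℝ) < N := by exact_mod_cast hN
  rw [integral_empDist_prod θ hN
    (fun q : ℝ × ℝ => (eta (q.1 + τ * q.2) (τ * lam / β) - q.1) ^ 2)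
    (((hc.comp (by fun_prop : Continuous fun q : ℝ × ℝ => q.1 + τ * q.2)).sub
      continuous_fst).pow 2).measurable
    (fun a => stdG_integrable_of_quadratic
      ((continuous_softErr τ a hb).pow 2).aestronglyMeasurable (2 * (τ ^ 2 + (τ * lam / β) ^ 2))
      fun x => by
        rw [abs_of_nonneg (sq_nonneg _)]
        exact softErr_sq_le h.2.1.le a x hb)] at h1
  simp only [softErr]
  field_simp at h1
  linarith

lemma StateEvo.sum_integral_eta' (h : StateEvo δ σ (empDist θ) lam β τ) (hN : 0 < N)
    (hδ : 0 < δ) :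
    ∑ j, ∫ z, eta' (θ j + τ * z) (τ * lam / β) ∂stdG = N * δ * (1 - β / τ) := by
  have h1 := h.2.2.2
  have hN' : (0 : ℝ) < N := by exact_mod_cast hN
  have hτ := h.2.1
  rw [integral_empDist_prod θ hN
    (fun q : ℝ × ℝ => eta' (q.1 + τ * q.2) (τ * lam / β))
    ((measurable_eta' _).comp (by fun_prop))
    (fun a => integrable_eta'_comp τ a _)] at h1
  field_simp at h1 ⊢
  linarith

lemma StateEvo.sum_integral_mul (h : StateEvo δ σ (empDist θ) lam β τ) (hN : 0 < N) (hδ : 0 < δ)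
    (hl : 0 ≤ lam) :
    ∑ j, ∫ z, z * softErr τ (τ * lam / β) (θ j) z ∂stdG = N * δ * (τ - β) := by
  simp only [integral_mul_softErr h.2.1 _ (h.threshold_nonneg hl)]
  rw [← Finset.mul_sum, h.sum_integral_eta' hN hδ]
  have := h.2.1
  field_simp

lemma StateEvo.sStar_eq (h : StateEvo δ σ (empDist θ) lam β τ) (hN : 0 < N) (hδ : 0 < δ) :
    sStar (empDist θ) τ (lam / β) = δ * (1 - β / τ) := by
  have hN' : (0 : ℝ) < N := by exact_mod_cast hN
  have hτ := h.2.1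
  have hm : MeasurableSet {q : ℝ × ℝ | lam / β * τ ≤ |q.1 + τ * q.2|} :=
    measurableSet_le measurable_const (by fun_prop)
  have e1 : sStar (empDist θ) τ (lam / β)
      = ∫ q, {q : ℝ × ℝ | lam / β * τ ≤ |q.1 + τ * q.2|}.indicator 1 q
        ∂((empDist θ).prod stdG) := by
    rw [integral_indicator_one hm]; rfl
  rw [e1, integral_empDist_prod θ hN _ (measurable_one.indicator hm) (fun a =>
    Integrable.of_bound ((measurable_one.indicator hm).comp
      (by fun_prop : Measurable fun z : ℝ => (a, z))).aestronglyMeasurable 1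
    (ae_of_all _ fun z => by
      simp only [Set.indicator, Pi.one_apply]
      split_ifs <;> simp))]
  have e2 : ∀ j, ∫ z, {q : ℝ × ℝ | lam / β * τ ≤ |q.1 + τ * q.2|}.indicator (1 : ℝ × ℝ → ℝ)
      (θ j, z) ∂stdG = ∫ z, eta' (θ j + τ * z) (τ * lam / β) ∂stdG := by
    intro j
    refine integral_congr_ae ?_
    filter_upwards [stdG_measure_abs_eq hτ (θ j) (τ * lam / β)] with z hz
    have e3 : lam / β * τ = τ * lam / β := by ring
    simp only [Set.indicator, Set.mem_ofPred_eq, Pi.one_apply, eta', e3]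
    rcases lt_or_gt_of_ne hz with h' | h'
    · rw [if_neg (by linarith), if_neg (by linarith)]
    · rw [if_pos h'.le, if_pos h']
  simp only [e2]
  rw [h.sum_integral_eta' hN hδ]
  field_simp

end StateEvolution

/-- Soft-thresholding risk at zero. -/
def tailRisk (α : ℝ) : ℝ := ∫ z, max (|z| - α) 0 ^ 2 ∂stdG

lemma max_abs_sub_sq_le {α : ℝ} (hα : 0 ≤ α) (z : ℝ) : max (|z| - α) 0 ^ 2 ≤ z ^ 2 := by
  rw [← sq_abs z]
  have h0 : 0 ≤ max (|z| - α) 0 := le_max_right _ _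
  have h1 : max (|z| - α) 0 ≤ |z| := max_le (by linarith) (abs_nonneg _)
  gcongr

lemma stdG_integrable_sq : Integrable (fun x : ℝ => x ^ 2) stdG :=
  stdG_integrable_of_quadratic (by fun_prop) 1 fun x => by rw [abs_of_nonneg] <;> nlinarith

lemma integrable_max_abs_sub_sq {α : ℝ} (hα : 0 ≤ α) :
    Integrable (fun z : ℝ => max (|z| - α) 0 ^ 2) stdG :=
  stdG_integrable_sq.mono' (by fun_prop) (ae_of_all _ fun z => by
    rw [Real.norm_eq_abs, abs_of_nonneg (sq_nonneg _)]
    exact max_abs_sub_sq_le hα z)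

lemma tailRisk_nonneg (α : ℝ) : 0 ≤ tailRisk α := integral_nonneg fun _ => sq_nonneg _

lemma tailRisk_le_one {α : ℝ} (hα : 0 ≤ α) : tailRisk α ≤ 1 := by
  rw [← stdG_integral_sq]
  exact integral_mono (integrable_max_abs_sub_sq hα) stdG_integrable_sq (max_abs_sub_sq_le hα)

lemma exists_tailRisk_le : ∃ C : ℝ, 0 < C ∧ ∀ α : ℝ, 0 < α → tailRisk α ≤ C / α ^ 2 := by
  have hE : 0 < ∫ x, Real.exp (x ^ 2 / 4) ∂stdG := integral_exp_pos stdG_integrable_exp_sq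
  refine ⟨256 * 1 ^ 2 * Real.exp (1 / 4) * ∫ x, Real.exp (x ^ 2 / 4) ∂stdG, by positivity,
    fun α hα => ?_⟩
  rw [← integral_const_mul, div_eq_mul_inv, ← integral_mul_const]
  refine integral_mono (integrable_max_abs_sub_sq hα.le)
    ((stdG_integrable_exp_sq.const_mul _).mul_const _) fun z => ?_
  have h1 := sq_mul_exp_le (a := 1) (s := 0) (y := 1 + z ^ 2) (x := z) one_pos
    (by rw [abs_of_nonneg (by positivity)]; linarith) (by norm_num)
  rw [zero_mul, abs_zero, Real.exp_zero, mul_one] at h1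
  refine le_trans ?_ (mul_le_mul_of_nonneg_right h1 (by positivity))
  have h2 : max (|z| - α) 0 ≤ (1 + z ^ 2) / α := by
    refine max_le ?_ (by positivity)
    rw [le_div_iff₀ hα, ← sq_abs z]
    nlinarith [sq_nonneg (|z| - α), sq_nonneg (|z|)]
  calc max (|z| - α) 0 ^ 2 ≤ ((1 + z ^ 2) / α) ^ 2 := by
        have h0 : 0 ≤ max (|z| - α) 0 := le_max_right _ _
        gcongr
    _ = _ := by rw [div_pow, div_eq_mul_inv]

lemma gphi_eq (x : ℝ) : gphi x = gaussianPDFReal 0 1 x := by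
  rw [gaussianPDFReal_std, gphi, div_eq_mul_inv, mul_comm]

lemma tendsto_linear_mul_gaussianPDFReal (c : ℝ) :
    Filter.Tendsto (fun z => (z + c) * gaussianPDFReal 0 1 z) Filter.atBot (nhds 0) := by
  have hb : ∀ z, |(z + c) * gaussianPDFReal 0 1 z| ≤ (1 + |c|) * (4 / (1 + |z|)) := by
    intro z
    have h1 := gaussianPDFReal_std_linear_bound z
    have h2 := gaussianPDFReal_nonneg 0 1 z
    rw [abs_mul, abs_of_nonneg h2]
    have h3 : |z + c| ≤ (1 + |c|) * (1 + |z|) := by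
      have := abs_add_le z c
      nlinarith [abs_nonneg z, abs_nonneg c, mul_nonneg (abs_nonneg z) (abs_nonneg c)]
    calc |z + c| * gaussianPDFReal 0 1 z
        ≤ (1 + |c|) * (1 + |z|) * gaussianPDFReal 0 1 z := by gcongr
      _ = (1 + |c|) * ((1 + |z|) * gaussianPDFReal 0 1 z) := by ring
      _ ≤ _ := by gcongr
  refine squeeze_zero_norm hb ?_
  rw [show (0 : ℝ) = (1 + |c|) * 0 by simp]
  refine Filter.Tendsto.const_mul _ ?_
  refine Filter.Tendsto.const_div_atTop ?_ 4
  exact Filter.tendsto_atTop_add_const_left _ _ Filter.tendsto_abs_atBot_atTop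

lemma tailRisk_eq {α : ℝ} (hα : 0 ≤ α) :
    tailRisk α = 2 * ((1 + α ^ 2) * gPhi (-α) - α * gphi α) := by
  set φ := gaussianPDFReal 0 1
  have hφi : Integrable φ := integrable_gaussianPDFReal 0 1
  have hi : Integrable fun z => φ z * max (|z| - α) 0 ^ 2 :=
    (stdG_integrable_iff _).1 (integrable_max_abs_sub_sq hα)
  have hq : Integrable fun z => φ z * (z + α) ^ 2 :=
    (stdG_integrable_iff _).1 (stdG_integrable_of_quadratic (by fun_prop) (2 * (1 + α ^ 2))
      fun z => by
        rw [abs_of_nonneg (sq_nonneg _)]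
        nlinarith [sq_nonneg (z - α), sq_nonneg (z * α)])
  have heven : ∀ z, φ (-z) = φ z := fun z => by simp [φ, gaussianPDFReal_std]
  have e0 : tailRisk α = ∫ z, φ z * max (|z| - α) 0 ^ 2 := stdG_integral_eq _
  have e1 : ∫ z, φ z * max (|z| - α) 0 ^ 2 = (∫ z in Set.Iic 0, φ z * max (|z| - α) 0 ^ 2)
      + ∫ z in Set.Ioi 0, φ z * max (|z| - α) 0 ^ 2 :=
    (intervalIntegral.integral_Iic_add_Ioi hi.integrableOn hi.integrableOn).symm
  have e2 : ∫ z in Set.Ioi 0, φ z * max (|z| - α) 0 ^ 2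
      = ∫ z in Set.Iic 0, φ z * max (|z| - α) 0 ^ 2 := by
    have := integral_comp_neg_Iic (0 : ℝ) (fun z => φ z * max (|z| - α) 0 ^ 2)
    simp only [heven, abs_neg, neg_zero] at this
    exact this.symm
  have e3 : ∫ z in Set.Iic 0, φ z * max (|z| - α) 0 ^ 2
      = ∫ z in Set.Iic (-α), φ z * (z + α) ^ 2 := by
    have h1 : ∫ z in Set.Iic 0, φ z * max (|z| - α) 0 ^ 2
        = ∫ z in Set.Iic (-α), φ z * max (|z| - α) 0 ^ 2 := by
      refine setIntegral_eq_of_subset_of_forall_sdiff_eq_zero measurableSet_Iic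
        (Set.Iic_subset_Iic.2 (by linarith)) ?_
      intro z hz
      have h2 : z ≤ 0 := hz.1
      have h3 : -α < z := not_le.1 hz.2
      rw [abs_of_nonpos h2, max_eq_right (by linarith)]; simp
    rw [h1]
    refine setIntegral_congr_fun measurableSet_Iic fun z hz => ?_
    have h2 : z ≤ -α := hz
    rw [abs_of_nonpos (by linarith), max_eq_left (by linarith)]
    ring
  have hd : ∀ z ∈ Set.Iic (-α), HasDerivAt (fun z => -((z + 2 * α) * φ z))
      (φ z * (z + α) ^ 2 - (1 + α ^ 2) * φ z) z := by
    intro z _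
    refine ((((hasDerivAt_id z).add_const (2 * α)).mul
      (hasDerivAt_gaussianPDFReal_std z)).neg).congr_deriv ?_
    simp only [id, φ]
    ring
  have e4 := integral_Iic_of_hasDerivAt_of_tendsto' hd
    ((hq.sub (hφi.const_mul _)).integrableOn)
    (m := 0) (by simpa using (tendsto_linear_mul_gaussianPDFReal (2 * α)).neg)
  rw [integral_sub hq.integrableOn (hφi.const_mul _).integrableOn, integral_const_mul] at e4
  have e5 : gPhi (-α) = ∫ z in Set.Iic (-α), φ z := by
    unfold gPhi
    simp only [gphi_eq, φ]
  rw [e0, e1, e2, e3, e5, gphi_eq]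
  rw [heven] at e4
  change _ = 2 * (_ - α * φ α)
  linarith

/-- Both uniformity classes consist of vectors that are sparse up to an `ℓ¹`-bounded part. -/
lemma DFamSpec.exists_sparse {δ q : ℝ} {Dfam : (M : ℕ) → Set (Fin M → ℝ)} (hδ : 0 < δ)
    (hD : DFamSpec δ Dfam q) : ∃ α s M : ℝ, 0 < α ∧ 0 ≤ s ∧ s ≤ 1 ∧ 0 ≤ M ∧
      s * (1 + α ^ 2) + (1 - s) * tailRisk α < δ ∧
      ∀ N, ∀ θ ∈ Dfam N, ∃ S : Finset (Fin N), (S.card : ℝ) ≤ s * N ∧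
        ∑ j ∈ Sᶜ, |θ j| ≤ M * N := by
  rcases hD with ⟨p, ξ, hp, hξ, hF, -⟩ | ⟨s, hs0, hs, hF, -⟩
  · obtain ⟨C, hC, hT⟩ := exists_tailRisk_le
    set α := √(2 * C / δ)
    have hα : 0 < α := Real.sqrt_pos.2 (by positivity)
    have hα2 : α ^ 2 = 2 * C / δ := Real.sq_sqrt (by positivity)
    have hTα : tailRisk α ≤ δ / 2 := by
      refine (hT α hα).trans (le_of_eq ?_)
      rw [hα2]; field_simp
    set s := min 1 (δ / (4 * (1 + α ^ 2)))
    have hs : 0 < s := lt_min one_pos (by positivity)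
    have hs1 : s ≤ 1 := min_le_left _ _
    have hs2 : s * (1 + α ^ 2) ≤ δ / 4 := by
      have : s ≤ δ / (4 * (1 + α ^ 2)) := min_le_right _ _
      rw [le_div_iff₀ (by positivity)] at this
      linarith
    set M := ξ / s ^ (1 / p)
    have hsp : 0 < s ^ (1 / p) := Real.rpow_pos_of_pos hs _
    have hM : 0 < M := by positivity
    have hMp : s * M ^ p = ξ ^ p := by
      rw [Real.div_rpow hξ.le hsp.le, ← Real.rpow_mul hs.le, one_div_mul_cancel hp.ne',
        Real.rpow_one]
      field_simp
    refine ⟨α, s, M, hα, hs.le, hs1, hM.le, ?_, ?_⟩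
    · have := mul_le_mul_of_nonneg_left hTα (sub_nonneg.2 hs1)
      nlinarith
    · intro N θ hθ
      rw [hF] at hθ
      have hθ' : (1 / (N : ℝ)) * ∑ i, |θ i| ^ p ≤ ξ ^ p := hθ
      refine ⟨Finset.univ.filter fun i => M < |θ i|, ?_, ?_⟩
      · rcases Nat.eq_zero_or_pos N with h0 | h0
        · subst h0; simp
        have hN : (0 : ℝ) < N := by exact_mod_cast h0
        have h1 : ((Finset.univ.filter fun i => M < |θ i|).card : ℝ) * M ^ p
            ≤ ∑ i, |θ i| ^ p := by
          rw [← nsmul_eq_mul, ← Finset.sum_const]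
          refine le_trans (Finset.sum_le_sum (g := fun i => |θ i| ^ p) fun i hi => ?_)
            (Finset.sum_le_univ_sum_of_nonneg fun i => by positivity)
          have := (Finset.mem_filter.1 hi).2
          exact Real.rpow_le_rpow hM.le this.le hp.le
        rw [one_div, inv_mul_le_iff₀ hN] at hθ'
        have h2 : 0 < M ^ p := by positivity
        nlinarith
      · calc _ ≤ ∑ j ∈ (Finset.univ.filter fun i => M < |θ i|)ᶜ, M :=
              Finset.sum_le_sum fun j hj => by simpa using hj
          _ ≤ _ := by
              rw [Finset.sum_const, nsmul_eq_mul, mul_comm]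
              have : (((Finset.univ.filter fun i => M < |θ i|)ᶜ).card : ℝ) ≤ N := by
                exact_mod_cast (Finset.card_le_univ _).trans (by simp)
              gcongr
  · unfold smax at hs
    have hs' : s / δ < sSup ((fun α : ℝ =>
      (1 - (2 / δ) * ((1 + α ^ 2) * gPhi (-α) - α * gphi α)) /
      (1 + α ^ 2 - 2 * ((1 + α ^ 2) * gPhi (-α) - α * gphi α))) '' Set.Ici 0) := by
      rw [div_lt_iff₀ hδ]; linarith
    obtain ⟨_, ⟨α, hα, rfl⟩, h⟩ := exists_lt_of_lt_csSup (Set.Nonempty.image _ ⟨0, by simp⟩) hs'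
    have hα0 : 0 ≤ α := hα
    have hT := tailRisk_eq hα0
    have h1 := tailRisk_le_one hα0
    simp only at h
    rw [show 2 / δ * ((1 + α ^ 2) * gPhi (-α) - α * gphi α) = tailRisk α / δ by
      rw [hT]; ring, ← hT] at h
    have hden : 0 < 1 + α ^ 2 - tailRisk α := by
      by_contra hcon
      have h2 : α ^ 2 = 0 ∧ tailRisk α = 1 := by
        constructor <;> nlinarith [sq_nonneg α]
      rw [h2.1, h2.2] at h
      norm_num at h
      exact absurd h (not_lt.2 (by positivity))
    have hαpos : 0 < α := by
      rcases hα0.eq_or_lt with h2 | h2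
      · exfalso
        subst h2
        have : tailRisk 0 = 1 := by
          rw [← stdG_integral_sq]
          unfold tailRisk
          simp
        rw [this] at hden
        norm_num at hden
      · exact h2
    rw [lt_div_iff₀ hden, div_mul_eq_mul_div, div_lt_iff₀ hδ, sub_mul, div_mul_cancel₀ _ hδ.ne']
      at h
    refine ⟨α, min s 1, 0, hαpos, le_min hs0 zero_le_one, min_le_right _ _, le_rfl, ?_, ?_⟩
    · have : min s 1 ≤ s := min_le_left _ _
      nlinarith
    · intro N θ hθ
      rw [hF] at hθ
      have hθ' : (l0 θ : ℝ) ≤ s * N := hθ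
      refine ⟨Finset.univ.filter fun i => θ i ≠ 0, ?_, ?_⟩
      · rw [min_mul_of_nonneg _ _ (Nat.cast_nonneg _)]
        refine le_min hθ' ?_
        rw [one_mul]
        exact_mod_cast (Finset.card_le_univ _).trans (by simp)
      · rw [zero_mul]
        refine (Finset.sum_eq_zero fun j hj => ?_).le
        simpa using hj

lemma DFamSpec.exponent_nonneg {δ q : ℝ} {Dfam : (M : ℕ) → Set (Fin M → ℝ)}
    (hD : DFamSpec δ Dfam q) : 0 ≤ q := by
  rcases hD with ⟨p, ξ, -, -, -, h⟩ | ⟨s, -, -, -, h⟩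
  · rw [h]; exact le_max_right _ _
  · exact h.ge

lemma softErr_penalty_le {τ β lam : ℝ} (hτ : 0 < τ) (hβ : 0 < β) (hl : 0 ≤ lam) (a z : ℝ) :
    lam * (|softErr τ (τ * lam / β) a z + a| - |a|)
      ≤ β * (z * softErr τ (τ * lam / β) a z) - β / τ * softErr τ (τ * lam / β) a z ^ 2 := by
  have hb : 0 ≤ τ * lam / β := by positivity
  have h1 := softErr_subgradient_eq τ a z hb
  have h2 := abs_mul_sub_softErr_le τ a z hb
  set w := softErr τ (τ * lam / β) a z
  have h3 : (τ * z - w) * a ≤ τ * lam / β * |a| := by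
    refine (le_abs_self _).trans ?_
    rw [abs_mul]
    gcongr
  have h4 : τ * lam / β * (|w + a| - |a|) ≤ (τ * z - w) * w := by linarith
  have h5 := mul_le_mul_of_nonneg_left h4 (show 0 ≤ β / τ by positivity)
  have e1 : β / τ * (τ * lam / β * (|w + a| - |a|)) = lam * (|w + a| - |a|) := by field_simp
  have e2 : β / τ * ((τ * z - w) * w) = β * (z * w) - β / τ * w ^ 2 := by field_simp
  linarith

/-- Residual of the noise against the `ℓ¹` penalty with scale `α`, given a support `S`. -/
def supportRes {N : ℕ} (S : Finset (Fin N)) (θ : Fin N → ℝ) (α : ℝ) (j : Fin N) (z : ℝ) : ℝ :=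
  if j ∈ S then z - α * Real.sign (θ j) else max (|z| - α) 0

lemma measurable_supportRes {N : ℕ} (S : Finset (Fin N)) (θ : Fin N → ℝ) (α : ℝ) (j : Fin N) :
    Measurable (supportRes S θ α j) := by
  unfold supportRes
  split_ifs <;> fun_prop

lemma abs_sign_le (a : ℝ) : |Real.sign a| ≤ 1 := by
  rcases Real.sign_apply_eq a with h | h | h <;> rw [h] <;> norm_num

lemma supportRes_sq_le {N : ℕ} (S : Finset (Fin N)) (θ : Fin N → ℝ) {α : ℝ} (hα : 0 ≤ α)
    (j : Fin N) (z : ℝ) : supportRes S θ α j z ^ 2 ≤ (2 + 2 * α ^ 2) * (1 + z ^ 2) := by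
  unfold supportRes
  have h1 : Real.sign (θ j) ^ 2 ≤ 1 := by
    rw [← sq_abs]; nlinarith [abs_sign_le (θ j), abs_nonneg (Real.sign (θ j))]
  split_ifs
  · nlinarith [sq_nonneg (z + α * Real.sign (θ j)), sq_nonneg (α * z), sq_nonneg α,
      mul_le_mul_of_nonneg_left h1 (sq_nonneg α)]
  · have := max_abs_sub_sq_le hα z
    nlinarith [sq_nonneg (α * z), sq_nonneg α, sq_nonneg z]

lemma mul_sub_penalty_le {N : ℕ} (S : Finset (Fin N)) (θ : Fin N → ℝ) {α : ℝ} (hα : 0 ≤ α)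
    (j : Fin N) (z w : ℝ) :
    z * w - α * (|w + θ j| - |θ j|) ≤ |w| * |supportRes S θ α j z|
      + if j ∈ S then 0 else 2 * α * |θ j| := by
  unfold supportRes
  split_ifs with h
  · have h1 : Real.sign (θ j) * w ≤ |w + θ j| - |θ j| := by
      have e1 : Real.sign (θ j) * θ j = |θ j| := by
        rcases lt_trichotomy (θ j) 0 with h | h | h
        · rw [Real.sign_of_neg h, abs_of_neg h]; ring
        · rw [h]; simp
        · rw [Real.sign_of_pos h, abs_of_pos h]; ring
      have e2 : Real.sign (θ j) * (w + θ j) ≤ |w + θ j| := by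
        refine (le_abs_self _).trans ?_
        rw [abs_mul]
        exact mul_le_of_le_one_left (abs_nonneg _) (abs_sign_le _)
      linarith
    rw [← abs_mul]
    have := le_abs_self (w * (z - α * Real.sign (θ j)))
    nlinarith [mul_le_mul_of_nonneg_left h1 hα]
  · rw [abs_of_nonneg (le_max_right (|z| - α) 0)]
    have h1 : |w| - 2 * |θ j| ≤ |w + θ j| - |θ j| := by
      have := abs_sub_abs_le_abs_sub w (-θ j)
      rw [abs_neg, sub_neg_eq_add] at this
      linarith
    have h2 : z * w ≤ |w| * |z| := by rw [← abs_mul, mul_comm]; exact le_abs_self _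
    have h3 := mul_le_mul_of_nonneg_left (le_max_left (|z| - α) 0) (abs_nonneg w)
    nlinarith [mul_le_mul_of_nonneg_left h1 hα]

lemma integrable_supportRes_sq {N : ℕ} (S : Finset (Fin N)) (θ : Fin N → ℝ) {α : ℝ} (hα : 0 ≤ α)
    (j : Fin N) : Integrable (fun z => supportRes S θ α j z ^ 2) stdG :=
  stdG_integrable_of_quadratic ((measurable_supportRes S θ α j).pow_const 2).aestronglyMeasurable
    (2 + 2 * α ^ 2) fun z => by
      rw [abs_of_nonneg (sq_nonneg _)]
      exact supportRes_sq_le S θ hα j z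

lemma sum_integral_supportRes_sq_le {N : ℕ} (S : Finset (Fin N)) (θ : Fin N → ℝ) {α s : ℝ}
    (hα : 0 ≤ α) (hS : (S.card : ℝ) ≤ s * N) :
    ∑ j, ∫ z, supportRes S θ α j z ^ 2 ∂stdG
      ≤ N * (s * (1 + α ^ 2) + (1 - s) * tailRisk α) := by
  have hT := tailRisk_le_one hα
  have h1 : ∀ j, ∫ z, supportRes S θ α j z ^ 2 ∂stdG
      ≤ tailRisk α + if j ∈ S then 1 + α ^ 2 - tailRisk α else 0 := by
    intro j
    unfold supportRes
    split_ifs with h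
    · have hid : Integrable (fun z : ℝ => z) stdG :=
        stdG_integrable_of_quadratic (by fun_prop) 1 fun x => by
          rw [← sq_abs]; nlinarith [sq_nonneg (|x| - 1), abs_nonneg x]
      set c := α * Real.sign (θ j)
      have hc : c ^ 2 ≤ α ^ 2 := by
        rw [← sq_abs, ← sq_abs α, abs_mul]
        have := mul_le_of_le_one_right (abs_nonneg α) (abs_sign_le (θ j))
        gcongr
      have e1 : ∫ z, (z - c) ^ 2 ∂stdG = 1 + c ^ 2 := by
        have e2 : ∀ z, (z - c) ^ 2 = z ^ 2 - 2 * c * z + c ^ 2 := fun z => by ring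
        simp only [e2]
        rw [integral_add (by exact stdG_integrable_sq.sub (hid.const_mul _)) (integrable_const _),
          integral_sub stdG_integrable_sq (hid.const_mul _), integral_const_mul, stdG_integral_sq,
          stdG_integral_id]
        simp
      rw [e1]; linarith
    · rw [add_zero]; rfl
  refine (Finset.sum_le_sum fun j _ => h1 j).trans ?_
  rw [Finset.sum_add_distrib, Finset.sum_ite_mem, Finset.univ_inter]
  simp only [Finset.sum_const, Finset.card_univ, Fintype.card_fin, nsmul_eq_mul]
  nlinarith [mul_le_mul_of_nonneg_right hS (show 0 ≤ 1 + α ^ 2 - tailRisk α by nlinarith)]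

section Bounds

variable {N : ℕ} {θ : Fin N → ℝ} {δ σ lam β τ : ℝ}

lemma StateEvo.sigma_le (h : StateEvo δ σ (empDist θ) lam β τ) (hδ : 0 < δ) (hσ : 0 < σ) :
    σ ≤ τ := by
  have h1 := h.2.2.1
  have h2 : 0 ≤ (1 / δ) * ∫ q : ℝ × ℝ, (eta (q.1 + τ * q.2) (τ * lam / β) - q.1) ^ 2
      ∂((empDist θ).prod stdG) := mul_nonneg (by positivity) (integral_nonneg fun _ => sq_nonneg _)
  exact (sq_le_sq₀ hσ.le h.2.1.le).1 (by linarith)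

lemma StateEvo.beta_le (h : StateEvo δ σ (empDist θ) lam β τ) (hδ : 0 < δ) : β ≤ τ := by
  have h1 := h.2.2.2
  have h2 : 0 ≤ (1 / δ) * ∫ q : ℝ × ℝ, eta' (q.1 + τ * q.2) (τ * lam / β)
      ∂((empDist θ).prod stdG) := mul_nonneg (by positivity) (integral_nonneg fun q => by
        simp only [eta', Pi.zero_apply]; split_ifs <;> norm_num)
  nlinarith [h.2.1]

lemma integrable_mul_softErr {τ : ℝ} (hτ : 0 ≤ τ) (a : ℝ) {b : ℝ} (hb : 0 ≤ b) :
    Integrable (fun z => z * softErr τ b a z) stdG :=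
  stdG_integrable_of_quadratic (continuous_id.mul (continuous_softErr τ a hb)).aestronglyMeasurable
    (τ + b) fun z => abs_mul_softErr_le hτ a z hb

lemma integrable_softErr_sq {τ : ℝ} (hτ : 0 ≤ τ) (a : ℝ) {b : ℝ} (hb : 0 ≤ b) :
    Integrable (fun z => softErr τ b a z ^ 2) stdG :=
  stdG_integrable_of_quadratic ((continuous_softErr τ a hb).pow 2).aestronglyMeasurable
    (2 * (τ ^ 2 + b ^ 2)) fun z => by
      rw [abs_of_nonneg (sq_nonneg _)]
      exact softErr_sq_le hτ a z hb

lemma abs_penalty_le {τ : ℝ} (hτ : 0 ≤ τ) (a z : ℝ) {b : ℝ} (hb : 0 ≤ b) :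
    |(|softErr τ b a z + a| - |a|)| ≤ (τ + b) * (1 + z ^ 2) := by
  refine le_trans ?_ (abs_softErr_le_quadratic hτ a z hb)
  have := abs_abs_sub_abs_le_abs_sub (softErr τ b a z + a) a
  simpa using this

lemma integrable_penalty {τ : ℝ} (hτ : 0 ≤ τ) (a : ℝ) {b : ℝ} (hb : 0 ≤ b) :
    Integrable (fun z => |softErr τ b a z + a| - |a|) stdG :=
  stdG_integrable_of_quadratic
    (by have := continuous_softErr τ a hb; fun_prop) (τ + b) fun z => abs_penalty_le hτ a z hb

lemma StateEvo.tau_bound (h : StateEvo δ σ (empDist θ) lam β τ) (hN : 0 < N) (hδ : 0 < δ)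
    (hσ : 0 < σ) (hl : 0 < lam) {α s M r : ℝ} (hα : 0 < α) (S : Finset (Fin N))
    (hS : (S.card : ℝ) ≤ s * N) (hM : ∑ j ∈ Sᶜ, |θ j| ≤ M * N) (hr : 0 < r)
    (hr2 : s * (1 + α ^ 2) + (1 - s) * tailRisk α ≤ r ^ 2 * δ) :
    lam * (1 - r) * τ ≤ 2 * lam * α * M / δ + (lam + α * σ) ^ 2 / (4 * α) := by
  have hβ := h.1
  have hτ := h.2.1
  have hστ := h.sigma_le hδ hσ
  have hb := h.threshold_nonneg hl.le
  have hN' : (0 : ℝ) < N := by exact_mod_cast hN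
  set b := τ * lam / β
  have s1 : ∑ j, ∫ z, softErr τ b (θ j) z ^ 2 ∂stdG = N * δ * (τ ^ 2 - σ ^ 2) :=
    h.sum_integral_sq hN hδ hl.le
  have s2 : ∑ j, ∫ z, z * softErr τ b (θ j) z ∂stdG = N * δ * (τ - β) :=
    h.sum_integral_mul hN hδ hl.le
  have s3 := sum_integral_supportRes_sq_le S θ hα.le hS
  set P := ∑ j, ∫ z, (|softErr τ b (θ j) z + θ j| - |θ j|) ∂stdG
  have up : lam * P ≤ N * δ * (β * (σ ^ 2 / τ - β)) := by
    have h1 : ∀ j, lam * ∫ z, (|softErr τ b (θ j) z + θ j| - |θ j|) ∂stdG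
        ≤ β * ∫ z, z * softErr τ b (θ j) z ∂stdG
          - β / τ * ∫ z, softErr τ b (θ j) z ^ 2 ∂stdG := by
      intro j
      rw [← integral_const_mul, ← integral_const_mul, ← integral_const_mul,
        ← integral_sub ((integrable_mul_softErr hτ.le _ hb).const_mul _)
          ((integrable_softErr_sq hτ.le _ hb).const_mul _)]
      exact integral_mono ((integrable_penalty hτ.le _ hb).const_mul _)
        (((integrable_mul_softErr hτ.le _ hb).const_mul _).sub
          ((integrable_softErr_sq hτ.le _ hb).const_mul _))
        fun z => softErr_penalty_le hτ hβ hl.le (θ j) z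
    have h2 := Finset.sum_le_sum fun j (_ : j ∈ Finset.univ) => h1 j
    rw [Finset.sum_sub_distrib, ← Finset.mul_sum, ← Finset.mul_sum, ← Finset.mul_sum, s1, s2] at h2
    refine h2.trans (le_of_eq ?_)
    field_simp
    ring
  have lo : N * δ * (τ - β) - α * P ≤ N * δ * (r * τ) + 2 * α * (M * N) := by
    set k := r / τ with hk
    have hk0 : 0 < k := by positivity
    have h1 : ∀ j, ∫ z, z * softErr τ b (θ j) z ∂stdG
        - α * ∫ z, (|softErr τ b (θ j) z + θ j| - |θ j|) ∂stdG
        ≤ k / 2 * ∫ z, softErr τ b (θ j) z ^ 2 ∂stdG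
          + 1 / (2 * k) * ∫ z, supportRes S θ α j z ^ 2 ∂stdG
          + if j ∈ Sᶜ then 2 * α * |θ j| else 0 := by
      intro j
      have i1 := integrable_mul_softErr hτ.le (θ j) hb
      have i2 := integrable_softErr_sq hτ.le (θ j) hb
      have i3 := integrable_penalty hτ.le (θ j) hb
      have i4 := integrable_supportRes_sq S θ hα.le j
      have e1 : ∫ z, (k / 2 * softErr τ b (θ j) z ^ 2 + 1 / (2 * k) * supportRes S θ α j z ^ 2
          + if j ∈ Sᶜ then 2 * α * |θ j| else 0) ∂stdG
          = k / 2 * ∫ z, softErr τ b (θ j) z ^ 2 ∂stdG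
          + 1 / (2 * k) * ∫ z, supportRes S θ α j z ^ 2 ∂stdG
          + if j ∈ Sᶜ then 2 * α * |θ j| else 0 := by
        rw [integral_add (by exact (i2.const_mul _).add (i4.const_mul _)) (integrable_const _),
          integral_add (i2.const_mul _) (i4.const_mul _), integral_const_mul, integral_const_mul]
        simp
      rw [← e1, ← integral_const_mul, ← integral_sub i1 (i3.const_mul _)]
      refine integral_mono (i1.sub (i3.const_mul _))
        (((i2.const_mul _).add (i4.const_mul _)).add (integrable_const _)) fun z => ?_
      have h3 := mul_sub_penalty_le S θ hα.le j z (softErr τ b (θ j) z)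
      have h4 : |softErr τ b (θ j) z| * |supportRes S θ α j z|
          ≤ k / 2 * softErr τ b (θ j) z ^ 2 + 1 / (2 * k) * supportRes S θ α j z ^ 2 := by
        rw [← sq_abs (softErr τ b (θ j) z), ← sq_abs (supportRes S θ α j z)]
        have : k / 2 * |softErr τ b (θ j) z| ^ 2 + 1 / (2 * k) * |supportRes S θ α j z| ^ 2
            - |softErr τ b (θ j) z| * |supportRes S θ α j z|
            = 1 / (2 * k) * (k * |softErr τ b (θ j) z| - |supportRes S θ α j z|) ^ 2 := by
          field_simp; ring
        have h5 : 0 ≤ 1 / (2 * k) *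
          (k * |softErr τ b (θ j) z| - |supportRes S θ α j z|) ^ 2 := by positivity
        linarith
      have h5 : (if j ∈ S then (0 : ℝ) else 2 * α * |θ j|)
          = if j ∈ Sᶜ then 2 * α * |θ j| else 0 := by
        by_cases hj : j ∈ S <;> simp [hj]
      rw [h5] at h3
      simp only at h3 h4 ⊢
      linarith
    have h2 := Finset.sum_le_sum fun j (_ : j ∈ Finset.univ) => h1 j
    rw [Finset.sum_sub_distrib, Finset.sum_add_distrib, Finset.sum_add_distrib, ← Finset.mul_sum,
      ← Finset.mul_sum, ← Finset.mul_sum, s1, s2, Finset.sum_ite_mem, Finset.univ_inter,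
      ← Finset.mul_sum] at h2
    have h3 : 1 / (2 * k) * ∑ j, ∫ z, supportRes S θ α j z ^ 2 ∂stdG
        ≤ 1 / (2 * k) * (N * (r ^ 2 * δ)) := by
      gcongr
      exact s3.trans (by gcongr)
    have h4 : 1 / (2 * k) * (N * (r ^ 2 * δ)) = N * δ * (r * τ / 2) := by
      rw [hk]; field_simp
    have h5 : k / 2 * (N * δ * (τ ^ 2 - σ ^ 2)) ≤ N * δ * (r * τ / 2) := by
      have : k / 2 * (N * δ * (τ ^ 2 - σ ^ 2)) = N * δ * (r * τ / 2)
          - k / 2 * (N * δ * σ ^ 2) := by rw [hk]; field_simp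
      have : 0 ≤ k / 2 * (N * δ * σ ^ 2) := by positivity
      linarith
    have h6 : 2 * α * ∑ j ∈ Sᶜ, |θ j| ≤ 2 * α * (M * N) := by gcongr
    linarith
  have hσ2 : β * (σ ^ 2 / τ - β) ≤ β * (σ - β) := by
    have : σ ^ 2 / τ ≤ σ := by rw [div_le_iff₀ hτ]; nlinarith
    gcongr
  have h7 := mul_le_mul_of_nonneg_left hσ2 (show 0 ≤ N * δ by positivity)
  have h8 : lam * (N * δ * (τ - β)) ≤ α * (N * δ * (β * (σ - β)))
      + lam * (N * δ * (r * τ) + 2 * α * (M * N)) := by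
    nlinarith [mul_le_mul_of_nonneg_left lo hl.le, mul_le_mul_of_nonneg_left up hα.le]
  have h9 : lam * (τ - β) ≤ α * (β * (σ - β)) + lam * (r * τ + 2 * α * M / δ) := by
    have e1 : α * (N * δ * (β * (σ - β))) + lam * (N * δ * (r * τ) + 2 * α * (M * N))
        = N * δ * (α * (β * (σ - β)) + lam * (r * τ + 2 * α * M / δ)) := by field_simp
    rw [e1] at h8
    have e2 : lam * (N * δ * (τ - β)) = N * δ * (lam * (τ - β)) := by ring
    rw [e2] at h8
    exact le_of_mul_le_mul_left h8 (by positivity)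
  have h10 : (lam + α * σ) * β - α * β ^ 2 ≤ (lam + α * σ) ^ 2 / (4 * α) := by
    rw [le_div_iff₀ (by positivity)]
    nlinarith [sq_nonneg (2 * α * β - (lam + α * σ))]
  have e3 : 2 * lam * α * M / δ = lam * (2 * α * M / δ) := by ring
  rw [e3]
  nlinarith

lemma StateEvo.beta_bound (h : StateEvo δ σ (empDist θ) lam β τ) (hN : 0 < N) (hδ : 0 < δ)
    (hσ : 0 < σ) (hl : 0 < lam) {s M : ℝ} (S : Finset (Fin N))
    (hS : (S.card : ℝ) ≤ s * N) (hM : ∑ j ∈ Sᶜ, |θ j| ≤ M * N) :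
    δ - s ≤ β * (δ / σ + 4 * τ / lam ^ 2 + 2 * M / (σ * lam)) := by
  have hβ := h.1
  have hτ := h.2.1
  have hστ := h.sigma_le hδ hσ
  have hN' : (0 : ℝ) < N := by exact_mod_cast hN
  have s1 := h.sum_integral_eta' hN hδ
  set A := lam / β with hA
  have hA0 : 0 < A := by positivity
  have hb : τ * lam / β = τ * A := by rw [hA]; ring
  rw [hb] at s1
  have h1 : ∀ j, ∫ z, eta' (θ j + τ * z) (τ * A) ∂stdG
      ≤ (if j ∈ S then 1 else 0) + (4 / A ^ 2 + if j ∈ Sᶜ then 2 / (σ * A) * |θ j| else 0) := by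
    intro j
    have hp : 0 < 4 / A ^ 2 := by positivity
    have hη : ∀ z, eta' (θ j + τ * z) (τ * A) ≤ 1 := fun z => by
      unfold eta'; split_ifs <;> norm_num
    by_cases hj : j ∈ S
    · simp only [hj, if_true, Finset.mem_compl, not_true_eq_false, if_false]
      have : ∫ z, eta' (θ j + τ * z) (τ * A) ∂stdG ≤ ∫ _z, (1 : ℝ) ∂stdG :=
        integral_mono (integrable_eta'_comp τ _ _) (integrable_const _) hη
      rw [integral_const] at this
      simp at this
      linarith
    · simp only [hj, if_false, Finset.mem_compl, not_false_eq_true, if_true]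
      have e1 : ∫ z, (4 / A ^ 2 * z ^ 2 + 2 / (σ * A) * |θ j|) ∂stdG
          = 4 / A ^ 2 + 2 / (σ * A) * |θ j| := by
        rw [integral_add (stdG_integrable_sq.const_mul _) (integrable_const _),
          integral_const_mul, stdG_integral_sq]
        simp
      rw [zero_add, ← e1]
      refine integral_mono (integrable_eta'_comp τ _ _)
        ((stdG_integrable_sq.const_mul _).add (integrable_const _)) fun z => ?_
      have hz : 0 ≤ 4 / A ^ 2 * z ^ 2 := by positivity
      have ha : 0 ≤ 2 / (σ * A) * |θ j| := by positivity
      by_cases hc : τ * A < |θ j + τ * z|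
      · have h2 := abs_add_le (θ j) (τ * z)
        rw [abs_mul, abs_of_pos hτ] at h2
        by_cases hz2 : A / 2 ≤ |z|
        · have : 1 ≤ 4 / A ^ 2 * z ^ 2 := by
            rw [div_mul_eq_mul_div, le_div_iff₀ (by positivity), ← sq_abs z]
            nlinarith
          have := hη z
          simp only
          linarith
        · have h3 : τ * A / 2 ≤ |θ j| := by
            have := mul_le_mul_of_nonneg_left (not_le.1 hz2).le hτ.le
            linarith
          have h4 : 1 ≤ 2 / (σ * A) * |θ j| := by
            rw [div_mul_eq_mul_div, le_div_iff₀ (by positivity)]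
            nlinarith
          have := hη z
          simp only
          linarith
      · simp only [eta', if_neg hc]
        linarith
  have h2 := Finset.sum_le_sum fun j (_ : j ∈ Finset.univ) => h1 j
  rw [s1, Finset.sum_add_distrib, Finset.sum_add_distrib, Finset.sum_ite_mem, Finset.univ_inter,
    Finset.sum_ite_mem, Finset.univ_inter, ← Finset.mul_sum] at h2
  simp only [Finset.sum_const, Finset.card_univ, Fintype.card_fin, nsmul_eq_mul, mul_one] at h2
  have h3 : 2 / (σ * A) * ∑ j ∈ Sᶜ, |θ j| ≤ 2 / (σ * A) * (M * N) := by gcongr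
  have h4 : N * (δ * (1 - β / τ)) ≤ N * (s + 4 / A ^ 2 + 2 / (σ * A) * M) := by linarith
  have h5 := le_of_mul_le_mul_left h4 hN'
  have h6 : β / τ ≤ β / σ := by gcongr
  have h7 : 4 / A ^ 2 ≤ β * (4 * τ / lam ^ 2) := by
    have : 4 / A ^ 2 = β * (4 * β / lam ^ 2) := by rw [hA]; field_simp
    rw [this]
    have := h.beta_le hδ
    gcongr
  have h8 : 2 / (σ * A) * M = β * (2 * M / (σ * lam)) := by rw [hA]; field_simp
  have h9 : δ * (β / τ) ≤ β * (δ / σ) := by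
    calc δ * (β / τ) ≤ δ * (β / σ) := by gcongr
      _ = _ := by ring
  nlinarith

end Bounds

/-- The product of the thresholding error with the truncated thresholded value. -/
def activeErr (τ b a z : ℝ) : ℝ := min |softErr τ b a z + a| 1 * |softErr τ b a z|

lemma activeErr_nonneg (τ b a z : ℝ) : 0 ≤ activeErr τ b a z := by
  unfold activeErr
  positivity

lemma activeErr_le (τ b a z : ℝ) : activeErr τ b a z ≤ |softErr τ b a z| := by
  unfold activeErr
  exact mul_le_of_le_one_left (abs_nonneg _) (min_le_right _ _)

lemma continuous_activeErr (τ a : ℝ) {b : ℝ} (hb : 0 ≤ b) : Continuous (activeErr τ b a) := by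
  have := continuous_softErr τ a hb
  unfold activeErr
  fun_prop

lemma abs_activeErr_le {τ : ℝ} (hτ : 0 ≤ τ) (a z : ℝ) {b : ℝ} (hb : 0 ≤ b) :
    |activeErr τ b a z| ≤ (τ + b) * (1 + z ^ 2) := by
  rw [abs_of_nonneg (activeErr_nonneg _ _ _ _)]
  exact (activeErr_le _ _ _ _).trans (abs_softErr_le_quadratic hτ a z hb)

lemma integrable_activeErr {τ : ℝ} (hτ : 0 ≤ τ) (a : ℝ) {b : ℝ} (hb : 0 ≤ b) :
    Integrable (activeErr τ b a) stdG :=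
  stdG_integrable_of_quadratic (continuous_activeErr τ a hb).aestronglyMeasurable (τ + b)
    fun z => abs_activeErr_le hτ a z hb

lemma eta_of_le {x b : ℝ} (hb : 0 ≤ b) (h : b ≤ x) : eta x b = x - b := by
  rw [eta_eq_sub_clamp x hb, min_eq_right h, max_eq_right (by linarith)]

lemma eta_of_le_neg {x b : ℝ} (hb : 0 ≤ b) (h : x ≤ -b) : eta x b = x + b := by
  rw [eta_eq_sub_clamp x hb, min_eq_left (by linarith), max_eq_left h]; ring

lemma le_activeErr_of_large {σ τ α A a z : ℝ} (hσ : 0 < σ) (hτ : σ ≤ τ) (hα : 0 ≤ α)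
    (hA : α ≤ A) (hz : (0 ≤ a ∧ A + 2 ≤ z) ∨ (a ≤ 0 ∧ z ≤ -(A + 2))) :
    min (2 * σ) 1 * (2 * σ) ≤ activeErr τ (τ * α) a z := by
  have hτ0 : 0 < τ := hσ.trans_le hτ
  have hb : 0 ≤ τ * α := by positivity
  have key : 2 * σ ≤ |softErr τ (τ * α) a z + a| ∧ 2 * σ ≤ |softErr τ (τ * α) a z| := by
    unfold softErr
    rcases hz with ⟨ha, hz⟩ | ⟨ha, hz⟩
    · have h1 : τ * (α + 2) ≤ τ * z := by gcongr; linarith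
      rw [eta_of_le hb (by nlinarith)]
      constructor
      · exact le_trans (by nlinarith) (le_abs_self _)
      · exact le_trans (by nlinarith) (le_abs_self _)
    · have h1 : τ * z ≤ τ * (-(α + 2)) := by gcongr; linarith
      rw [eta_of_le_neg hb (by nlinarith)]
      constructor
      · exact le_trans (by nlinarith) (neg_le_abs _)
      · exact le_trans (by nlinarith) (neg_le_abs _)
  unfold activeErr
  have h2 : min (2 * σ) 1 ≤ min |softErr τ (τ * α) a z + a| 1 := min_le_min_right _ key.1
  have h3 : 0 ≤ min (2 * σ) 1 := by positivity
  gcongr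
  exact key.2

lemma stdG_real_pos_of_open {s : Set ℝ} (hs : IsOpen s) (hne : s.Nonempty) : 0 < stdG.real s := by
  have : IsProbabilityMeasure stdG := stdG_isProbabilityMeasure
  refine ENNReal.toReal_pos (fun h => ?_) (measure_ne_top _ _)
  have := gaussianReal_absolutelyContinuous' 0 (v := 1) one_ne_zero h
  exact (hs.measure_pos volume hne).ne' this

lemma exists_activeErr_lower (σ A : ℝ) (hσ : 0 < σ) : ∃ m : ℝ, 0 < m ∧
    ∀ τ α a : ℝ, σ ≤ τ → 0 ≤ α → α ≤ A → m ≤ ∫ z, activeErr τ (τ * α) a z ∂stdG := by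
  have : IsProbabilityMeasure stdG := stdG_isProbabilityMeasure
  set p := stdG.real (Set.Ici (A + 2)) with hp
  set p' := stdG.real (Set.Iic (-(A + 2))) with hp'
  have hp0 : 0 < p := (stdG_real_pos_of_open isOpen_Ioi ⟨A + 3, by simp; norm_num⟩).trans_le
    (measureReal_mono (s₁ := Set.Ioi (A + 2)) Set.Ioi_subset_Ici_self)
  have hp'0 : 0 < p' := (stdG_real_pos_of_open isOpen_Iio ⟨-(A + 3), by simp; norm_num⟩).trans_le
    (measureReal_mono (s₁ := Set.Iio (-(A + 2))) Set.Iio_subset_Iic_self)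
  set k := min (2 * σ) 1 * (2 * σ) with hk
  have hk0 : 0 < k := by positivity
  have aux : ∀ (τ α a : ℝ) (s : Set ℝ), σ ≤ τ → 0 ≤ α → MeasurableSet s →
      (∀ z ∈ s, k ≤ activeErr τ (τ * α) a z) →
      k * stdG.real s ≤ ∫ z, activeErr τ (τ * α) a z ∂stdG := by
    intro τ α a s hτ hα hs h
    have hτ0 : 0 ≤ τ := (hσ.trans_le hτ).le
    have : ∫ z, s.indicator (fun _ => k) z ∂stdG = k * stdG.real s := by
      rw [integral_indicator_const _ hs, smul_eq_mul, mul_comm]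
    rw [← this]
    refine integral_mono ((integrable_const k).indicator hs)
      (integrable_activeErr hτ0 a (by positivity)) fun z => ?_
    by_cases hz : z ∈ s
    · rw [Set.indicator_of_mem hz]; exact h z hz
    · rw [Set.indicator_of_notMem hz]; exact activeErr_nonneg _ _ _ _
  refine ⟨k * min p p', by positivity, fun τ α a hτ hα hA => ?_⟩
  rcases le_total 0 a with ha | ha
  · refine le_trans ?_ (aux τ α a (Set.Ici (A + 2)) hτ hα measurableSet_Ici fun z hz =>
      le_activeErr_of_large hσ hτ hα hA (Or.inl ⟨ha, hz⟩))
    gcongr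
    exact min_le_left _ _
  · refine le_trans ?_ (aux τ α a (Set.Iic (-(A + 2))) hτ hα measurableSet_Iic fun z hz =>
      le_activeErr_of_large hσ hτ hα hA (Or.inr ⟨ha, hz⟩))
    gcongr
    exact min_le_right _ _

/-- The sum of the expected `ℓ₁` increments of the thresholded vector. -/
def penMean {N : ℕ} (τ b : ℝ) (θ : Fin N → ℝ) : ℝ :=
  ∑ j, ∫ z, (|softErr τ b (θ j) z + θ j| - |θ j|) ∂stdG

/-- The empirical averages of the scalar denoising problem are within `t` of their means; `h` is
the Gaussian vector, `a` the normalised norm of the second Gaussian vector, `h0` a scalar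
Gaussian. -/
structure Typical {N : ℕ} (d σ lam β τ m t : ℝ) (θ h : Fin N → ℝ) (a h0 : ℝ) : Prop where
  inner : |∑ j, h j * softErr τ (τ * lam / β) (θ j) (h j) - d * (τ - β)| ≤ t * d
  sq : |∑ j, softErr τ (τ * lam / β) (θ j) (h j) ^ 2 - d * (τ ^ 2 - σ ^ 2)| ≤ t * d
  pen : |∑ j, (|softErr τ (τ * lam / β) (θ j) (h j) + θ j| - |θ j|)
    - penMean τ (τ * lam / β) θ| ≤ t * d
  norm : |∑ j, h j ^ 2 - N| ≤ t * N
  active : m * N ≤ ∑ j, activeErr τ (τ * lam / β) (θ j) (h j)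
  noise_nonneg : 0 ≤ a
  noise : |a ^ 2 - 1| ≤ t
  scalar : |h0| ≤ t * √d

lemma Typical.abs_noise_sub_one_le {N : ℕ} {d σ lam β τ m t a h0 : ℝ} {θ h : Fin N → ℝ}
    (H : Typical d σ lam β τ m t θ h a h0) : |a - 1| ≤ t := by
  have h1 := H.noise
  have h2 := H.noise_nonneg
  rw [show a ^ 2 - 1 = (a - 1) * (a + 1) by ring, abs_mul, abs_of_nonneg (by linarith : 0 ≤ a + 1)]
    at h1
  nlinarith [abs_nonneg (a - 1)]

/-- The subgradient inequality for the absolute value at the thresholded point. -/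
lemma penalty_subgradient {τ lam β : ℝ} (hτ : 0 < τ) (hβ : 0 < β) (hl : 0 ≤ lam) (a z w : ℝ) :
    lam * |softErr τ (τ * lam / β) a z + a|
      + β * (z - softErr τ (τ * lam / β) a z / τ) * (w - softErr τ (τ * lam / β) a z)
      ≤ lam * |w + a| := by
  have hb : 0 ≤ τ * lam / β := by positivity
  set b := τ * lam / β with hbdef
  have h1 := softErr_subgradient_eq τ a z hb
  have h2 : (τ * z - softErr τ b a z) * (w + a) ≤ b * |w + a| :=
    (le_abs_self _).trans (by rw [abs_mul]; gcongr; exact abs_mul_sub_softErr_le τ a z hb)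
  have h3 : b * (β / τ) = lam := by rw [hbdef]; field_simp
  have h4 : β * (z - softErr τ b a z / τ) = (β / τ) * (τ * z - softErr τ b a z) := by field_simp
  rw [h4, ← h3]
  have : 0 ≤ β / τ := by positivity
  nlinarith [mul_le_mul_of_nonneg_left h2 this]

set_option maxHeartbeats 800000 in
lemma Typical.primal_lower {N : ℕ} {d σ lam β τ m t a h0 : ℝ} {θ h : Fin N → ℝ}
    (H : Typical d σ lam β τ m t θ h a h0) (hd : 0 < d) (hσ : 0 < σ) (hl : 0 ≤ lam)
    (hβ : 0 < β) (hβτ : β ≤ τ) (hστ : σ ≤ τ) (ht : 0 ≤ t) {K : ℝ} (hK : 0 ≤ K)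
    {w : Fin N → ℝ} (hw : ∑ j, w j ^ 2 ≤ K ^ 2 * d) :
    β ^ 2 / 2 + lam / d * penMean τ (τ * lam / β) θ
        - t * (β * (K + σ) * (1 + 1 / σ ^ 2) + 1 + lam + β + β * σ)
      ≤ β * (√((∑ j, w j ^ 2) / d + σ ^ 2) * a) - β * ((∑ j, h j * w j) / d) + β * σ * (h0 / √d)
        + lam / d * ∑ j, (|w j + θ j| - |θ j|) - β ^ 2 / 2 := by
  have hτ : 0 < τ := hβ.trans_le hβτ
  set w0 : Fin N → ℝ := fun j => softErr τ (τ * lam / β) (θ j) (h j) with hw0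
  have hin := H.inner; have hsq := H.sq; have hpen := H.pen
  simp only [← show ∀ j, w0 j = softErr τ (τ * lam / β) (θ j) (h j) from fun _ => rfl]
    at hin hsq hpen
  have hconv : lam * ∑ j, (|w0 j + θ j| - |θ j|) + β * (∑ j, h j * w j - ∑ j, h j * w0 j)
      - β / τ * (∑ j, w0 j * w j - ∑ j, w0 j ^ 2) ≤ lam * ∑ j, (|w j + θ j| - |θ j|) := by
    simp only [Finset.mul_sum, ← Finset.sum_sub_distrib, ← Finset.sum_add_distrib]
    refine Finset.sum_le_sum fun j _ => ?_
    have := penalty_subgradient hτ hβ hl (θ j) (h j) (w j)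
    rw [show softErr τ (τ * lam / β) (θ j) (h j) = w0 j from rfl] at this
    have e : β * (h j - w0 j / τ) * (w j - w0 j)
      = β * (h j * w j - h j * w0 j) - β / τ * (w0 j * w j - w0 j ^ 2) := by ring
    linarith
  set A := ∑ j, h j * w0 j with hA
  set B := ∑ j, w0 j ^ 2 with hB
  set P0 := ∑ j, (|w0 j + θ j| - |θ j|) with hP0
  set W := ∑ j, w j ^ 2 with hW
  have hB0 : 0 ≤ B := Finset.sum_nonneg fun _ _ => sq_nonneg _
  have hW0 : 0 ≤ W := Finset.sum_nonneg fun _ _ => sq_nonneg _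
  set T := √(W / d + σ ^ 2) with hT
  have hTsq : T ^ 2 = W / d + σ ^ 2 := Real.sq_sqrt (by positivity)
  have hT0 : 0 ≤ T := Real.sqrt_nonneg _
  have hTK : T ≤ K + σ := by
    refine Real.sqrt_le_iff.mpr ⟨by positivity, ?_⟩
    have : W / d ≤ K ^ 2 := by rwa [div_le_iff₀ hd]
    nlinarith
  set T0 := √(B / d + σ ^ 2) with hT0d
  have hT0sq : T0 ^ 2 = B / d + σ ^ 2 := Real.sq_sqrt (by positivity)
  have hT00 : 0 ≤ T0 := Real.sqrt_nonneg _
  have hcs : (∑ j, w0 j * w j) / d + σ ^ 2 ≤ T * T0 := by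
    have h1 := inner_le_of_sq_sum w0 w (Real.sqrt_nonneg B) (Real.sqrt_nonneg W)
      (by rw [Real.sq_sqrt hB0]) (by rw [Real.sq_sqrt hW0])
    have h2 : (∑ j, w0 j * w j) / d ≤ √(B / d) * √(W / d) := by
      rw [Real.sqrt_div hB0, Real.sqrt_div hW0, div_mul_div_comm, Real.mul_self_sqrt hd.le]
      gcongr
    have h3 : √(B / d) ^ 2 = B / d := Real.sq_sqrt (by positivity)
    have h4 : √(W / d) ^ 2 = W / d := Real.sq_sqrt (by positivity)
    have h5 : |√(B / d) * √(W / d) + σ ^ 2| ≤ T * T0 := by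
      refine abs_le_of_sq_le_sq ?_ (by positivity)
      rw [mul_pow T, hTsq, hT0sq]
      calc _ ≤ (√(W / d) ^ 2 + σ ^ 2) * (√(B / d) ^ 2 + σ ^ 2) := by
            nlinarith [mul_nonneg (sq_nonneg σ) (sq_nonneg (√(B / d) - √(W / d)))]
        _ = _ := by rw [h3, h4]
    linarith [le_abs_self (√(B / d) * √(W / d) + σ ^ 2)]
  have hT0τ : T0 ≤ τ + t / τ := by
    refine Real.sqrt_le_iff.mpr ⟨by positivity, ?_⟩
    have : B / d ≤ τ ^ 2 - σ ^ 2 + t := by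
      rw [div_le_iff₀ hd]; have := (abs_le.1 hsq).2; nlinarith
    have e : (τ + t / τ) ^ 2 = τ ^ 2 + 2 * t + (t / τ) ^ 2 := by field_simp; ring
    nlinarith [sq_nonneg (t / τ)]
  clear_value T T0 A B P0 W w0
  have hr1 : β / τ ≤ 1 := (div_le_one hτ).mpr hβτ
  have hr0 : 0 ≤ β / τ := by positivity
  have hrτ : β / τ * τ = β := by field_simp
  have ha : 1 - t ≤ a := by linarith [(abs_le.1 H.abs_noise_sub_one_le).1]
  have e1 : β * T * (1 - t) ≤ β * T * a := by gcongr
  have e2 : β / τ * (T * T0) ≤ β * T + β * T * (t * (1 / σ ^ 2)) := by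
    calc β / τ * (T * T0) ≤ β / τ * (T * (τ + t / τ)) := by gcongr
      _ = β * T + β * T * (t * (1 / τ ^ 2)) := by field_simp
      _ ≤ β * T + β * T * (t * (1 / σ ^ 2)) := by
        have : 1 / τ ^ 2 ≤ 1 / σ ^ 2 := by gcongr
        gcongr
  have e3 : β * T * (t * (1 + 1 / σ ^ 2)) ≤ β * (K + σ) * (t * (1 + 1 / σ ^ 2)) := by gcongr
  have hBl : τ ^ 2 - σ ^ 2 - t ≤ B / d := by
    rw [le_div_iff₀ hd]; have := (abs_le.1 hsq).1; nlinarith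
  have e4 : β * τ - t ≤ β / τ * (σ ^ 2 + B / d) := by
    calc β * τ - t ≤ β * τ - β / τ * t := by nlinarith
      _ = β / τ * (τ ^ 2 - t) := by field_simp
      _ ≤ _ := by gcongr; linarith
  have e5 : β * (A / d) ≤ β * (τ - β + t) := by
    gcongr
    rw [div_le_iff₀ hd]; have := (abs_le.1 hin).2; nlinarith
  have e6 : lam / d * (penMean τ (τ * lam / β) θ - t * d) ≤ lam / d * P0 := by
    gcongr
    have := (abs_le.1 hpen).1; linarith
  have e6' : lam / d * (t * d) = lam * t := by field_simp
  have hsd : 0 < √d := Real.sqrt_pos.mpr hd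
  have e7 : β * σ * (-t) ≤ β * σ * (h0 / √d) := by
    gcongr
    rw [le_div_iff₀ hsd]; have := (abs_le.1 H.scalar).1; linarith
  have e8 : β / τ * ((∑ j, w0 j * w j) / d + σ ^ 2) ≤ β / τ * (T * T0) := by gcongr
  have e9 : lam / d * P0 + β * ((∑ j, h j * w j) / d - A / d)
      - β / τ * ((∑ j, w0 j * w j) / d - B / d) ≤ lam / d * ∑ j, (|w j + θ j| - |θ j|) := by
    have := div_le_div_of_nonneg_right hconv hd.le
    calc _ = (lam * P0 + β * (∑ j, h j * w j - A) - β / τ * (∑ j, w0 j * w j - B)) / d := by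
          field_simp
      _ ≤ _ := this
      _ = _ := by ring
  linarith

/-- The subgradient of the absolute value at the thresholded point selected by thresholding. -/
def softDual (τ lam β a z : ℝ) : ℝ :=
  β / lam * (z - softErr τ (τ * lam / β) a z / τ)

lemma softDual_mul {τ lam β : ℝ} (hτ : 0 < τ) (hβ : 0 < β) (hl : 0 < lam) (a z : ℝ) :
    softDual τ lam β a z * (softErr τ (τ * lam / β) a z + a)
      = |softErr τ (τ * lam / β) a z + a| := by
  have hb : 0 ≤ τ * lam / β := by positivity
  have h1 := softErr_subgradient_eq τ a z hb
  have h2 : softDual τ lam β a z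
      = (τ * lam / β)⁻¹ * (τ * z - softErr τ (τ * lam / β) a z) := by
    unfold softDual; field_simp
  rw [h2, mul_assoc, h1, inv_mul_cancel_left₀ (by positivity)]

lemma abs_softDual_le {τ lam β : ℝ} (hτ : 0 < τ) (hβ : 0 < β) (hl : 0 < lam) (a z : ℝ) :
    |softDual τ lam β a z| ≤ 1 := by
  have hb : 0 < τ * lam / β := by positivity
  have h1 := abs_mul_sub_softErr_le τ a z hb.le
  have h2 : softDual τ lam β a z
      = (τ * z - softErr τ (τ * lam / β) a z) / (τ * lam / β) := by
    unfold softDual; field_simp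
  rw [h2, abs_div, abs_of_pos hb]
  exact (div_le_one hb).mpr h1

/-- The gap in the `ℓ₁` duality controls the distance to the selected subgradient on the
support of the thresholded point. -/
lemma abs_mul_abs_sub_softDual {τ lam β : ℝ} (hτ : 0 < τ) (hβ : 0 < β) (hl : 0 < lam)
    (a z v : ℝ) (hv : |v| ≤ 1) :
    |softErr τ (τ * lam / β) a z + a| * |v - softDual τ lam β a z|
      = |softErr τ (τ * lam / β) a z + a| - v * (softErr τ (τ * lam / β) a z + a) := by
  have h := softDual_mul hτ hβ hl a z
  have h1 := abs_le.1 (abs_softDual_le hτ hβ hl a z)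
  set y := softErr τ (τ * lam / β) a z + a
  set v0 := softDual τ lam β a z
  have h2 := abs_le.1 hv
  rcases lt_trichotomy y 0 with hy | hy | hy
  · rw [abs_of_neg hy] at h ⊢
    have : v0 = -1 := by nlinarith
    rw [this, sub_neg_eq_add, abs_of_nonneg (by linarith)]; ring
  · simp [hy]
  · rw [abs_of_pos hy] at h ⊢
    have : v0 = 1 := by nlinarith
    rw [this, abs_of_nonpos (by linarith)]; ring

lemma Typical.dual_slack {N : ℕ} {d σ lam β τ m t a h0 : ℝ} {θ h : Fin N → ℝ}
    (H : Typical d σ lam β τ m t θ h a h0) (hd : 0 < d) (hσ : 0 < σ) (hl : 0 < lam)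
    (hβ : 0 < β) (hβτ : β ≤ τ) (hστ : σ ≤ τ) (ht : 0 ≤ t) (ht1 : t ≤ 1)
    {M : ℝ} (hτM : τ ≤ M) (hlM : lam ≤ M) (hσM : 1 ≤ M * σ) (hM : 1 ≤ M)
    {v : Fin N → ℝ} {bb G p : ℝ} (hv : ∀ j, |v j| ≤ 1) (hbb : 0 ≤ bb)
    (hG : -(bb * a) ≤ G)
    (hAO : √(τ ^ 2 - σ ^ 2 + t) * p - σ * bb * (h0 / √d) + √(τ ^ 2 + t) * G + bb ^ 2 / 2
      - lam / d * ∑ j, (v j * θ j - |θ j|)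
        ≤ -(β ^ 2 / 2 + lam / d * penMean τ (τ * lam / β) θ) + M * t) :
    (√(τ ^ 2 - σ ^ 2 + t) * p
        + (∑ j, (lam * v j - bb * h j) * softErr τ (τ * lam / β) (θ j) (h j)) / d)
      + lam / d * ∑ j, |softErr τ (τ * lam / β) (θ j) (h j) + θ j|
        * |v j - softDual τ lam β (θ j) (h j)|
      + (bb - β) ^ 2 / 4 ≤ 32 * M ^ 2 * t := by
  have hτ : 0 < τ := hβ.trans_le hβτ
  have e0 : (∑ j, (lam * v j - bb * h j) * softErr τ (τ * lam / β) (θ j) (h j)) / d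
      + lam / d * ∑ j, |softErr τ (τ * lam / β) (θ j) (h j) + θ j|
        * |v j - softDual τ lam β (θ j) (h j)|
      = lam / d * ∑ j, (|softErr τ (τ * lam / β) (θ j) (h j) + θ j| - |θ j|)
        - lam / d * ∑ j, (v j * θ j - |θ j|)
        - bb * ((∑ j, h j * softErr τ (τ * lam / β) (θ j) (h j)) / d) := by
    simp only [fun j => abs_mul_abs_sub_softDual hτ hβ hl (θ j) (h j) (v j) (hv j)]
    simp only [div_eq_mul_inv, Finset.mul_sum, Finset.sum_mul, ← Finset.sum_sub_distrib,
      ← Finset.sum_add_distrib]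
    refine Finset.sum_congr rfl fun j _ => ?_
    ring
  have hin := H.inner
  have hpen := H.pen
  set A := ∑ j, h j * softErr τ (τ * lam / β) (θ j) (h j)
  set P0 := ∑ j, (|softErr τ (τ * lam / β) (θ j) (h j) + θ j| - |θ j|)
  have ha : a ≤ 1 + t := by linarith [(abs_le.1 H.abs_noise_sub_one_le).2]
  have hM0 : 0 < M := by linarith
  have hsq : √(τ ^ 2 + t) ≤ τ + M * t := by
    refine Real.sqrt_le_iff.mpr ⟨by positivity, ?_⟩
    have : 1 ≤ M * τ := hσM.trans (by gcongr)
    nlinarith [mul_nonneg (sub_nonneg.2 this) ht, sq_nonneg (M * t)]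
  have e1 : -(√(τ ^ 2 + t) * G) ≤ bb * (τ + 3 * M * t) := by
    have h1 : -(√(τ ^ 2 + t) * G) ≤ √(τ ^ 2 + t) * (bb * a) := by
      have := mul_le_mul_of_nonneg_left hG (Real.sqrt_nonneg (τ ^ 2 + t))
      linarith
    have h2 : √(τ ^ 2 + t) * (bb * a) ≤ (τ + M * t) * (bb * (1 + t)) := by
      have := H.noise_nonneg
      gcongr
    have h3 : (τ + M * t) * (1 + t) ≤ τ + 3 * M * t := by
      nlinarith [mul_nonneg ht (sub_nonneg.2 hτM), mul_nonneg (mul_nonneg hM0.le ht)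
        (sub_nonneg.2 ht1)]
    calc _ ≤ _ := h1
      _ ≤ _ := h2
      _ = bb * ((τ + M * t) * (1 + t)) := by ring
      _ ≤ _ := by gcongr
  have hsd : 0 < √d := Real.sqrt_pos.mpr hd
  have e2 : σ * bb * (h0 / √d) ≤ M * bb * t := by
    have : h0 / √d ≤ t := by
      rw [div_le_iff₀ hsd]; exact (le_abs_self _).trans H.scalar
    calc σ * bb * (h0 / √d) ≤ σ * bb * t := by gcongr
      _ ≤ M * bb * t := by gcongr; linarith
  have e3 : lam / d * P0 ≤ lam / d * penMean τ (τ * lam / β) θ + M * t := by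
    have h1 : lam / d * P0 ≤ lam / d * (penMean τ (τ * lam / β) θ + t * d) := by
      gcongr
      have := (abs_le.1 hpen).2; linarith
    have h2 : lam / d * (t * d) = lam * t := by field_simp
    have h3 : lam * t ≤ M * t := by gcongr
    linarith
  have e4 : bb * (τ - β - t) ≤ bb * (A / d) := by
    gcongr
    rw [le_div_iff₀ hd]; have := (abs_le.1 hin).1; nlinarith
  have e5 : t * bb ≤ M * t * bb := by nlinarith only [mul_nonneg ht hbb, hM]
  have e6 : 5 * M * t * (bb - β) ≤ (bb - β) ^ 2 / 4 + 25 * M ^ 2 * t := by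
    have : 25 * M ^ 2 * t ^ 2 ≤ 25 * M ^ 2 * t := by
      gcongr; nlinarith only [ht, ht1]
    have h1 := sq_nonneg ((bb - β) / 2 - 5 * M * t)
    have h2 : ((bb - β) / 2 - 5 * M * t) ^ 2
      = (bb - β) ^ 2 / 4 - 5 * M * t * (bb - β) + 25 * M ^ 2 * t ^ 2 := by ring
    linarith
  have e7 : M * t * β ≤ M ^ 2 * t := by
    calc M * t * β ≤ M * t * M := by gcongr; linarith
      _ = _ := by ring
  have e8 : M * t ≤ M ^ 2 * t := by gcongr; nlinarith only [hM]
  have e9 : (bb - β) ^ 2 / 4 = bb ^ 2 / 2 - bb * β + β ^ 2 / 2 - (bb - β) ^ 2 / 4 := by ring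
  rw [add_assoc, add_assoc, ← add_assoc (_ / d), e0]
  have e10 : M * bb * t = M * t * (bb - β) + M * t * β := by ring
  have e11 : bb * (τ + 3 * M * t) = bb * τ + 3 * (M * t * (bb - β)) + 3 * (M * t * β) := by ring
  have e12 : bb * (τ - β - t) = bb * τ - bb * β - t * bb := by ring
  have e13 : M * t * bb = M * t * (bb - β) + M * t * β := by ring
  have e14 : M ^ 2 * t * 32 = 32 * M ^ 2 * t := by ring
  linarith

lemma sum_sq_align {N : ℕ} {P w : Fin N → ℝ} {d p s : ℝ} (hs : 0 < s)
    (hp : ∑ j, P j ^ 2 = p ^ 2 * d) (hw : ∑ j, w j ^ 2 = s ^ 2 * d) :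
    ∑ j, (P j + p / s * w j) ^ 2 = 2 * (p / s) * (s * p * d + ∑ j, P j * w j) := by
  have : ∀ j, (P j + p / s * w j) ^ 2
      = P j ^ 2 + 2 * (p / s) * (P j * w j) + (p / s) ^ 2 * w j ^ 2 := fun j => by ring
  simp only [this, Finset.sum_add_distrib, ← Finset.mul_sum, hp, hw]
  field_simp
  ring

lemma sum_abs_sq_le {N : ℕ} (e : Fin N → ℝ) : (∑ j, |e j|) ^ 2 ≤ N * ∑ j, e j ^ 2 := by
  have := sq_sum_le_card_mul_sum_sq (s := Finset.univ) (f := fun j => |e j|)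
  simpa using this

/-- If the slack in the dual objective is of order `t`, then the dual vector is within order
`√t` of the thresholded one. -/
lemma dual_vector_dist {N : ℕ} {P w h D y : Fin N → ℝ} {d lam r p s R b M t m : ℝ}
    (hN : 0 < (N : ℝ)) (hd : 0 < d) (hNd : N ≤ M * d) (hdN : d ≤ M * N) (hM : 1 ≤ M)
    (hl : 0 < lam) (hp0 : 0 ≤ p) (hs0 : 0 ≤ s) (hsR : s ≤ R) (ht : 0 ≤ t) (ht1 : t ≤ 1)
    (hm : 1 ≤ M * m) (hsM : s ≤ 2 * M)
    (hD : ∀ j, lam * D j = P j + b * h j + r * w j)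
    (hp : ∑ j, P j ^ 2 = p ^ 2 * d) (hw : ∑ j, w j ^ 2 = s ^ 2 * d)
    (hpM : p ^ 2 ≤ 1100 * M ^ 3)
    (hh : ∑ j, h j ^ 2 ≤ 2 * N) (hb : b ^ 2 ≤ 128 * M ^ 2 * t)
    (hS1 : R * p + (∑ j, P j * w j) / d ≤ 32 * M ^ 2 * t)
    (hS3 : lam / d * ∑ j, |y j| * |D j| ≤ 32 * M ^ 2 * t)
    (hact : m * N ≤ ∑ j, min |y j| 1 * |w j|) :
    lam ^ 2 * ∑ j, D j ^ 2 ≤ 200000 * M ^ 12 * t * d := by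
  have hM0 : 0 < M := by linarith
  have hm0 : 0 < m := by
    by_contra hc
    nlinarith only [hc, hm, hM0]
  have hs2 : 1 ≤ M ^ 3 * s ^ 2 := by
    have h1 : m * N ≤ ∑ j, |w j| := hact.trans (Finset.sum_le_sum fun j _ =>
      mul_le_of_le_one_left (abs_nonneg _) (min_le_right _ _))
    have h2 : (m * N) ^ 2 ≤ N * (s ^ 2 * d) := by
      rw [← hw]; exact (pow_le_pow_left₀ (by positivity) h1 2).trans (sum_abs_sq_le w)
    have h3 : N * (s ^ 2 * d) ≤ N * (s ^ 2 * (M * N)) := by gcongr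
    have h4 : m ^ 2 ≤ M * s ^ 2 := by
      have : m ^ 2 * (N ^ 2 : ℝ) ≤ M * s ^ 2 * N ^ 2 := by linarith
      exact le_of_mul_le_mul_right this (by positivity)
    calc (1 : ℝ) ≤ (M * m) ^ 2 := one_le_pow₀ hm
      _ = M ^ 2 * m ^ 2 := by ring
      _ ≤ M ^ 2 * (M * s ^ 2) := by gcongr
      _ = _ := by ring
  have hs : 0 < s := by
    refine lt_of_le_of_ne hs0 fun h => ?_
    rw [← h] at hs2; norm_num at hs2
  set c := p / s with hc
  have hc0 : 0 ≤ c := by positivity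
  have hc1 : c ≤ 34 * M ^ 3 := by
    refine (abs_le_of_sq_le_sq' (b := 34 * M ^ 3) ?_ (by positivity)).2
    have h1 : c ^ 2 * s ^ 2 = p ^ 2 := by rw [hc]; field_simp
    calc c ^ 2 ≤ c ^ 2 * (M ^ 3 * s ^ 2) := le_mul_of_one_le_right (by positivity) hs2
      _ = M ^ 3 * p ^ 2 := by rw [← h1]; ring
      _ ≤ M ^ 3 * (1100 * M ^ 3) := by gcongr
      _ ≤ _ := by nlinarith only [pow_pos hM0 6]
  have hE := sum_sq_align hs hp hw
  rw [← hc] at hE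
  have hE1 : ∑ j, (P j + c * w j) ^ 2 ≤ 2176 * M ^ 5 * t * d := by
    have h1 : s * p * d + ∑ j, P j * w j ≤ 32 * M ^ 2 * t * d := by
      have h2 : s * p * d ≤ R * p * d := by gcongr
      have h3 : (R * p + (∑ j, P j * w j) / d) * d = R * p * d + ∑ j, P j * w j := by
        field_simp
      have := mul_le_mul_of_nonneg_right hS1 hd.le
      linarith
    rw [hE]
    calc 2 * c * (s * p * d + ∑ j, P j * w j) ≤ 2 * c * (32 * M ^ 2 * t * d) := by gcongr
      _ ≤ 2 * (34 * M ^ 3) * (32 * M ^ 2 * t * d) := by gcongr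
      _ = _ := by ring
  set e : Fin N → ℝ := fun j => b * h j + (P j + c * w j) with he
  have hM35 : M ^ 3 ≤ M ^ 5 := by gcongr; norm_num
  have hM58 : M ^ 5 ≤ M ^ 12 := by gcongr; norm_num
  have hM10 : M ^ 10 ≤ M ^ 12 := by gcongr; norm_num
  have he2 : ∑ j, e j ^ 2 ≤ 4900 * M ^ 5 * t * d := by
    have h1 : ∑ j, e j ^ 2 ≤ 2 * b ^ 2 * ∑ j, h j ^ 2 + 2 * ∑ j, (P j + c * w j) ^ 2 := by
      rw [Finset.mul_sum, Finset.mul_sum, ← Finset.sum_add_distrib]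
      refine Finset.sum_le_sum fun j _ => ?_
      rw [he]; nlinarith only [sq_nonneg (b * h j - (P j + c * w j))]
    have h2 : 2 * b ^ 2 * ∑ j, h j ^ 2 ≤ 2 * (128 * M ^ 2 * t) * (2 * (M * d)) := by
      have : ∑ j, h j ^ 2 ≤ 2 * (M * d) := by linarith
      have h0 : 0 ≤ ∑ j, h j ^ 2 := Finset.sum_nonneg fun _ _ => sq_nonneg _
      gcongr
    have h3 : 512 * (M ^ 3 * (t * d)) ≤ 512 * (M ^ 5 * (t * d)) := by gcongr
    have h4 : 0 ≤ M ^ 5 * (t * d) := by positivity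
    linarith
  have hpt : ∀ j, |c - r| * (min |y j| 1 * |w j|) ≤ lam * (|y j| * |D j|) + |e j| := by
    intro j
    have h1 : (c - r) * w j = e j - lam * D j := by rw [he, hD j]; ring
    have h2 : |c - r| * |w j| ≤ |e j| + lam * |D j| := by
      rw [← abs_mul, h1]
      refine (abs_sub _ _).trans ?_
      rw [abs_mul lam, abs_of_pos hl]
    calc |c - r| * (min |y j| 1 * |w j|) = min |y j| 1 * (|c - r| * |w j|) := by ring
      _ ≤ min |y j| 1 * (|e j| + lam * |D j|) := by gcongr
      _ = min |y j| 1 * (lam * |D j|) + min |y j| 1 * |e j| := by ring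
      _ ≤ |y j| * (lam * |D j|) + 1 * |e j| := by
        gcongr
        · exact min_le_left _ _
        · exact min_le_right _ _
      _ = _ := by ring
  have hcr : (c - r) ^ 2 ≤ 12000 * M ^ 8 * t := by
    have h1 : |c - r| * (m * N) ≤ 32 * M ^ 2 * t * d + ∑ j, |e j| := by
      calc |c - r| * (m * N) ≤ |c - r| * ∑ j, min |y j| 1 * |w j| := by gcongr
        _ = ∑ j, |c - r| * (min |y j| 1 * |w j|) := Finset.mul_sum _ _ _
        _ ≤ ∑ j, (lam * (|y j| * |D j|) + |e j|) := Finset.sum_le_sum fun j _ => hpt j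
        _ = (lam / d * ∑ j, |y j| * |D j|) * d + ∑ j, |e j| := by
          rw [Finset.sum_add_distrib, ← Finset.mul_sum]; field_simp
        _ ≤ _ := by gcongr
    have h2 : (|c - r| * (m * N)) ^ 2 ≤ 2 * (32 * M ^ 2 * t * d) ^ 2 + 2 * (∑ j, |e j|) ^ 2 := by
      refine (pow_le_pow_left₀ (by positivity) h1 2).trans ?_
      nlinarith only [sq_nonneg (32 * M ^ 2 * t * d - ∑ j, |e j|)]
    have h3 : (∑ j, |e j|) ^ 2 ≤ N * (4900 * M ^ 5 * t * (M * N)) := by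
      refine (sum_abs_sq_le e).trans ?_
      gcongr
      exact he2.trans (by gcongr)
    have h4 : (32 * M ^ 2 * t * d) ^ 2 ≤ 1024 * M ^ 6 * t * N ^ 2 := by
      calc (32 * M ^ 2 * t * d) ^ 2 ≤ (32 * M ^ 2 * t * (M * N)) ^ 2 := by gcongr
        _ = 1024 * M ^ 6 * (t * t) * N ^ 2 := by ring
        _ ≤ 1024 * M ^ 6 * (t * 1) * N ^ 2 := by gcongr
        _ = _ := by ring
    have h5 : ((c - r) ^ 2 * m ^ 2) * (N : ℝ) ^ 2 ≤ (12000 * M ^ 6 * t) * N ^ 2 := by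
      have e1 : (|c - r| * (m * N)) ^ 2 = ((c - r) ^ 2 * m ^ 2) * (N : ℝ) ^ 2 := by
        rw [mul_pow, sq_abs]; ring
      rw [← e1]
      have : 0 ≤ M ^ 6 * t * (N : ℝ) ^ 2 := by positivity
      linarith
    have h6 := le_of_mul_le_mul_right h5 (by positivity)
    calc (c - r) ^ 2 ≤ (c - r) ^ 2 * (M * m) ^ 2 :=
          le_mul_of_one_le_right (by positivity) (one_le_pow₀ hm)
      _ = M ^ 2 * ((c - r) ^ 2 * m ^ 2) := by ring
      _ ≤ M ^ 2 * (12000 * M ^ 6 * t) := by gcongr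
      _ = _ := by ring
  have hfin : lam ^ 2 * ∑ j, D j ^ 2 ≤ 2 * ∑ j, e j ^ 2 + 2 * (c - r) ^ 2 * (s ^ 2 * d) := by
    rw [← hw, Finset.mul_sum, Finset.mul_sum, Finset.mul_sum, ← Finset.sum_add_distrib]
    refine Finset.sum_le_sum fun j _ => ?_
    have h1 : lam * D j = e j - (c - r) * w j := by rw [he, hD j]; ring
    rw [← mul_pow, h1]
    nlinarith only [sq_nonneg (e j + (c - r) * w j)]
  calc lam ^ 2 * ∑ j, D j ^ 2 ≤ _ := hfin
    _ ≤ 2 * (4900 * M ^ 5 * t * d) + 2 * (12000 * M ^ 8 * t) * ((2 * M) ^ 2 * d) := by gcongr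
    _ = 9800 * (M ^ 5 * t * d) + 96000 * (M ^ 10 * t * d) := by ring
    _ ≤ 9800 * (M ^ 12 * t * d) + 96000 * (M ^ 12 * t * d) := by gcongr
    _ ≤ _ := by
      have : 0 ≤ M ^ 12 * t * d := by positivity
      linarith

/-- The limiting value of the normalised squared norm of the subgradient. -/
def dualNorm (δ σ lam β τ : ℝ) : ℝ :=
  β ^ 2 / lam ^ 2 * (1 - 2 * δ * (τ - β) / τ + δ * (τ ^ 2 - σ ^ 2) / τ ^ 2)

lemma StateEvo.dualNorm_eq {N : ℕ} {δ σ lam β τ : ℝ} {θ : Fin N → ℝ}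
    (h : StateEvo δ σ (empDist θ) lam β τ) (hN : 0 < N) (hδ : 0 < δ) :
    β ^ 2 / lam ^ 2 * (1 + δ - 2 * sStar (empDist θ) τ (lam / β) - δ * σ ^ 2 / τ ^ 2)
      = dualNorm δ σ lam β τ := by
  have := h.2.1
  rw [h.sStar_eq hN hδ]
  unfold dualNorm
  field_simp
  ring

lemma Typical.softDual_norm {N : ℕ} {δ σ lam β τ m t a h0 M : ℝ} {θ h : Fin N → ℝ}
    (H : Typical (δ * N) σ lam β τ m t θ h a h0) (hN : 0 < (N : ℝ)) (hδ : 0 < δ)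
    (hl : 0 < lam) (hβ : 0 < β) (hβτ : β ≤ τ) (hστ : σ ≤ τ) (ht : 0 ≤ t)
    (hτM : τ ≤ M) (hσM : 1 ≤ M * σ) (hM : 1 ≤ M) (hδM : δ ≤ M) (hlM' : 1 ≤ M * lam) :
    |(∑ j, softDual τ lam β (θ j) (h j) ^ 2) / N - dualNorm δ σ lam β τ| ≤ 4 * M ^ 7 * t := by
  have hτ : 0 < τ := hβ.trans_le hβτ
  have hM0 : 0 < M := by linarith
  have h1 := H.inner
  have h2 := H.sq
  have h3 := H.norm
  set A := ∑ j, h j * softErr τ (τ * lam / β) (θ j) (h j)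
  set B := ∑ j, softErr τ (τ * lam / β) (θ j) (h j) ^ 2
  set Q := ∑ j, h j ^ 2
  have e1 : (∑ j, softDual τ lam β (θ j) (h j) ^ 2)
      = β ^ 2 / lam ^ 2 * (Q - 2 / τ * A + 1 / τ ^ 2 * B) := by
    simp only [A, B, Q, Finset.mul_sum, ← Finset.sum_sub_distrib, ← Finset.sum_add_distrib]
    refine Finset.sum_congr rfl fun j _ => ?_
    unfold softDual
    field_simp
    ring
  have e2 : (∑ j, softDual τ lam β (θ j) (h j) ^ 2) / N - dualNorm δ σ lam β τ
      = β ^ 2 / lam ^ 2 * ((Q - N) / N - 2 / τ * (A - δ * N * (τ - β)) / N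
        + 1 / τ ^ 2 * (B - δ * N * (τ ^ 2 - σ ^ 2)) / N) := by
    rw [e1]; unfold dualNorm; field_simp; ring
  have hτ1 : 1 / τ ≤ M := by
    rw [div_le_iff₀ hτ]; exact hσM.trans (by gcongr)
  have hl1 : 1 / lam ≤ M := by rwa [div_le_iff₀ hl]
  have hbl : β ^ 2 / lam ^ 2 ≤ M ^ 4 := by
    calc β ^ 2 / lam ^ 2 = β ^ 2 * (1 / lam) ^ 2 := by field_simp
      _ ≤ M ^ 2 * M ^ 2 := by gcongr; linarith
      _ = _ := by ring
  have a1 : |(Q - N) / N| ≤ M ^ 3 * t := by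
    rw [abs_div, abs_of_pos hN, div_le_iff₀ hN]
    refine h3.trans ?_
    have : 1 * (t * N) ≤ M ^ 3 * (t * N) := by gcongr; exact one_le_pow₀ hM
    linarith
  have a2 : |2 / τ * (A - δ * N * (τ - β)) / N| ≤ 2 * M ^ 2 * t := by
    rw [abs_div, abs_of_pos hN, div_le_iff₀ hN, abs_mul, abs_of_pos (by positivity : 0 < 2 / τ)]
    calc 2 / τ * |A - δ * N * (τ - β)| ≤ 2 / τ * (t * (δ * N)) := by gcongr
      _ = 2 * (1 / τ) * (t * (δ * N)) := by ring
      _ ≤ 2 * M * (t * (M * N)) := by gcongr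
      _ = _ := by ring
  have a3 : |1 / τ ^ 2 * (B - δ * N * (τ ^ 2 - σ ^ 2)) / N| ≤ M ^ 3 * t := by
    rw [abs_div, abs_of_pos hN, div_le_iff₀ hN, abs_mul, abs_of_pos (by positivity : 0 < 1 / τ ^ 2)]
    calc 1 / τ ^ 2 * |B - δ * N * (τ ^ 2 - σ ^ 2)| ≤ 1 / τ ^ 2 * (t * (δ * N)) := by gcongr
      _ = (1 / τ) ^ 2 * (t * (δ * N)) := by ring
      _ ≤ M ^ 2 * (t * (M * N)) := by gcongr
      _ = _ := by ring
  have hM23 : 2 * M ^ 2 * t ≤ 2 * M ^ 3 * t := by gcongr; norm_num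
  rw [e2, abs_mul, abs_of_nonneg (by positivity : 0 ≤ β ^ 2 / lam ^ 2)]
  calc _ ≤ M ^ 4 * (4 * M ^ 3 * t) := by
        gcongr
        rw [abs_le] at a1 a2 a3 ⊢
        constructor <;> linarith
    _ = _ := by ring

lemma Typical.dual_norm {N : ℕ} {δ σ lam β τ m t a h0 M : ℝ} {θ h : Fin N → ℝ}
    (H : Typical (δ * N) σ lam β τ m t θ h a h0) (hN : 0 < (N : ℝ)) (hδ : 0 < δ) (hσ : 0 < σ)
    (hl : 0 < lam) (hβ : 0 < β) (hβτ : β ≤ τ) (hστ : σ ≤ τ) (ht : 0 ≤ t) (ht1 : t ≤ 1)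
    (hτM : τ ≤ M) (hlM : lam ≤ M) (hσM : 1 ≤ M * σ) (hM : 1 ≤ M) (hδM : δ ≤ M)
    (hδM' : 1 ≤ M * δ) (hlM' : 1 ≤ M * lam) (hm : 1 ≤ M * m)
    {v : Fin N → ℝ} {bb G p : ℝ} (hv : ∀ j, |v j| ≤ 1) (hbb : 0 ≤ bb) (hp0 : 0 ≤ p)
    (hp : ∑ j, (lam * v j - bb * h j) ^ 2 = p ^ 2 * (δ * N))
    (hG : -(bb * a) ≤ G)
    (hAO : √(τ ^ 2 - σ ^ 2 + t) * p - σ * bb * (h0 / √(δ * N)) + √(τ ^ 2 + t) * G + bb ^ 2 / 2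
      - lam / (δ * N) * ∑ j, (v j * θ j - |θ j|)
        ≤ -(β ^ 2 / 2 + lam / (δ * N) * penMean τ (τ * lam / β) θ) + M * t) :
    |(∑ j, v j ^ 2) / N - dualNorm δ σ lam β τ| ≤ 1000 * M ^ 8 * √t := by
  have hτ : 0 < τ := hβ.trans_le hβτ
  have hM0 : 0 < M := by linarith
  have hd : 0 < δ * N := by positivity
  have hslack := H.dual_slack hd hσ hl hβ hβτ hστ ht ht1 hτM hlM hσM hM hv hbb hG hAO
  have hb : 0 ≤ τ * lam / β := by positivity
  set d := δ * N with hddef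
  have hNd : (N : ℝ) ≤ M * d := by
    calc (N : ℝ) = 1 * N := by ring
      _ ≤ M * δ * N := by gcongr
      _ = _ := by rw [hddef]; ring
  have hdN : d ≤ M * N := by rw [hddef]; gcongr
  set w : Fin N → ℝ := fun j => softErr τ (τ * lam / β) (θ j) (h j) with hwdef
  set v0 : Fin N → ℝ := fun j => softDual τ lam β (θ j) (h j) with hv0
  set P : Fin N → ℝ := fun j => lam * v j - bb * h j with hP
  have hBnn : 0 ≤ ∑ j, w j ^ 2 := Finset.sum_nonneg fun _ _ => sq_nonneg _
  set s := √((∑ j, w j ^ 2) / d) with hs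
  have hs2 : ∑ j, w j ^ 2 = s ^ 2 * d := by
    rw [hs, Real.sq_sqrt (by positivity)]; field_simp
  have hsR : s ≤ √(τ ^ 2 - σ ^ 2 + t) := by
    refine Real.sqrt_le_sqrt ?_
    rw [div_le_iff₀ hd]
    have := (abs_le.1 H.sq).2
    change ∑ j, w j ^ 2 - _ ≤ _ at this
    linarith
  have hR2 : √(τ ^ 2 - σ ^ 2 + t) ≤ 2 * M := by
    refine Real.sqrt_le_iff.mpr ⟨by positivity, ?_⟩
    have : τ ^ 2 ≤ M ^ 2 := by gcongr
    nlinarith only [this, hM, ht1, sq_nonneg σ]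
  set R := √(τ ^ 2 - σ ^ 2 + t)
  have hS1 : 0 ≤ R * p + (∑ j, P j * w j) / d := by
    have h1 := inner_le_of_sq_sum (fun j => -P j) w (a := p * √d) (b := s * √d)
      (by positivity) (by positivity)
      (by simp only [neg_sq]; rw [mul_pow, Real.sq_sqrt hd.le]; exact hp.le)
      (by rw [mul_pow, Real.sq_sqrt hd.le]; exact hs2.le)
    have h2 : p * √d * (s * √d) = s * p * d := by
      rw [show p * √d * (s * √d) = s * p * (√d * √d) by ring, Real.mul_self_sqrt hd.le]
    simp only [neg_mul, Finset.sum_neg_distrib] at h1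
    rw [h2] at h1
    have h3 : -(s * p) ≤ (∑ j, P j * w j) / d := by
      rw [le_div_iff₀ hd]; linarith
    have h4 : s * p ≤ R * p := by gcongr
    linarith
  have hS3 : 0 ≤ lam / d * ∑ j, |w j + θ j| * |v j - v0 j| := by positivity
  have hb2 : (bb - β) ^ 2 ≤ 128 * M ^ 2 * t := by linarith
  have hh : ∑ j, h j ^ 2 ≤ 2 * N := by
    have := (abs_le.1 H.norm).2
    nlinarith only [this, ht1, hN]
  have hpM : p ^ 2 ≤ 1100 * M ^ 3 := by
    have hbb2 : bb ^ 2 ≤ 258 * M ^ 2 := by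
      have h1 : β ^ 2 ≤ M ^ 2 := by gcongr; linarith
      have h2 : 128 * M ^ 2 * t ≤ 128 * M ^ 2 := mul_le_of_le_one_right (by positivity) ht1
      nlinarith only [sq_nonneg (bb - 2 * β), h1, h2, hb2]
    have h3 : ∑ j, P j ^ 2 ≤ 2 * lam ^ 2 * N + 2 * bb ^ 2 * ∑ j, h j ^ 2 := by
      have : ∑ j, P j ^ 2 ≤ ∑ j, (2 * lam ^ 2 + 2 * bb ^ 2 * h j ^ 2) := by
        refine Finset.sum_le_sum fun j _ => ?_
        have h4 : v j ^ 2 ≤ 1 := by rw [← sq_abs]; exact pow_le_one₀ (abs_nonneg _) (hv j)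
        have h5 : lam ^ 2 * v j ^ 2 ≤ lam ^ 2 := mul_le_of_le_one_right (by positivity) h4
        change (lam * v j - bb * h j) ^ 2 ≤ _
        nlinarith only [sq_nonneg (lam * v j + bb * h j), h5]
      refine this.trans_eq ?_
      rw [Finset.sum_add_distrib, Finset.mul_sum, Finset.sum_const, Finset.card_univ,
        Fintype.card_fin, nsmul_eq_mul]
      ring
    have h4 : p ^ 2 * d ≤ 1100 * M ^ 3 * d := by
      rw [← hp]
      refine h3.trans ?_
      calc 2 * lam ^ 2 * N + 2 * bb ^ 2 * ∑ j, h j ^ 2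
          ≤ 2 * M ^ 2 * N + 2 * (258 * M ^ 2) * (2 * N) := by gcongr
        _ = 1034 * M ^ 2 * N := by ring
        _ ≤ 1100 * M ^ 2 * (M * d) := by gcongr; norm_num
        _ = _ := by ring
    exact le_of_mul_le_mul_right h4 hd
  have hmain := dual_vector_dist (P := P) (w := w) (h := h) (D := fun j => v j - v0 j)
    (y := fun j => w j + θ j) (d := d) (lam := lam) (r := β / τ) (p := p) (s := s) (R := R)
    (b := bb - β) (M := M) (t := t) (m := m) hN hd hNd hdN hM hl hp0 (Real.sqrt_nonneg _) hsR
    ht ht1 hm (hsR.trans hR2) (fun j => by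
      simp only [hP, hv0, hwdef, softDual]; field_simp; ring) hp hs2 hpM hh hb2
    (by linarith [sq_nonneg (bb - β)]) (by linarith [sq_nonneg (bb - β)]) H.active
  have hD2 : ∑ j, (v j - v0 j) ^ 2 ≤ 200000 * M ^ 15 * t * N := by
    have hnn : 0 ≤ ∑ j, (v j - v0 j) ^ 2 := Finset.sum_nonneg fun _ _ => sq_nonneg _
    calc ∑ j, (v j - v0 j) ^ 2 ≤ (M * lam) ^ 2 * ∑ j, (v j - v0 j) ^ 2 :=
          le_mul_of_one_le_left hnn (one_le_pow₀ hlM')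
      _ = M ^ 2 * (lam ^ 2 * ∑ j, (v j - v0 j) ^ 2) := by ring
      _ ≤ M ^ 2 * (200000 * M ^ 12 * t * (M * N)) := by
        refine mul_le_mul_of_nonneg_left (hmain.trans ?_) (by positivity)
        gcongr
      _ = _ := by ring
  have hD1 : ∑ j, |v j - v0 j| ≤ 450 * M ^ 8 * √t * N := by
    refine (abs_le_of_sq_le_sq' ?_ (by positivity)).2
    calc (∑ j, |v j - v0 j|) ^ 2 ≤ N * ∑ j, (v j - v0 j) ^ 2 := sum_abs_sq_le _
      _ ≤ N * (200000 * M ^ 15 * t * N) := by gcongr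
      _ = 200000 * M ^ 15 * (t * N ^ 2) := by ring
      _ ≤ 202500 * M ^ 16 * (t * N ^ 2) := by gcongr <;> norm_num
      _ = 202500 * M ^ 16 * ((√t) ^ 2 * N ^ 2) := by rw [Real.sq_sqrt ht]
      _ = _ := by ring
  have hvv : |(∑ j, v j ^ 2) - ∑ j, v0 j ^ 2| ≤ 2 * (450 * M ^ 8 * √t * N) := by
    rw [← Finset.sum_sub_distrib]
    refine (Finset.abs_sum_le_sum_abs _ _).trans ?_
    refine le_trans ?_ (mul_le_mul_of_nonneg_left hD1 zero_le_two)
    rw [Finset.mul_sum]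
    refine Finset.sum_le_sum fun j _ => ?_
    rw [show v j ^ 2 - v0 j ^ 2 = (v j + v0 j) * (v j - v0 j) by ring, abs_mul]
    have h1 : |v0 j| ≤ 1 := abs_softDual_le hτ hβ hl _ _
    gcongr
    exact (abs_add_le _ _).trans (by linarith [hv j])
  have h0 := H.softDual_norm hN hδ hl hβ hβτ hστ ht hτM hσM hM hδM hlM'
  have ht2 : t ≤ √t := Real.le_sqrt_self_iff.mpr ht1
  have hM78 : 4 * M ^ 7 * t ≤ 4 * M ^ 8 * √t := by gcongr; norm_num
  have hvv2 : |(∑ j, v j ^ 2) / N - (∑ j, v0 j ^ 2) / N| ≤ 900 * M ^ 8 * √t := by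
    rw [← sub_div, abs_div, abs_of_pos hN, div_le_iff₀ hN]
    linarith
  have hpos : 0 ≤ M ^ 8 * √t := by positivity
  have := abs_sub_le ((∑ j, v j ^ 2) / N) ((∑ j, v0 j ^ 2) / N) (dualNorm δ σ lam β τ)
  change |(∑ j, v0 j ^ 2) / N - _| ≤ _ at h0
  linarith

set_option maxHeartbeats 1000000 in
lemma typical_prob (δ σ M m : ℝ) (hδ : 0 < δ) (hM : 0 < M) (hm : 0 < m) :
    ∃ C c : ℝ, 0 < C ∧ 0 < c ∧ ∀ {K : Type} [Fintype K] (N n : ℕ) (e₁ : Fin N → K)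
      (e₂ : Fin n → K) (k₀ : K), e₁.Injective → e₂.Injective → 0 < N → (n : ℝ) = δ * N →
      ∀ (θ : Fin N → ℝ) (lam β τ : ℝ), 0 < lam → StateEvo δ σ (empDist θ) lam β τ →
      τ ≤ M → lam ≤ M * β →
      (∀ j, m ≤ ∫ z, activeErr τ (τ * lam / β) (θ j) z ∂stdG) →
      ∀ t : ℝ, 0 ≤ t → t ≤ 1 →
      (stdPi K).real {ω | ¬ Typical (δ * N) σ lam β τ (m / 2) t θ (fun j => ω (e₁ j))
        (√(∑ i, ω (e₂ i) ^ 2) / √(δ * N)) (ω k₀)} ≤ C * Real.exp (-c * N * t ^ 2) := by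
  set A := 2 * (M ^ 2 + (M * M) ^ 2) + (M + M * M) + 2 with hA
  obtain ⟨c, hc, H⟩ := stdPi_concentration A (by positivity)
  obtain ⟨C, hC, Hs⟩ := stdPi_single_tail
  set r := min (min δ 1) (m / 2) with hr
  have hr0 : 0 < r := by positivity
  have hr1 : r ≤ 1 := (min_le_left _ _).trans (min_le_right _ _)
  have hrδ : r ≤ δ := (min_le_left _ _).trans (min_le_left _ _)
  have hrm : r ≤ m / 2 := min_le_right _ _
  set c' := min (min (c * r ^ 2) (c * δ)) (δ / 4) with hc'
  have hc'1 : c' ≤ c * r ^ 2 := (min_le_left _ _).trans (min_le_left _ _)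
  have hc'2 : c' ≤ c * δ := (min_le_left _ _).trans (min_le_right _ _)
  have hc'3 : c' ≤ δ / 4 := min_le_right _ _
  refine ⟨12 + C, c', by positivity, by positivity, ?_⟩
  intro K _ N n e₁ e₂ k₀ he₁ he₂ hN hnN θ lam β τ hl hSE hτM hlM hact t ht0 ht1
  have hβ := hSE.1
  have hτ := hSE.2.1
  have hb := hSE.threshold_nonneg hl.le
  have hbM : τ * lam / β ≤ M * M := by
    rw [div_le_iff₀ hβ]
    calc τ * lam ≤ M * (M * β) := by gcongr
      _ = _ := by ring
  have hN' : (0 : ℝ) < N := by exact_mod_cast hN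
  have hd : 0 < δ * N := by positivity
  set b := τ * lam / β with hbdef
  have hA1 : τ + b ≤ A := by rw [hA]; nlinarith [sq_nonneg M, sq_nonneg (M * M)]
  have hA2 : 2 * (τ ^ 2 + b ^ 2) ≤ A := by
    have : 2 * (τ ^ 2 + b ^ 2) ≤ 2 * (M ^ 2 + (M * M) ^ 2) := by gcongr
    rw [hA]; nlinarith [sq_nonneg M]
  have hA3 : 1 ≤ A := by rw [hA]; nlinarith [sq_nonneg M, sq_nonneg (M * M)]
  have up : ∀ {B x y : ℝ}, |y| ≤ B * (1 + x ^ 2) → B ≤ A → |y| ≤ A * (1 + x ^ 2) :=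
    fun h h' => h.trans (by gcongr)
  set E := Real.exp (-c' * N * t ^ 2) with hE
  have conc : ∀ F : Fin N → ℝ → ℝ, (∀ j, Measurable (F j)) →
      (∀ j x, |F j x| ≤ A * (1 + x ^ 2)) →
      (stdPi K).real {ω | r * t * N ≤ |∑ j, F j (ω (e₁ j)) - ∑ j, ∫ x, F j x ∂stdG|}
        ≤ 2 * E := by
    intro F hF hFA
    have := H e₁ he₁ F hF hFA (r * t) (by positivity) (mul_le_one₀ hr1 ht0 ht1)
    rw [Fintype.card_fin] at this
    refine this.trans ?_
    rw [hE]
    refine mul_le_mul_of_nonneg_left (Real.exp_le_exp.mpr ?_) zero_le_two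
    have : c' * (t ^ 2 * N) ≤ c * r ^ 2 * (t ^ 2 * N) := by gcongr
    linarith
  have hcs := continuous_softErr τ (b := b)
  have p1 := conc (fun j z => z * softErr τ b (θ j) z)
    (fun j => by have := hcs (θ j) hb; exact (by fun_prop : Continuous _).measurable)
    fun j x => up (abs_mul_softErr_le hτ.le (θ j) x hb) hA1
  have p2 := conc (fun j z => softErr τ b (θ j) z ^ 2)
    (fun j => by have := hcs (θ j) hb; exact (by fun_prop : Continuous _).measurable)
    fun j x => up (B := 2 * (τ ^ 2 + b ^ 2))
      (by rw [abs_of_nonneg (sq_nonneg _)]; exact softErr_sq_le hτ.le (θ j) x hb) hA2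
  have p3 := conc (fun j z => |softErr τ b (θ j) z + θ j| - |θ j|)
    (fun j => by have := hcs (θ j) hb; exact (by fun_prop : Continuous _).measurable)
    fun j x => up (abs_penalty_le hτ.le (θ j) x hb) hA1
  have p4 := conc (fun _ z => z ^ 2) (fun j => by fun_prop)
    fun j x => up (B := 1) (by rw [abs_of_nonneg (sq_nonneg _)]; linarith) hA3
  have p5 := conc (fun j z => activeErr τ b (θ j) z)
    (fun j => (continuous_activeErr τ (θ j) hb).measurable)
    fun j x => up (abs_activeErr_le hτ.le (θ j) x hb) hA1
  have p6 := H e₂ he₂ (fun _ z => z ^ 2) (fun j => by fun_prop)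
    (fun j x => up (B := 1) (by rw [abs_of_nonneg (sq_nonneg _)]; linarith) hA3) t ht0 ht1
  have p7 := Hs k₀ (t ^ 2 * (δ * N))
  have q6 : 2 * Real.exp (-c * t ^ 2 * n) ≤ 2 * E := by
    rw [hE, hnN]
    refine mul_le_mul_of_nonneg_left (Real.exp_le_exp.mpr ?_) zero_le_two
    have : c' * (t ^ 2 * N) ≤ c * δ * (t ^ 2 * N) := by gcongr
    linarith
  have q7 : C * Real.exp (-(t ^ 2 * (δ * N) / 4)) ≤ C * E := by
    rw [hE]
    refine mul_le_mul_of_nonneg_left (Real.exp_le_exp.mpr ?_) hC.le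
    have : c' * (t ^ 2 * N) ≤ δ / 4 * (t ^ 2 * N) := by gcongr
    linarith
  rw [hSE.sum_integral_mul hN hδ hl.le] at p1
  rw [hSE.sum_integral_sq hN hδ hl.le] at p2
  simp only [stdG_integral_sq, Finset.sum_const, Finset.card_univ, Fintype.card_fin,
    nsmul_eq_mul, mul_one] at p4 p6
  have hsub : {ω : K → ℝ | ¬ Typical (δ * N) σ lam β τ (m / 2) t θ (fun j => ω (e₁ j))
        (√(∑ i, ω (e₂ i) ^ 2) / √(δ * N)) (ω k₀)} ⊆
      {ω | r * t * N ≤ |∑ j, ω (e₁ j) * softErr τ b (θ j) (ω (e₁ j)) - N * δ * (τ - β)|} ∪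
      {ω | r * t * N ≤ |∑ j, softErr τ b (θ j) (ω (e₁ j)) ^ 2 - N * δ * (τ ^ 2 - σ ^ 2)|} ∪
      {ω | r * t * N ≤ |∑ j, (|softErr τ b (θ j) (ω (e₁ j)) + θ j| - |θ j|)
        - ∑ j, ∫ z, (|softErr τ b (θ j) z + θ j| - |θ j|) ∂stdG|} ∪
      {ω | r * t * N ≤ |∑ j, ω (e₁ j) ^ 2 - N|} ∪
      {ω | r * t * N ≤ |∑ j, activeErr τ b (θ j) (ω (e₁ j))
        - ∑ j, ∫ z, activeErr τ b (θ j) z ∂stdG|} ∪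
      {ω | t * n ≤ |∑ j, ω (e₂ j) ^ 2 - n|} ∪
      {ω | t ^ 2 * (δ * N) ≤ ω k₀ ^ 2} := by
    intro ω hω
    by_contra hcon
    simp only [Set.mem_union, Set.mem_ofPred_eq, not_or, not_le] at hcon
    obtain ⟨⟨⟨⟨⟨⟨h1, h2⟩, h3⟩, h4⟩, h5⟩, h6⟩, h7⟩ := hcon
    have hrt : r * t * N ≤ t * (δ * N) := by
      calc r * t * N ≤ δ * t * N := by gcongr
        _ = _ := by ring
    have hrt1 : r * t * N ≤ t * N := by
      calc r * t * N ≤ 1 * t * N := by gcongr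
        _ = _ := by ring
    have hrt2 : r * t * N ≤ m / 2 * N := by
      calc r * t * N ≤ (m / 2) * 1 * N := by gcongr
        _ = _ := by ring
    refine hω ⟨?_, ?_, ?_, ?_, ?_, ?_, ?_, ?_⟩
    · rw [mul_comm δ]; rw [mul_comm δ] at hrt; exact (h1.le.trans hrt)
    · rw [mul_comm δ]; rw [mul_comm δ] at hrt; exact (h2.le.trans hrt)
    · exact h3.le.trans hrt
    · exact h4.le.trans hrt1
    · have h8 : m * N ≤ ∑ j, ∫ z, activeErr τ b (θ j) z ∂stdG := by
        have := Finset.sum_le_sum fun j (_ : j ∈ (Finset.univ : Finset (Fin N))) => hact j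
        simpa [mul_comm] using this
      have := (abs_lt.1 h5).1
      linarith
    · positivity
    · rw [div_pow, Real.sq_sqrt (Finset.sum_nonneg fun _ _ => sq_nonneg _), Real.sq_sqrt hd.le,
        ← hnN]
      have hn0 : 0 < (n : ℝ) := by rw [hnN]; exact hd
      rw [div_sub_one hn0.ne', abs_div, abs_of_pos hn0, div_le_iff₀ hn0]
      exact h6.le
    · refine abs_le_of_sq_le_sq ?_ (by positivity)
      rw [mul_pow, Real.sq_sqrt hd.le]
      exact h7.le
  refine (measureReal_mono hsub).trans ?_
  refine (measureReal_union_le _ _).trans ?_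
  have l6 := measureReal_union_le (μ := stdPi K)
  refine (add_le_add ((l6 _ _).trans (add_le_add ((l6 _ _).trans (add_le_add ((l6 _ _).trans
    (add_le_add ((l6 _ _).trans (add_le_add ((l6 _ _).trans (add_le_add p1 p2)) p3)) p4)) p5))
    (p6.trans q6))) (p7.trans q7)).trans ?_
  linarith

/-- The entries of the standardized pair `(√n X, z)`, listed along an index set. -/
def designEntries {n N : ℕ} {K : Type} (e : (Fin n × Fin N) ⊕ Fin n ≃ K)
    (ω : (Fin n → Fin N → ℝ) × (Fin n → ℝ)) (k : K) : ℝ :=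
  Sum.elim (fun p => √(n : ℝ) * ω.1 p.1 p.2) ω.2 (e.symm k)

lemma continuous_designEntries {n N : ℕ} {K : Type} (e : (Fin n × Fin N) ⊕ Fin n ≃ K) :
    Continuous (designEntries e) := by
  refine continuous_pi fun k => ?_
  rcases h : e.symm k with p | i
  · simp only [designEntries, h, Sum.elim_inl]
    fun_prop
  · simp only [designEntries, h, Sum.elim_inr]
    fun_prop

instance PX_isProbabilityMeasure (n N : ℕ) : IsProbabilityMeasure (PX n N) := by
  unfold PX
  infer_instance

instance Pz_isProbabilityMeasure (n : ℕ) : IsProbabilityMeasure (Pz n) := by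
  unfold Pz
  infer_instance

instance Pmodel_isProbabilityMeasure (n N : ℕ) : IsProbabilityMeasure (Pmodel n N) := by
  unfold Pmodel
  infer_instance

lemma measurePreserving_designEntries {n N : ℕ} (hn : 0 < n) {K : Type} [Fintype K]
    (e : (Fin n × Fin N) ⊕ Fin n ≃ K) :
    MeasurePreserving (designEntries e) (Pmodel n N) (stdPi K) := by
  refine ⟨(continuous_designEntries e).measurable, ?_⟩
  refine (Measure.pi_eq fun s hs => ?_).symm
  rw [Measure.map_apply (continuous_designEntries e).measurable (.univ_pi hs)]
  have hpre : designEntries e ⁻¹' Set.univ.pi s =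
      (Set.univ.pi fun i => Set.univ.pi fun j =>
        (fun x => √(n : ℝ) * x) ⁻¹' s (e (.inl (i, j)))) ×ˢ
      (Set.univ.pi fun i => s (e (.inr i))) := by
    ext ω
    simp only [Set.mem_preimage, Set.mem_univ_pi, Set.mem_prod]
    rw [← e.forall_congr_right]
    simp [designEntries, Sum.forall]
  have hsq : Measure.map (fun x => √(n : ℝ) * x) (gaussianReal 0 ((n : ℝ≥0))⁻¹) = stdG := by
    rw [gaussianReal_map_const_mul, stdG, mul_zero]
    congr 1
    ext
    have : (n : ℝ) ≠ 0 := by positivity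
    simp [this]
  have hg : ∀ t, MeasurableSet t →
      gaussianReal 0 ((n : ℝ≥0))⁻¹ ((fun x => √(n : ℝ) * x) ⁻¹' t) = stdG t := fun t ht => by
    rw [← hsq, Measure.map_apply (by fun_prop) ht]
  rw [hpre, Pmodel, Measure.prod_prod, PX, Pz, Measure.pi_pi, Measure.pi_pi]
  simp_rw [Measure.pi_pi, hg _ (hs _)]
  rw [← e.prod_comp, Fintype.prod_sum_type, Fintype.prod_prod_type]
  rfl

/-- Rows of the design together with the noise, indexed by the rows. -/
def rowIndex (n N : ℕ) : (Fin n × Fin N) ⊕ Fin n ≃ Fin n × Option (Fin N) where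
  toFun := Sum.elim (fun p => (p.1, some p.2)) fun i => (i, none)
  invFun q := q.2.elim (.inr q.1) fun j => .inl (q.1, j)
  left_inv := by rintro (p | i) <;> rfl
  right_inv := by rintro ⟨i, _ | j⟩ <;> rfl

/-- Columns of the design together with the noise, indexed by the columns. -/
def colIndex (n N : ℕ) : (Fin n × Fin N) ⊕ Fin n ≃ Option (Fin N) × Fin n :=
  (rowIndex n N).trans (Equiv.prodComm _ _)

@[simp] lemma designEntries_row_some {n N : ℕ} (ω : (Fin n → Fin N → ℝ) × (Fin n → ℝ))
    (i : Fin n) (j : Fin N) :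
    designEntries (rowIndex n N) ω (i, some j) = √(n : ℝ) * ω.1 i j := rfl

@[simp] lemma designEntries_row_none {n N : ℕ} (ω : (Fin n → Fin N → ℝ) × (Fin n → ℝ))
    (i : Fin n) : designEntries (rowIndex n N) ω (i, none) = ω.2 i := rfl

@[simp] lemma designEntries_col_some {n N : ℕ} (ω : (Fin n → Fin N → ℝ) × (Fin n → ℝ))
    (i : Fin n) (j : Fin N) :
    designEntries (colIndex n N) ω (some j, i) = √(n : ℝ) * ω.1 i j := rfl

@[simp] lemma designEntries_col_none {n N : ℕ} (ω : (Fin n → Fin N → ℝ) × (Fin n → ℝ))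
    (i : Fin n) : designEntries (colIndex n N) ω (none, i) = ω.2 i := rfl

/-- Gaussian comparison for the residual `σ z - X w`. -/
theorem residual_comparison {n N : ℕ} (hn : 0 < n) (A : Set (Fin N → ℝ)) {σ b : ℝ}
    (hb : 0 ≤ b) {ψ : (Fin N → ℝ) → ℝ} (hψ : Continuous ψ) {s u : ℝ} (hsu : s < u) :
    (Pmodel n N).real {ω | ∃ w ∈ A,
        b * √((∑ i, (σ * ω.2 i - ∑ j, ω.1 i j * w j) ^ 2) / n) + ψ w < s}
      ≤ 2 * (stdPi (Fin n ⊕ Option (Fin N))).real {ω | ∃ w ∈ A,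
        b * (√((∑ j, w j ^ 2) / n + σ ^ 2) * (√(∑ i, ω (.inl i) ^ 2) / √(n : ℝ)))
          - b * ((∑ j, ω (.inr (some j)) * w j) / n) + b * σ * (ω (.inr none) / √(n : ℝ))
          + ψ w < u} := by
  have hn0 : (0 : ℝ) < n := by exact_mod_cast hn
  set r := √(n : ℝ) with hr
  have hr0 : 0 < r := Real.sqrt_pos.2 hn0
  have hrr : r ^ 2 = n := Real.sq_sqrt hn0.le
  have key := gordon_norm (W := A) (I := Fin n) (J := Option (Fin N))
    (fun w o => o.elim σ fun j => -(w.1 j) / r)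
    (fun w => √((∑ j, w.1 j ^ 2) / n + σ ^ 2)) (fun w => Real.sqrt_nonneg _)
    (fun w => by
      have : 0 ≤ (∑ j, w.1 j ^ 2) / (n : ℝ) + σ ^ 2 := by positivity
      rw [Real.sq_sqrt this, Fintype.sum_option]
      simp only [Option.elim_none, Option.elim_some, div_pow, neg_sq, hrr, ← Finset.sum_div]
      ring)
    (b / r) (b / r) ((b / r) ^ 2) (by positivity) (by positivity)
    (fun _ => 1) (fun _ => 0) (fun _ _ => 0) (fun w => ψ w.1)
    (fun o => by
      rcases o with _ | j
      · exact continuous_const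
      · have h : Continuous fun w : A => w.1 j := (continuous_apply j).comp continuous_subtype_val
        exact h.neg.div_const r)
    (fun _ => continuous_const)
    (hψ.comp continuous_subtype_val) (by simp) (by simp) (by positivity) (by simp) s u hsu
  set E := {ω : Fin n × Option (Fin N) → ℝ | ∃ w : A, b / r * √(∑ k, ((fun _ => (1 : ℝ)) k *
      ∑ j, (fun w : A => fun o : Option (Fin N) => o.elim σ fun j => -(w.1 j) / r) w j * ω (k, j)
        - (fun _ _ => (0 : ℝ)) w k) ^ 2) + ∑ k, (fun _ => (0 : ℝ)) k *
      ∑ j, (fun w : A => fun o : Option (Fin N) => o.elim σ fun j => -(w.1 j) / r) w j * ω (k, j)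
        + (fun w : A => ψ w.1) w < s} with hE
  have hEo : IsOpen E := by
    rw [hE]
    simp only [Set.ofPred_exists]
    refine isOpen_iUnion fun w => isOpen_lt ?_ continuous_const
    fun_prop
  rw [← (measurePreserving_designEntries hn (rowIndex n N)).measureReal_preimage
    hEo.measurableSet.nullMeasurableSet] at key
  have hsum : ∀ x : ℝ, 0 ≤ x → b / r * √x = b * √(x / n) := fun x hx => by
    rw [Real.sqrt_div hx, ← hr]
    ring
  refine (le_of_eq ?_).trans (key.trans (le_of_eq ?_))
  · congr 1
    ext ω
    simp only [hE, Set.mem_ofPred_eq, Set.mem_preimage, Fintype.sum_option, Option.elim_none,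
      Option.elim_some, designEntries_row_some, designEntries_row_none, one_mul, sub_zero,
      zero_mul, Finset.sum_const_zero, add_zero, Subtype.exists, exists_prop]
    refine exists_congr fun w => and_congr_right fun _ => ?_
    rw [hsum _ (by positivity)]
    have : ∀ i, σ * ω.2 i + ∑ j, -w j / r * (r * ω.1 i j) = σ * ω.2 i - ∑ j, ω.1 i j * w j := by
      intro i
      rw [sub_eq_add_neg, ← Finset.sum_neg_distrib]
      congr 1
      refine Finset.sum_congr rfl fun j _ => ?_
      field_simp
    simp_rw [← hr, this]
  · congr 2
    ext ω
    simp only [Set.mem_ofPred_eq, Fintype.sum_option, Option.elim_none,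
      Option.elim_some, one_mul, sub_zero,
      zero_mul, Finset.sum_const_zero, add_zero, Subtype.exists, exists_prop]
    refine exists_congr fun w => and_congr_right fun _ => ?_
    have h1 : b / r * √(∑ k, (√((∑ j, w j ^ 2) / (n : ℝ) + σ ^ 2) * ω (.inl k)) ^ 2) =
        b * (√((∑ j, w j ^ 2) / n + σ ^ 2) * (√(∑ i, ω (.inl i) ^ 2) / r)) := by
      simp_rw [mul_pow]
      rw [← Finset.mul_sum, Real.sqrt_mul (by positivity), Real.sqrt_sq (Real.sqrt_nonneg _)]
      ring
    have h2 : ∑ j, -w j / r * ω (.inr (some j)) = -(∑ j, ω (.inr (some j)) * w j) / r := by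
      rw [neg_div, Finset.sum_div, ← Finset.sum_neg_distrib]
      refine Finset.sum_congr rfl fun j _ => ?_
      ring
    rw [h1, h2, show b / r * (σ * ω (.inr none) + -(∑ j, ω (.inr (some j)) * w j) / r) =
      b * σ * (ω (.inr none) / r) - b * ((∑ j, ω (.inr (some j)) * w j) / n) by
        rw [← hrr]; field_simp; ring]
    constructor <;> intro h <;> linarith

/-- Gaussian comparison for the correlation `Xᵀ u`. -/
theorem correlation_comparison {n N : ℕ} (hn : 0 < n) (B : Set ((Fin n → ℝ) × (Fin N → ℝ)))
    {σ R lam : ℝ} (hR : 0 ≤ R) {ψ : (Fin n → ℝ) × (Fin N → ℝ) → ℝ}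
    (hψ : Continuous ψ) {s t : ℝ} (hst : s < t) :
    (Pmodel n N).real {ω | ∃ q ∈ B,
        R * √((∑ j, (lam * q.2 j - ∑ i, ω.1 i j * q.1 i) ^ 2) / n)
          - σ * ((∑ i, q.1 i * ω.2 i) / n) + ψ q < s}
      ≤ 2 * (stdPi (Option (Fin N) ⊕ Fin n)).real {ω | ∃ q ∈ B,
        R * √((∑ j, (lam * q.2 j - √(∑ i, q.1 i ^ 2) / √(n : ℝ) * ω (.inl (some j))) ^ 2) / n)
          - σ * (√(∑ i, q.1 i ^ 2) / √(n : ℝ)) * (ω (.inl none) / √(n : ℝ))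
          + √(R ^ 2 + σ ^ 2) * ((∑ i, q.1 i * ω (.inr i)) / n) + ψ q < t} := by
  have hn0 : (0 : ℝ) < n := by exact_mod_cast hn
  set r := √(n : ℝ) with hr
  have hr0 : 0 < r := Real.sqrt_pos.2 hn0
  have hrr : r ^ 2 = n := Real.sq_sqrt hn0.le
  have hsq : √(R ^ 2 + σ ^ 2) ^ 2 = R ^ 2 + σ ^ 2 := Real.sq_sqrt (by positivity)
  have key := gordon_norm (W := B) (I := Option (Fin N)) (J := Fin n)
    (fun q i => q.1.1 i) (fun q => √(∑ i, q.1.1 i ^ 2)) (fun q => Real.sqrt_nonneg _)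
    (fun q => by rw [Real.sq_sqrt (by positivity)])
    (R / r) (√(R ^ 2 + σ ^ 2) / n) ((R / n) ^ 2) (by positivity) (by positivity)
    (fun o => o.elim 0 fun _ => 1 / r) (fun o => o.elim (-σ / n) fun _ => 0)
    (fun q o => o.elim 0 fun j => lam * q.1.2 j) (fun q => ψ q.1)
    (fun i => by fun_prop)
    (fun o => by rcases o with _ | j <;> simp <;> fun_prop)
    (hψ.comp continuous_subtype_val) (by rintro (_ | j) <;> simp)
    (by
      rintro (_ | j)
      · simp; positivity
      · simp only [Option.elim_some]
        rw [← hrr]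
        refine le_of_eq ?_
        field_simp)
    (by positivity)
    (by
      rw [Fintype.sum_option, div_pow √_, hsq]
      simp only [Option.elim_none, Option.elim_some]
      refine le_of_eq ?_
      field_simp
      simp) s t hst
  set E := {ω : Option (Fin N) × Fin n → ℝ | ∃ q : B, R / r * √(∑ k : Option (Fin N),
      ((fun o : Option (Fin N) => o.elim 0 fun _ => 1 / r) k *
      ∑ j, (fun (q : B) i => q.1.1 i) q j * ω (k, j)
        - (fun (q : B) (o : Option (Fin N)) => o.elim 0 fun j => lam * q.1.2 j) q k) ^ 2)
      + ∑ k : Option (Fin N), (fun o : Option (Fin N) => o.elim (-σ / n) fun _ => 0) k *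
      ∑ j, (fun (q : B) i => q.1.1 i) q j * ω (k, j)
        + (fun q : B => ψ q.1) q < s} with hE
  have hEo : IsOpen E := by
    rw [hE]
    simp only [Set.ofPred_exists]
    refine isOpen_iUnion fun w => isOpen_lt ?_ continuous_const
    fun_prop
  rw [← (measurePreserving_designEntries hn (colIndex n N)).measureReal_preimage
    hEo.measurableSet.nullMeasurableSet] at key
  have hsum : ∀ x : ℝ, 0 ≤ x → R / r * √x = R * √(x / n) := fun x hx => by
    rw [Real.sqrt_div hx, ← hr]
    ring
  refine (le_of_eq ?_).trans (key.trans (le_of_eq ?_))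
  · congr 1
    ext ω
    simp only [hE, Set.mem_ofPred_eq, Set.mem_preimage, Fintype.sum_option, Option.elim_none,
      Option.elim_some, designEntries_col_some, designEntries_col_none, sub_zero,
      zero_mul, Finset.sum_const_zero, add_zero, Subtype.exists, exists_prop]
    refine exists_congr fun q => and_congr_right fun _ => ?_
    rw [hsum _ (by positivity)]
    have : ∀ j, (1 / r * ∑ i, q.1 i * (r * ω.1 i j) - lam * q.2 j) ^ 2 =
        (lam * q.2 j - ∑ i, ω.1 i j * q.1 i) ^ 2 := by
      intro j
      rw [← neg_sq, neg_sub, Finset.mul_sum]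
      congr 2
      refine Finset.sum_congr rfl fun j _ => ?_
      field_simp
    simp_rw [← hr, this]
    rw [show -σ / (n : ℝ) * ∑ i, q.1 i * ω.2 i = -(σ * ((∑ i, q.1 i * ω.2 i) / n)) by ring]
    constructor <;> intro h <;> simp at h ⊢ <;> linarith
  · congr 2
    ext ω
    simp only [Set.mem_ofPred_eq, Fintype.sum_option, Option.elim_none,
      Option.elim_some, sub_zero,
      zero_mul, Finset.sum_const_zero, add_zero, Subtype.exists, exists_prop]
    refine exists_congr fun q => and_congr_right fun _ => ?_
    rw [hsum _ (by positivity)]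
    have : ∀ j, (1 / r * (√(∑ i, q.1 i ^ 2) * ω (.inl (some j))) - lam * q.2 j) ^ 2 =
        (lam * q.2 j - √(∑ i, q.1 i ^ 2) / r * ω (.inl (some j))) ^ 2 := by
      intro j
      ring
    simp_rw [this]
    rw [show -σ / (n : ℝ) * (√(∑ i, q.1 i ^ 2) * ω (.inl none)) =
      -(σ * (√(∑ i, q.1 i ^ 2) / r) * (ω (.inl none) / r)) by rw [← hrr]; field_simp,
      show √(R ^ 2 + σ ^ 2) / (n : ℝ) * ∑ i, q.1 i * ω (.inr i) =
        √(R ^ 2 + σ ^ 2) * ((∑ i, q.1 i * ω (.inr i)) / n) by ring]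
    constructor <;> intro h <;> simp at h ⊢ <;> linarith

lemma inner_sub_penalty_le {N : ℕ} (S : Finset (Fin N)) (θ h w : Fin N → ℝ) {α d r L : ℝ}
    (hα : 0 ≤ α) (hd : 0 < d) (hr : 0 ≤ r) (hL : ∑ j ∈ Sᶜ, |θ j| ≤ L)
    (hh : ∑ j, supportRes S θ α j (h j) ^ 2 ≤ r ^ 2 * d) :
    (∑ j, h j * w j) / d - α * ((∑ j, (|w j + θ j| - |θ j|)) / d)
      ≤ r * √((∑ j, w j ^ 2) / d) + 2 * α * L / d := by
  have h1 : ∑ j, (h j * w j - α * (|w j + θ j| - |θ j|))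
      ≤ ∑ j, (|w j| * |supportRes S θ α j (h j)| + if j ∈ S then 0 else 2 * α * |θ j|) :=
    Finset.sum_le_sum fun j _ => mul_sub_penalty_le S θ hα j (h j) (w j)
  rw [Finset.sum_sub_distrib, ← Finset.mul_sum, Finset.sum_add_distrib] at h1
  have h2 : ∑ j, |w j| * |supportRes S θ α j (h j)| ≤ √(∑ j, w j ^ 2) * (r * √d) := by
    refine inner_le_of_sq_sum (fun j => |w j|) (fun j => |supportRes S θ α j (h j)|)
      (Real.sqrt_nonneg _) (by positivity) ?_ ?_
    · simp only [sq_abs]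
      rw [Real.sq_sqrt (by positivity)]
    · simp only [sq_abs]
      rwa [mul_pow, Real.sq_sqrt hd.le]
  have h3 : ∑ j, (if j ∈ S then 0 else 2 * α * |θ j|) ≤ 2 * α * L := by
    have : ∑ j, (if j ∈ S then 0 else 2 * α * |θ j|) = 2 * α * ∑ j ∈ Sᶜ, |θ j| := by
      rw [Finset.mul_sum, Finset.sum_ite, Finset.sum_const_zero, zero_add]
      congr 1
      ext j
      simp
    rw [this]
    gcongr
  have hsd : √d * √d = d := Real.mul_self_sqrt hd.le
  have hsd0 : 0 < √d := Real.sqrt_pos.2 hd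
  calc (∑ j, h j * w j) / d - α * ((∑ j, (|w j + θ j| - |θ j|)) / d)
      = (∑ j, h j * w j - α * ∑ j, (|w j + θ j| - |θ j|)) / d := by ring
    _ ≤ (√(∑ j, w j ^ 2) * (r * √d) + 2 * α * L) / d := by gcongr; linarith
    _ = _ := by
      rw [Real.sqrt_div (by positivity), add_div]
      congr 1
      rw [div_eq_iff hd.ne']
      field_simp
      rw [pow_two, hsd]

set_option maxHeartbeats 800000 in
lemma penalized_residual_prob (δ σ α s M : ℝ) (hδ : 0 < δ) (hσ : 0 < σ) (hα : 0 < α)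
    (hs0 : 0 ≤ s) (hs1 : s ≤ 1) (hM : 0 ≤ M)
    (hsα : s * (1 + α ^ 2) + (1 - s) * tailRisk α < δ) :
    ∃ k K C c : ℝ, 0 < k ∧ 0 < K ∧ 0 < C ∧ 0 < c ∧ ∀ N n : ℕ, 0 < N → (n : ℝ) = δ * N →
      ∀ (θ : Fin N → ℝ) (S : Finset (Fin N)), (S.card : ℝ) ≤ s * N → ∑ j ∈ Sᶜ, |θ j| ≤ M * N →
      (Pmodel n N).real {ω | ∃ w : Fin N → ℝ,
        α⁻¹ * √((∑ i, (σ * ω.2 i - ∑ j, ω.1 i j * w j) ^ 2) / n)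
          + (∑ j, (|w j + θ j| - |θ j|)) / n < k * √((∑ j, w j ^ 2) / n) - K}
        ≤ C * Real.exp (-c * N) := by
  set δ' := s * (1 + α ^ 2) + (1 - s) * tailRisk α with hδ'
  have hT := tailRisk_nonneg (α := α)
  have hδ'0 : 0 ≤ δ' := by
    have : 0 ≤ (1 - s) * tailRisk α := mul_nonneg (by linarith) hT
    positivity
  obtain ⟨c₀, hc₀, H⟩ := stdPi_concentration (2 + 2 * α ^ 2) (by positivity)
  obtain ⟨C₀, hC₀, Hs⟩ := stdPi_single_tail
  set r := √((δ' + δ) / (2 * δ)) with hr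
  have hr0 : 0 ≤ r := Real.sqrt_nonneg _
  have hr2 : r ^ 2 = (δ' + δ) / (2 * δ) := Real.sq_sqrt (by positivity)
  have hr1 : r < 1 := by
    rw [hr, Real.sqrt_lt' one_pos, one_pow, div_lt_one (by positivity)]
    linarith
  set t₁ := min 1 ((δ - δ') / 2) with ht₁
  have ht₁0 : 0 < t₁ := lt_min one_pos (by linarith)
  set ρ := (1 + r) / 2 with hρ
  set t₂ := 1 - ρ ^ 2 with ht₂
  have ht₂0 : 0 < t₂ := by rw [ht₂, hρ]; nlinarith only [hr0, hr1]
  have ht₂1 : t₂ ≤ 1 := by rw [ht₂]; nlinarith only [sq_nonneg ρ]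
  set b := α⁻¹ with hb
  have hb0 : 0 < b := inv_pos.2 hα
  have hbα : b * α = 1 := inv_mul_cancel₀ hα.ne'
  set c := min (min (c₀ * t₁ ^ 2) (c₀ * t₂ ^ 2 * δ)) (δ / 4) with hc
  have hc1 : c ≤ c₀ * t₁ ^ 2 := (min_le_left _ _).trans (min_le_left _ _)
  have hc2 : c ≤ c₀ * t₂ ^ 2 * δ := (min_le_left _ _).trans (min_le_right _ _)
  have hc3 : c ≤ δ / 4 := min_le_right _ _
  set K₀ := 2 * M / δ + b * σ with hK₀
  refine ⟨b * (1 - r) / 2, K₀ + 1, 2 * (4 + C₀), c, ?_, by positivity, by positivity,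
    by positivity, ?_⟩
  · have : 0 < 1 - r := by linarith
    positivity
  intro N n hN hnN θ S hS hSM
  have hN' : (0 : ℝ) < N := by exact_mod_cast hN
  have hn' : (0 : ℝ) < n := by rw [hnN]; positivity
  have hn : 0 < n := by exact_mod_cast hn'
  have hsn : 0 < √(n : ℝ) := Real.sqrt_pos.2 hn'
  set k := b * (1 - r) / 2 with hk
  have key := residual_comparison hn (Set.univ : Set (Fin N → ℝ)) (σ := σ) hb0.le
    (ψ := fun w => (∑ j, (|w j + θ j| - |θ j|)) / n - k * √((∑ j, w j ^ 2) / n))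
    (by fun_prop) (s := -(K₀ + 1)) (u := -K₀) (by linarith)
  refine (le_of_eq ?_).trans (key.trans ?_)
  · congr 1
    ext ω
    simp only [Set.mem_ofPred_eq, Set.mem_univ, true_and]
    refine exists_congr fun w => ?_
    constructor <;> intro h <;> linarith
  have p1 := H (K := Fin n ⊕ Option (Fin N)) (fun j : Fin N => .inr (some j))
    (fun _ _ h => by simpa using h) (fun j z => supportRes S θ α j z ^ 2)
    (fun j => (measurable_supportRes S θ α j).pow_const 2)
    (fun j x => by
      rw [abs_of_nonneg (sq_nonneg _)]
      exact supportRes_sq_le S θ hα.le j x) t₁ ht₁0.le (min_le_left _ _)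
  have p2 := H (K := Fin n ⊕ Option (Fin N)) (fun i : Fin n => .inl i)
    (fun _ _ h => by simpa using h) (fun _ z => z ^ 2)
    (fun j => by fun_prop)
    (fun j x => by
      rw [abs_of_nonneg (sq_nonneg _)]
      nlinarith [sq_nonneg α, sq_nonneg x, mul_nonneg (sq_nonneg α) (sq_nonneg x)])
    t₂ ht₂0.le ht₂1
  have p3 := Hs (K := Fin n ⊕ Option (Fin N)) (.inr none) n
  simp only [stdG_integral_sq, Finset.sum_const, Finset.card_univ, Fintype.card_fin,
    nsmul_eq_mul, mul_one] at p1 p2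
  have q1 : 2 * Real.exp (-c₀ * t₁ ^ 2 * N) ≤ 2 * Real.exp (-c * N) := by
    refine mul_le_mul_of_nonneg_left (Real.exp_le_exp.mpr ?_) zero_le_two
    have := mul_le_mul_of_nonneg_right hc1 hN'.le
    linarith
  have q2 : 2 * Real.exp (-c₀ * t₂ ^ 2 * n) ≤ 2 * Real.exp (-c * N) := by
    refine mul_le_mul_of_nonneg_left (Real.exp_le_exp.mpr ?_) zero_le_two
    have := mul_le_mul_of_nonneg_right hc2 hN'.le
    rw [hnN]
    linarith
  have q3 : C₀ * Real.exp (-((n : ℝ) / 4)) ≤ C₀ * Real.exp (-c * N) := by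
    refine mul_le_mul_of_nonneg_left (Real.exp_le_exp.mpr ?_) hC₀.le
    have := mul_le_mul_of_nonneg_right hc3 hN'.le
    rw [hnN]
    linarith
  rw [mul_assoc]
  refine mul_le_mul_of_nonneg_left ?_ zero_le_two
  refine (measureReal_mono (s₂ :=
    ({ω | t₁ * N ≤ |∑ j, supportRes S θ α j (ω (.inr (some j))) ^ 2
        - ∑ j, ∫ z, supportRes S θ α j z ^ 2 ∂stdG|} ∪
      {ω | t₂ * n ≤ |∑ i, ω (.inl i) ^ 2 - (n : ℝ)|}) ∪ {ω | (n : ℝ) ≤ ω (.inr none) ^ 2}) ?_).trans ?_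
  · rintro ω ⟨w, -, hw⟩
    by_contra hcon
    simp only [Set.mem_union, Set.mem_ofPred_eq, not_or, not_le] at hcon
    obtain ⟨⟨h1, h2⟩, h3⟩ := hcon
    have hsup := sum_integral_supportRes_sq_le S θ hα.le hS
    rw [← hδ'] at hsup
    have hsup2 : ∑ j, supportRes S θ α j (ω (.inr (some j))) ^ 2 ≤ r ^ 2 * n := by
      have h4 := (abs_lt.1 h1).2
      have h5 : t₁ * N ≤ (δ - δ') / 2 * N := by gcongr; exact min_le_right _ _
      have h6 : r ^ 2 * n = (δ' + δ) / 2 * N := by rw [hr2, hnN]; field_simp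
      rw [h6]
      linarith
    have hmain := inner_sub_penalty_le S θ (fun j => ω (.inr (some j))) w hα.le hn' hr0 hSM hsup2
    have hx0 : 0 ≤ √((∑ j, w j ^ 2) / (n : ℝ)) := Real.sqrt_nonneg _
    set x := √((∑ j, w j ^ 2) / (n : ℝ)) with hx
    have hxT : x ≤ √((∑ j, w j ^ 2) / (n : ℝ) + σ ^ 2) :=
      Real.sqrt_le_sqrt (by nlinarith only [sq_nonneg σ])
    have ha : ρ ≤ √(∑ i, ω (.inl i) ^ 2) / √(n : ℝ) := by
      rw [← Real.sqrt_div (by positivity)]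
      refine Real.le_sqrt_of_sq_le ?_
      rw [le_div_iff₀ hn']
      have := (abs_lt.1 h2).1
      rw [ht₂] at this
      linarith
    have hρ0 : 0 ≤ ρ := by rw [hρ]; linarith
    have h0 : -1 ≤ ω (.inr none) / √(n : ℝ) := by
      rw [le_div_iff₀ hsn, neg_one_mul]
      refine (abs_le.1 (abs_le_of_sq_le_sq ?_ hsn.le)).1
      rw [Real.sq_sqrt hn'.le]
      exact h3.le
    have hTa : x * ρ ≤ √((∑ j, w j ^ 2) / (n : ℝ) + σ ^ 2) *
        (√(∑ i, ω (.inl i) ^ 2) / √(n : ℝ)) := by gcongr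
    have e1 := mul_le_mul_of_nonneg_left hTa hb0.le
    have e2 := mul_le_mul_of_nonneg_left h0 (mul_nonneg hb0.le hσ.le)
    have e3 := mul_le_mul_of_nonneg_left hmain hb0.le
    have e4 : b * (r * x + 2 * α * (M * N) / n) = b * r * x + 2 * M / δ := by
      rw [hnN, hb]
      field_simp
    have e5 : ∀ P : ℝ, b * (α * P) = P := fun P => by rw [← mul_assoc, hbα, one_mul]
    rw [e4, mul_sub, e5] at e3
    have e6 : b * (x * ρ) - b * r * x - k * x = 0 := by
      rw [hk, hρ]; ring
    rw [hK₀] at hw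
    linarith
  · refine (measureReal_union_le _ _).trans ?_
    refine (add_le_add ((measureReal_union_le _ _).trans (add_le_add (p1.trans q1) (p2.trans q2)))
      (p3.trans q3)).trans ?_
    linarith

/-- The Lasso cost at `θ + w`, recentered so that the penalty vanishes at `w = 0`. -/
def excessCost {n N : ℕ} (σ : ℝ) (θ : Fin N → ℝ) (lam : ℝ)
    (ω : (Fin n → Fin N → ℝ) × (Fin n → ℝ)) (w : Fin N → ℝ) : ℝ :=
  (∑ i, (σ * ω.2 i - ∑ j, ω.1 i j * w j) ^ 2) / n / 2
    + lam * ((∑ j, (|w j + θ j| - |θ j|)) / n)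

lemma lassoCost_yvec_eq {n N : ℕ} (σ : ℝ) (θ : Fin N → ℝ) (lam : ℝ)
    (ω : (Fin n → Fin N → ℝ) × (Fin n → ℝ)) (w : Fin N → ℝ) :
    lassoCost ω.1 (yvec σ θ ω.1 ω.2) lam (fun j => w j + θ j) =
      excessCost σ θ lam ω w + lam / n * ∑ j, |θ j| := by
  unfold lassoCost yvec excessCost
  have h : ∀ i, ∑ j, ω.1 i j * θ j + σ * ω.2 i - ∑ j, ω.1 i j * (w j + θ j) =
      σ * ω.2 i - ∑ j, ω.1 i j * w j := fun i => by
    simp_rw [mul_add, Finset.sum_add_distrib]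
    ring
  simp_rw [h, Finset.sum_sub_distrib]
  ring

lemma excessCost_zero {n N : ℕ} (σ : ℝ) (θ : Fin N → ℝ) (lam : ℝ)
    (ω : (Fin n → Fin N → ℝ) × (Fin n → ℝ)) :
    excessCost σ θ lam ω 0 = σ ^ 2 * (∑ i, ω.2 i ^ 2) / n / 2 := by
  simp [excessCost, mul_pow, Finset.mul_sum]

lemma noise_sq_prob : ∃ C c : ℝ, 0 < C ∧ 0 < c ∧ ∀ n N : ℕ, 0 < n →
    (Pmodel n N).real {ω | (2 * n : ℝ) ≤ ∑ i, ω.2 i ^ 2} ≤ C * Real.exp (-c * n) := by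
  obtain ⟨c, hc, H⟩ := stdPi_concentration 1 one_pos
  refine ⟨2, c, two_pos, hc, fun n N hn => ?_⟩
  have h := H (K := Fin n × Option (Fin N)) (fun i : Fin n => (i, none))
    (fun _ _ h => by simpa using h) (fun _ z => z ^ 2) (fun j => by fun_prop)
    (fun j x => by rw [abs_of_nonneg (sq_nonneg _)]; linarith) 1 zero_le_one le_rfl
  simp only [stdG_integral_sq, Finset.sum_const, Finset.card_univ, Fintype.card_fin,
    nsmul_eq_mul, mul_one, one_mul, one_pow] at h
  have hcl : IsClosed {ω : Fin n × Option (Fin N) → ℝ |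
      (n : ℝ) ≤ |∑ i, ω (i, none) ^ 2 - (n : ℝ)|} :=
    isClosed_le (by fun_prop) (by fun_prop)
  rw [← (measurePreserving_designEntries hn (rowIndex n N)).measureReal_preimage
    hcl.measurableSet.nullMeasurableSet] at h
  refine (measureReal_mono ?_).trans h
  intro ω hω
  simp only [Set.mem_preimage, Set.mem_ofPred_eq, designEntries_row_none] at hω ⊢
  exact (by linarith : (n : ℝ) ≤ ∑ i, ω.2 i ^ 2 - n).trans (le_abs_self _)

/-- All points of small Lasso cost are bounded with overwhelming probability. -/
lemma excessCost_bounded_prob (δ σ α s M lmin lmax : ℝ) (hδ : 0 < δ) (hσ : 0 < σ) (hα : 0 < α)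
    (hs0 : 0 ≤ s) (hs1 : s ≤ 1) (hM : 0 ≤ M)
    (hsα : s * (1 + α ^ 2) + (1 - s) * tailRisk α < δ) (hl : 0 < lmin) (hll : lmin ≤ lmax) :
    ∃ K C c : ℝ, 0 < K ∧ 0 < C ∧ 0 < c ∧ ∀ N n : ℕ, 0 < N → (n : ℝ) = δ * N →
      ∀ (θ : Fin N → ℝ) (S : Finset (Fin N)), (S.card : ℝ) ≤ s * N → ∑ j ∈ Sᶜ, |θ j| ≤ M * N →
      (Pmodel n N).real {ω | ∃ lam ∈ Set.Icc lmin lmax, ∃ w : Fin N → ℝ,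
        excessCost σ θ lam ω w ≤ excessCost σ θ lam ω 0 ∧ K < √((∑ j, w j ^ 2) / n)}
        ≤ C * Real.exp (-c * N) := by
  obtain ⟨k, K₀, C₀, c₀, hk, hK₀, hC₀, hc₀, H₀⟩ :=
    penalized_residual_prob δ σ α s M hδ hσ hα hs0 hs1 hM hsα
  obtain ⟨C₁, c₁, hC₁, hc₁, H₁⟩ := noise_sq_prob
  set b := α⁻¹ with hb
  have hlm : 0 < lmax := hl.trans_le hll
  set K := (σ ^ 2 / lmin + K₀ + lmax * b ^ 2 / 2) / k with hK
  refine ⟨K, C₀ + C₁, min c₀ (c₁ * δ), by positivity, by positivity, by positivity, ?_⟩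
  intro N n hN hnN θ S hS hSM
  have hN' : (0 : ℝ) < N := by exact_mod_cast hN
  have hn' : (0 : ℝ) < n := by rw [hnN]; positivity
  have hn : 0 < n := by exact_mod_cast hn'
  have p0 := H₀ N n hN hnN θ S hS hSM
  have p1 := H₁ n N hn
  have q0 : C₀ * Real.exp (-c₀ * N) ≤ C₀ * Real.exp (-(min c₀ (c₁ * δ)) * N) := by
    refine mul_le_mul_of_nonneg_left (Real.exp_le_exp.mpr ?_) hC₀.le
    have := mul_le_mul_of_nonneg_right (min_le_left c₀ (c₁ * δ)) hN'.le
    linarith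
  have q1 : C₁ * Real.exp (-c₁ * n) ≤ C₁ * Real.exp (-(min c₀ (c₁ * δ)) * N) := by
    refine mul_le_mul_of_nonneg_left (Real.exp_le_exp.mpr ?_) hC₁.le
    have := mul_le_mul_of_nonneg_right (min_le_right c₀ (c₁ * δ)) hN'.le
    rw [hnN]
    linarith
  rw [add_mul]
  refine (measureReal_mono ?_).trans
    ((measureReal_union_le _ _).trans (add_le_add (p0.trans q0) (p1.trans q1)))
  rintro ω ⟨lam, ⟨h1, h2⟩, w, hw, hKw⟩
  by_contra hcon
  simp only [Set.mem_union, Set.mem_ofPred_eq, not_or, not_le, not_exists, not_lt] at hcon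
  obtain ⟨h3, h4⟩ := hcon
  have h5 := h3 w
  have hlam : 0 < lam := hl.trans_le h1
  rw [excessCost_zero] at hw
  unfold excessCost at hw
  have h6 : σ ^ 2 * (∑ i, ω.2 i ^ 2) / n / 2 ≤ σ ^ 2 := by
    rw [div_div, div_le_iff₀ (by positivity)]
    nlinarith only [sq_nonneg σ, h4]
  have hR := Real.sq_sqrt (show 0 ≤ (∑ i, (σ * ω.2 i - ∑ j, ω.1 i j * w j) ^ 2) / (n : ℝ) by
    positivity)
  set R := √((∑ i, (σ * ω.2 i - ∑ j, ω.1 i j * w j) ^ 2) / (n : ℝ))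
  set x := √((∑ j, w j ^ 2) / (n : ℝ))
  set P := (∑ j, (|w j + θ j| - |θ j|)) / (n : ℝ)
  rw [← hR] at hw
  have h7 : lam * (k * x - K₀) ≤ σ ^ 2 + lam ^ 2 * b ^ 2 / 2 := by
    have := mul_le_mul_of_nonneg_left h5 hlam.le
    nlinarith only [this, hw, h6, sq_nonneg (R - lam * b)]
  have h8 : k * x - K₀ ≤ σ ^ 2 / lmin + lmax * b ^ 2 / 2 := by
    have h9 : k * x - K₀ ≤ (σ ^ 2 + lam ^ 2 * b ^ 2 / 2) / lam := by
      rw [le_div_iff₀ hlam]; linarith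
    refine h9.trans ?_
    rw [add_div]
    refine add_le_add (by gcongr) ?_
    rw [show lam ^ 2 * b ^ 2 / 2 / lam = lam * b ^ 2 / 2 by field_simp]
    gcongr
  rw [hK, div_lt_iff₀ hk] at hKw
  linarith

/-- Quantitative bounds on the parameters of the model. -/
structure ParamBounds (δ σ M m : ℝ) : Prop where
  delta_pos : 0 < δ
  sigma_pos : 0 < σ
  m_pos : 0 < m
  one_le : 1 ≤ M
  sigma_le : σ ≤ M
  one_le_sigma : 1 ≤ M * σ
  delta_le : δ ≤ M
  one_le_delta : 1 ≤ M * δ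
  one_le_m : 1 ≤ M * (m / 2)

lemma ParamBounds.mono {δ σ M m M' : ℝ} (h : ParamBounds δ σ M m) (hM : M ≤ M') :
    ParamBounds δ σ M' m where
  delta_pos := h.delta_pos
  sigma_pos := h.sigma_pos
  m_pos := h.m_pos
  one_le := h.one_le.trans hM
  sigma_le := h.sigma_le.trans hM
  one_le_sigma := h.one_le_sigma.trans (mul_le_mul_of_nonneg_right hM h.sigma_pos.le)
  delta_le := h.delta_le.trans hM
  one_le_delta := h.one_le_delta.trans (mul_le_mul_of_nonneg_right hM h.delta_pos.le)
  one_le_m := h.one_le_m.trans (mul_le_mul_of_nonneg_right hM (by linarith [h.m_pos]))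

/-- A solution of the fixed point equations with quantitative bounds. -/
structure BoundedSolution (δ σ M m : ℝ) {N : ℕ} (θ : Fin N → ℝ) (lam β τ : ℝ) : Prop where
  evo : StateEvo δ σ (empDist θ) lam β τ
  tau_le : τ ≤ M
  lam_le_mul : lam ≤ M * β
  active : ∀ j, m ≤ ∫ z, activeErr τ (τ * lam / β) (θ j) z ∂stdG
  lam_le : lam ≤ M
  one_le_lam : 1 ≤ M * lam

lemma BoundedSolution.mono {δ σ M m M' : ℝ} {N : ℕ} {θ : Fin N → ℝ} {lam β τ : ℝ}
    (h : BoundedSolution δ σ M m θ lam β τ) (hM : M ≤ M') (hlam : 0 ≤ lam) :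
    BoundedSolution δ σ M' m θ lam β τ where
  evo := h.evo
  tau_le := h.tau_le.trans hM
  lam_le_mul := h.lam_le_mul.trans (mul_le_mul_of_nonneg_right hM h.evo.1.le)
  active := h.active
  lam_le := h.lam_le.trans hM
  one_le_lam := h.one_le_lam.trans (mul_le_mul_of_nonneg_right hM hlam)

/-- The asymptotic value of the recentered Lasso cost. -/
def limitCost (δ : ℝ) {N : ℕ} (θ : Fin N → ℝ) (lam β τ : ℝ) : ℝ :=
  β ^ 2 / 2 + lam / (δ * N) * penMean τ (τ * lam / β) θ

/-- The Lasso cost is rarely much below its asymptotic value. -/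
lemma excessCost_lower_prob {δ σ M m K : ℝ} (hP : ParamBounds δ σ M m) (hK : 0 ≤ K) :
    ∃ A C c : ℝ, 0 < A ∧ 0 < C ∧ 0 < c ∧ ∀ N n : ℕ, 0 < N → (n : ℝ) = δ * N →
      ∀ (θ : Fin N → ℝ) (lam β τ : ℝ), 0 < lam → BoundedSolution δ σ M m θ lam β τ →
      ∀ t : ℝ, 0 < t → t ≤ 1 →
      (Pmodel n N).real {ω | ∃ w : Fin N → ℝ, √((∑ j, w j ^ 2) / n) ≤ K ∧
        excessCost σ θ lam ω w < limitCost δ θ lam β τ - A * t} ≤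
        C * Real.exp (-c * N * t ^ 2) := by
  have hM := hP.one_le
  have hM0 : 0 < M := by linarith
  have hδ := hP.delta_pos
  have hσ := hP.sigma_pos
  obtain ⟨C, c, hC, hc, H⟩ := typical_prob δ σ M m hδ hM0 hP.m_pos
  refine ⟨M * (K + M) * (1 + M ^ 2) + 2 + M + M + M * M, 2 * C, c, by positivity, by positivity,
    hc, ?_⟩
  intro N n hN hnN θ lam β τ hlam hB t ht0 ht1
  have hN' : (0 : ℝ) < N := by exact_mod_cast hN
  have hn' : (0 : ℝ) < n := by rw [hnN]; positivity
  have hn : 0 < n := by exact_mod_cast hn'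
  have hβ := hB.evo.1
  have hβτ := hB.evo.beta_le hδ
  have hστ := hB.evo.sigma_le hδ hσ
  have hβM : β ≤ M := hβτ.trans hB.tau_le
  set B₀ := β * (K + σ) * (1 + 1 / σ ^ 2) + 1 + lam + β + β * σ with hB₀
  have hσ2 : 1 / σ ^ 2 ≤ M ^ 2 := by
    rw [div_le_iff₀ (by positivity), ← mul_pow]
    exact one_le_pow₀ hP.one_le_sigma
  have hB₀' : B₀ ≤ M * (K + M) * (1 + M ^ 2) + 1 + M + M + M * M := by
    rw [hB₀]
    have := hP.sigma_le
    have := hB.lam_le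
    gcongr
  have key := residual_comparison hn {w : Fin N → ℝ | ∑ j, w j ^ 2 ≤ K ^ 2 * n} (σ := σ) hβ.le
    (ψ := fun w => lam / n * (∑ j, (|w j + θ j| - |θ j|)) - β ^ 2 / 2)
    (by fun_prop) (s := limitCost δ θ lam β τ - (B₀ + 1) * t)
    (u := limitCost δ θ lam β τ - B₀ * t) (by linarith)
  have hT := H (K := Fin n ⊕ Option (Fin N)) N n (fun j => .inr (some j)) (fun i => .inl i)
    (.inr none) (fun _ _ h => by simpa using h) (fun _ _ h => by simpa using h) hN hnN θ lam β τ
    hlam hB.evo hB.tau_le hB.lam_le_mul hB.active t ht0.le ht1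
  rw [mul_assoc 2 C]
  refine (measureReal_mono ?_).trans (key.trans (mul_le_mul_of_nonneg_left
    ((measureReal_mono ?_).trans hT) zero_le_two))
  · rintro ω ⟨w, hw, hcost⟩
    refine ⟨w, ?_, ?_⟩
    · rw [Real.sqrt_le_iff, div_le_iff₀ hn'] at hw
      exact hw.2
    · have hR := Real.sq_sqrt (show 0 ≤ (∑ i, (σ * ω.2 i - ∑ j, ω.1 i j * w j) ^ 2) / (n : ℝ) by
        positivity)
      unfold excessCost at hcost
      set R := √((∑ i, (σ * ω.2 i - ∑ j, ω.1 i j * w j) ^ 2) / (n : ℝ))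
      rw [← hR] at hcost
      have e1 : (B₀ + 1) * t ≤ (M * (K + M) * (1 + M ^ 2) + 2 + M + M + M * M) * t :=
        mul_le_mul_of_nonneg_right (by linarith) ht0.le
      have e2 : lam * ((∑ j, (|w j + θ j| - |θ j|)) / n) =
        lam / n * (∑ j, (|w j + θ j| - |θ j|)) := by ring
      rw [e2] at hcost
      change β * R + (lam / n * (∑ j, (|w j + θ j| - |θ j|)) - β ^ 2 / 2) <
        limitCost δ θ lam β τ - (B₀ + 1) * t
      nlinarith only [sq_nonneg (R - β), hcost, e1]
  · rintro ω ⟨w, hw, hlt⟩ hTyp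
    rw [hnN] at hw
    have := hTyp.primal_lower (by positivity) hσ hlam.le hβ hβτ hστ ht0.le hK hw
    rw [← hB₀, ← hnN] at this
    unfold limitCost at hlt
    rw [← hnN] at hlt
    linarith

set_option maxHeartbeats 800000 in
/-- The dual objective is rarely small away from the asymptotic subgradient norm. -/
lemma dualNorm_prob {δ σ M m : ℝ} (hP : ParamBounds δ σ M m) :
    ∃ C c : ℝ, 0 < C ∧ 0 < c ∧ ∀ N n : ℕ, 0 < N → (n : ℝ) = δ * N →
      ∀ (θ : Fin N → ℝ) (lam β τ : ℝ), 0 < lam → BoundedSolution δ σ M m θ lam β τ →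
      ∀ t : ℝ, 0 < t → t ≤ 1 →
      (Pmodel n N).real {ω | ∃ q : (Fin n → ℝ) × (Fin N → ℝ), (∀ j, |q.2 j| ≤ 1) ∧
        1000 * M ^ 8 * √t < |(∑ j, q.2 j ^ 2) / N - dualNorm δ σ lam β τ| ∧
        √(τ ^ 2 - σ ^ 2 + t) * √((∑ j, (lam * q.2 j - ∑ i, ω.1 i j * q.1 i) ^ 2) / n)
          - σ * ((∑ i, q.1 i * ω.2 i) / n)
          + ((∑ i, q.1 i ^ 2) / n / 2 - lam / n * ∑ j, (q.2 j * θ j - |θ j|))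
          < -limitCost δ θ lam β τ + (M - 1) * t} ≤ C * Real.exp (-c * N * t ^ 2) := by
  have hM := hP.one_le
  have hM0 : 0 < M := by linarith
  have hδ := hP.delta_pos
  have hσ := hP.sigma_pos
  obtain ⟨C, c, hC, hc, H⟩ := typical_prob δ σ M m hδ hM0 hP.m_pos
  refine ⟨2 * C, c, by positivity, hc, ?_⟩
  intro N n hN hnN θ lam β τ hlam hB t ht0 ht1
  have hN' : (0 : ℝ) < N := by exact_mod_cast hN
  have hn' : (0 : ℝ) < n := by rw [hnN]; positivity
  have hn : 0 < n := by exact_mod_cast hn'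
  have hβ := hB.evo.1
  have hβτ := hB.evo.beta_le hδ
  have hστ := hB.evo.sigma_le hδ hσ
  have hsn : 0 < √(n : ℝ) := Real.sqrt_pos.2 hn'
  have hsn2 : √(n : ℝ) * √(n : ℝ) = n := Real.mul_self_sqrt hn'.le
  have hτσ : 0 ≤ τ ^ 2 - σ ^ 2 + t := by nlinarith only [hστ, hσ, ht0]
  have key := correlation_comparison hn {q : (Fin n → ℝ) × (Fin N → ℝ) | (∀ j, |q.2 j| ≤ 1) ∧
      1000 * M ^ 8 * √t < |(∑ j, q.2 j ^ 2) / N - dualNorm δ σ lam β τ|} (σ := σ) (lam := lam)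
    (Real.sqrt_nonneg (τ ^ 2 - σ ^ 2 + t))
    (ψ := fun q => (∑ i, q.1 i ^ 2) / n / 2 - lam / n * ∑ j, (q.2 j * θ j - |θ j|))
    (by fun_prop) (s := -limitCost δ θ lam β τ + (M - 1) * t)
    (t := -limitCost δ θ lam β τ + M * t) (by linarith)
  have hT := H (K := Option (Fin N) ⊕ Fin n) N n (fun j => .inl (some j)) (fun i => .inr i)
    (.inl none) (fun _ _ h => by simpa using h) (fun _ _ h => by simpa using h) hN hnN θ lam β τ
    hlam hB.evo hB.tau_le hB.lam_le_mul hB.active t ht0.le ht1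
  rw [mul_assoc 2 C]
  refine (le_of_eq ?_).trans (key.trans (mul_le_mul_of_nonneg_left
    ((measureReal_mono ?_).trans hT) zero_le_two))
  · congr 1
    ext ω
    simp only [Set.mem_ofPred_eq, and_assoc]
  · rintro ω ⟨q, ⟨hv, hfar⟩, hlt⟩ hTyp
    refine absurd ?_ (not_le.2 hfar)
    have hu := Real.sq_sqrt (show 0 ≤ ∑ i, q.1 i ^ 2 by positivity)
    refine hTyp.dual_norm hN' hδ hσ hlam hβ hβτ hστ ht0.le ht1 hB.tau_le hB.lam_le
      hP.one_le_sigma hP.one_le hP.delta_le hP.one_le_delta hB.one_le_lam hP.one_le_m hv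
      (bb := √(∑ i, q.1 i ^ 2) / √(n : ℝ)) (G := (∑ i, q.1 i * ω (.inr i)) / n)
      (p := √((∑ j, (lam * q.2 j - √(∑ i, q.1 i ^ 2) / √(n : ℝ) * ω (.inl (some j))) ^ 2) / n))
      (by positivity) (by positivity) ?_ ?_ ?_
    · rw [← hnN, Real.sq_sqrt (by positivity), div_mul_cancel₀ _ hn'.ne']
    · rw [← hnN, div_mul_div_comm, hsn2, ← neg_div]
      gcongr
      have := inner_le_of_sq_sum (fun i => -q.1 i) (fun i => ω (.inr i))
        (Real.sqrt_nonneg (∑ i, q.1 i ^ 2)) (Real.sqrt_nonneg (∑ i, ω (.inr i) ^ 2))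
        (by simp only [neg_sq]; rw [hu]) (by rw [Real.sq_sqrt (by positivity)])
      simp only [neg_mul, Finset.sum_neg_distrib] at this
      linarith
    · rw [Real.sq_sqrt hτσ] at hlt
      unfold limitCost at hlt
      rw [← hnN, div_pow, hu, Real.sq_sqrt hn'.le]
      rw [← hnN, show τ ^ 2 - σ ^ 2 + t + σ ^ 2 = τ ^ 2 + t by ring] at hlt
      linarith

lemma le_of_forall_small_quadratic {p q A : ℝ}
    (h : ∀ s : ℝ, 0 < s → s ≤ 1 → s * p ≤ s * q + s ^ 2 * A) : p ≤ q := by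
  refine le_of_forall_pos_le_add fun ε hε => ?_
  have hA : 0 < |A| + 1 := by positivity
  have hs0 : 0 < min 1 (ε / (|A| + 1)) := lt_min one_pos (by positivity)
  have h1 := h _ hs0 (min_le_left _ _)
  have h2 : min 1 (ε / (|A| + 1)) * (|A| + 1) ≤ ε := by
    rw [← le_div_iff₀ hA]; exact min_le_right _ _
  set s := min 1 (ε / (|A| + 1))
  have h3 : s * p ≤ s * (q + s * A) := by linarith
  have h4 := le_of_mul_le_mul_left h3 hs0
  have h5 : s * A ≤ s * |A| := mul_le_mul_of_nonneg_left (le_abs_self A) hs0.le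
  linarith

lemma subgradient_of_forall {g x lam A : ℝ} (hlam : 0 ≤ lam)
    (h : ∀ s : ℝ, s * g ≤ lam * (|x + s| - |x|) + s ^ 2 * A) :
    |g| ≤ lam ∧ g * x = lam * |x| := by
  have h1 : |g| ≤ lam := by
    refine abs_le'.2 ⟨le_of_forall_small_quadratic (A := A) fun s hs _ => ?_,
      le_of_forall_small_quadratic (A := A) fun s hs _ => ?_⟩
    · have h2 : lam * (|x + s| - |x|) ≤ lam * s :=
        mul_le_mul_of_nonneg_left (by linarith [abs_add_le x s, abs_of_pos hs]) hlam
      linarith [h s]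
    · have h2 : lam * (|x + -s| - |x|) ≤ lam * s :=
        mul_le_mul_of_nonneg_left
          (by linarith [abs_add_le x (-s), abs_neg s, abs_of_pos hs]) hlam
      have := h (-s)
      rw [neg_sq] at this
      linarith
  refine ⟨h1, le_antisymm ?_ ?_⟩
  · calc g * x ≤ |g * x| := le_abs_self _
      _ = |g| * |x| := abs_mul _ _
      _ ≤ lam * |x| := by gcongr
  · refine le_of_forall_small_quadratic (A := x ^ 2 * A) fun s hs hs1 => ?_
    have h2 := h (-(s * x))
    have h3 : |x + -(s * x)| = (1 - s) * |x| := by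
      rw [show x + -(s * x) = (1 - s) * x by ring, abs_mul, abs_of_nonneg (by linarith)]
    rw [h3] at h2
    linarith

/-- Optimality conditions for the Lasso. -/
lemma excessCost_optimality {n N : ℕ} (hn : 0 < n) {σ : ℝ} {θ : Fin N → ℝ} {lam : ℝ}
    (hlam : 0 ≤ lam) {ω : (Fin n → Fin N → ℝ) × (Fin n → ℝ)} {w : Fin N → ℝ}
    (hw : ∀ w', excessCost σ θ lam ω w ≤ excessCost σ θ lam ω w') (j : Fin N) :
    |∑ i, ω.1 i j * (σ * ω.2 i - ∑ k, ω.1 i k * w k)| ≤ lam ∧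
      (∑ i, ω.1 i j * (σ * ω.2 i - ∑ k, ω.1 i k * w k)) * (w j + θ j) = lam * |w j + θ j| := by
  have hn' : (0 : ℝ) < n := by exact_mod_cast hn
  refine subgradient_of_forall (A := (∑ i, ω.1 i j ^ 2) / 2) hlam fun s => ?_
  have h1 := hw (w + Pi.single j s)
  unfold excessCost at h1
  have h2 : ∀ i, ∑ k, ω.1 i k * (w + Pi.single j s : Fin N → ℝ) k =
      ∑ k, ω.1 i k * w k + ω.1 i j * s := by
    intro i
    simp [mul_add, Finset.sum_add_distrib, Pi.single_apply]
  have h3 : ∑ k, (|(w + Pi.single j s : Fin N → ℝ) k + θ k| - |θ k|) =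
      ∑ k, (|w k + θ k| - |θ k|) + (|w j + θ j + s| - |w j + θ j|) := by
    rw [← sub_eq_iff_eq_add', ← Finset.sum_sub_distrib,
      Finset.sum_eq_single j (fun k _ hk => by simp [hk]) (by simp)]
    simp only [Pi.add_apply, Pi.single_eq_same]
    rw [show w j + s + θ j = w j + θ j + s by ring]
    ring
  have h4 : ∑ i, (σ * ω.2 i - ∑ k, ω.1 i k * (w + Pi.single j s : Fin N → ℝ) k) ^ 2 =
      ∑ i, (σ * ω.2 i - ∑ k, ω.1 i k * w k) ^ 2
        - 2 * s * (∑ i, ω.1 i j * (σ * ω.2 i - ∑ k, ω.1 i k * w k))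
        + s ^ 2 * ∑ i, ω.1 i j ^ 2 := by
    rw [Finset.mul_sum, Finset.mul_sum, ← Finset.sum_sub_distrib, ← Finset.sum_add_distrib]
    refine Finset.sum_congr rfl fun i _ => ?_
    rw [h2]
    ring
  rw [h3, h4] at h1
  have h5 := mul_le_mul_of_nonneg_left h1 hn'.le
  have e : ∀ a b c d : ℝ, (n : ℝ) * ((a - 2 * s * b + s ^ 2 * c) / n / 2 + lam * (d / n)) =
      (a - 2 * s * b + s ^ 2 * c) / 2 + lam * d := fun a b c d => by field_simp
  have e' : ∀ a d : ℝ, (n : ℝ) * (a / n / 2 + lam * (d / n)) = a / 2 + lam * d :=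
    fun a d => by field_simp
  rw [e, e'] at h5
  linarith

/-- At the Lasso solution for the penalty `lam'`, the dual objective for the penalty `lam` nearly
equals minus the cost. -/
lemma dual_value_le {n N : ℕ} (hN : 0 < N) {δ : ℝ} (hδ : 0 < δ) (hnN : (n : ℝ) = δ * N)
    {σ : ℝ} {θ : Fin N → ℝ} {lam lam' R K : ℝ} (hlam' : 0 < lam') (hR : 0 ≤ R)
    {ω : (Fin n → Fin N → ℝ) × (Fin n → ℝ)} {w v : Fin N → ℝ} {u : Fin n → ℝ}
    (hw : ∀ w', excessCost σ θ lam' ω w ≤ excessCost σ θ lam' ω w')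
    (hu : ∀ i, u i = σ * ω.2 i - ∑ k, ω.1 i k * w k)
    (hv : ∀ j, lam' * v j = ∑ i, ω.1 i j * u i)
    (hK : √((∑ j, w j ^ 2) / n) ≤ K) :
    (∀ j, |v j| ≤ 1) ∧
      R * √((∑ j, (lam * v j - ∑ i, ω.1 i j * u i) ^ 2) / n) - σ * ((∑ i, u i * ω.2 i) / n)
        + ((∑ i, u i ^ 2) / n / 2 - lam / n * ∑ j, (v j * θ j - |θ j|))
        ≤ -excessCost σ θ lam ω w + |lam - lam'| * (√(1 / δ) * (R + K)) := by
  have hN' : (0 : ℝ) < N := by exact_mod_cast hN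
  have hn' : (0 : ℝ) < n := by rw [hnN]; positivity
  have hn : 0 < n := by exact_mod_cast hn'
  have hopt := fun j => excessCost_optimality hn hlam'.le hw j
  simp only [← hu, ← hv] at hopt
  have hv1 : ∀ j, |v j| ≤ 1 := fun j => by
    have := (hopt j).1
    rw [abs_mul, abs_of_pos hlam'] at this
    exact le_of_mul_le_mul_left (by linarith) hlam'
  have hvx : ∀ j, v j * (w j + θ j) = |w j + θ j| := fun j => by
    have := (hopt j).2
    rw [mul_assoc] at this
    exact mul_left_cancel₀ hlam'.ne' this
  have hvs : ∑ j, v j ^ 2 ≤ N := by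
    have : ∑ j, v j ^ 2 ≤ ∑ _j : Fin N, (1 : ℝ) :=
      Finset.sum_le_sum fun j _ => (sq_le_one_iff_abs_le_one _).2 (hv1 j)
    simpa using this
  have hv2 : (∑ j, v j ^ 2) / n ≤ 1 / δ := by
    rw [div_le_div_iff₀ hn' hδ, hnN]
    nlinarith only [hvs, hδ]
  refine ⟨hv1, ?_⟩
  have h1 : √((∑ j, (lam * v j - ∑ i, ω.1 i j * u i) ^ 2) / n) ≤ |lam - lam'| * √(1 / δ) := by
    rw [← Real.sqrt_sq_eq_abs, ← Real.sqrt_mul (sq_nonneg _)]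
    refine Real.sqrt_le_sqrt ?_
    simp only [← hv, ← sub_mul, mul_pow]
    rw [← Finset.mul_sum, mul_div_assoc]
    gcongr
  have h2 : σ * (∑ i, u i * ω.2 i) = ∑ i, u i ^ 2 + lam' * ∑ j, v j * w j := by
    have e1 : ∑ i, u i * ∑ k, ω.1 i k * w k = lam' * ∑ j, v j * w j := by
      simp_rw [Finset.mul_sum]
      rw [Finset.sum_comm]
      refine Finset.sum_congr rfl fun j _ => ?_
      rw [← mul_assoc, hv, Finset.sum_mul]
      refine Finset.sum_congr rfl fun i _ => ?_
      ring
    rw [← e1, Finset.mul_sum, ← Finset.sum_add_distrib]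
    refine Finset.sum_congr rfl fun i _ => ?_
    have := hu i
    rw [show σ * (u i * ω.2 i) = u i * (σ * ω.2 i) by ring,
      show σ * ω.2 i = u i + ∑ k, ω.1 i k * w k by linarith]
    ring
  have h3 : ∑ j, (v j * θ j - |θ j|) = ∑ j, (|w j + θ j| - |θ j|) - ∑ j, v j * w j := by
    rw [← Finset.sum_sub_distrib]
    refine Finset.sum_congr rfl fun j _ => ?_
    rw [← hvx j]
    ring
  have h4 : |(∑ j, v j * w j) / n| ≤ √(1 / δ) * K := by
    have e1 := inner_le_of_sq_sum v w (Real.sqrt_nonneg (∑ j, v j ^ 2))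
      (Real.sqrt_nonneg (∑ j, w j ^ 2)) (by rw [Real.sq_sqrt (by positivity)])
      (by rw [Real.sq_sqrt (by positivity)])
    have e2 := inner_le_of_sq_sum (fun j => -v j) w (Real.sqrt_nonneg (∑ j, v j ^ 2))
      (Real.sqrt_nonneg (∑ j, w j ^ 2)) (by simp only [neg_sq]; rw [Real.sq_sqrt (by positivity)])
      (by rw [Real.sq_sqrt (by positivity)])
    simp only [neg_mul, Finset.sum_neg_distrib] at e2
    have e3 : √(∑ j, v j ^ 2) * √(∑ j, w j ^ 2) / n =
        √((∑ j, v j ^ 2) / n) * √((∑ j, w j ^ 2) / n) := by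
      rw [Real.sqrt_div (by positivity), Real.sqrt_div (by positivity), div_mul_div_comm,
        Real.mul_self_sqrt hn'.le]
    rw [abs_div, abs_of_pos hn']
    calc |∑ j, v j * w j| / n ≤ √(∑ j, v j ^ 2) * √(∑ j, w j ^ 2) / n := by
          gcongr
          exact abs_le'.2 ⟨e1, e2⟩
      _ = √((∑ j, v j ^ 2) / n) * √((∑ j, w j ^ 2) / n) := e3
      _ ≤ √(1 / δ) * K := by gcongr
  have h5 : (lam - lam') * ((∑ j, v j * w j) / n) ≤ |lam - lam'| * (√(1 / δ) * K) := by
    refine (le_abs_self _).trans ?_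
    rw [abs_mul]
    gcongr
  have h6 := mul_le_mul_of_nonneg_left h1 hR
  have h7 : σ * ((∑ i, u i * ω.2 i) / n) = (∑ i, u i ^ 2) / n + lam' * ((∑ j, v j * w j) / n) := by
    rw [← mul_div_assoc, h2]
    ring
  have h8 : excessCost σ θ lam ω w = (∑ i, u i ^ 2) / n / 2
      + lam * ((∑ j, (|w j + θ j| - |θ j|)) / n) := by
    simp only [excessCost, hu]
  have h9 : lam / n * ∑ j, (v j * θ j - |θ j|) = lam * ((∑ j, (|w j + θ j| - |θ j|)) / n)
      - lam * ((∑ j, v j * w j) / n) := by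
    rw [h3]
    ring
  rw [h7, h8, h9]
  linarith

/-- The subgradient vector associated with the candidate `θ + w`. -/
def subgradientVec {n N : ℕ} (σ lam : ℝ) (ω : (Fin n → Fin N → ℝ) × (Fin n → ℝ))
    (w : Fin N → ℝ) (j : Fin N) : ℝ :=
  (1 / lam) * ∑ i, ω.1 i j * (σ * ω.2 i - ∑ k, ω.1 i k * w k)

set_option maxHeartbeats 800000 in
/-- Control of the subgradient norm for all penalties close to a fixed one. -/
theorem subgradient_norm_prob {δ σ α s L M m lmin lmax : ℝ} (hP : ParamBounds δ σ M m)
    (hα : 0 < α) (hs0 : 0 ≤ s) (hs1 : s ≤ 1) (hL : 0 ≤ L)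
    (hsα : s * (1 + α ^ 2) + (1 - s) * tailRisk α < δ) (hl : 0 < lmin) (hll : lmin ≤ lmax) :
    ∃ D C c : ℝ, 0 < D ∧ 0 < C ∧ 0 < c ∧ ∀ N n : ℕ, 0 < N → (n : ℝ) = δ * N →
      ∀ (θ : Fin N → ℝ) (S : Finset (Fin N)), (S.card : ℝ) ≤ s * N → ∑ j ∈ Sᶜ, |θ j| ≤ L * N →
      ∀ lam β τ : ℝ, 0 < lam → BoundedSolution δ σ M m θ lam β τ →
      ∀ t : ℝ, 0 < t → t ≤ 1 →
      (Pmodel n N).real {ω | ∃ lam' ∈ Set.Icc lmin lmax, |lam - lam'| ≤ t ∧ ∃ w : Fin N → ℝ,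
        (∀ w', excessCost σ θ lam' ω w ≤ excessCost σ θ lam' ω w') ∧
        D * √t < |(∑ j, subgradientVec σ lam' ω w j ^ 2) / N - dualNorm δ σ lam β τ|}
        ≤ C * Real.exp (-c * N * t ^ 2) := by
  have hδ := hP.delta_pos
  have hσ := hP.sigma_pos
  have hM := hP.one_le
  obtain ⟨K, C₁, c₁, hK, hC₁, hc₁, H₁⟩ :=
    excessCost_bounded_prob δ σ α s L lmin lmax hδ hσ hα hs0 hs1 hL hsα hl hll
  obtain ⟨A, C₂, c₂, hA, hC₂, hc₂, H₂⟩ := excessCost_lower_prob hP hK.le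
  set M' := M + (A + √(1 / δ) * (M + 1 + K)) + 2 with hM'
  have hMM' : M ≤ M' := by
    have : 0 ≤ √(1 / δ) * (M + 1 + K) := by positivity
    rw [hM']
    linarith
  obtain ⟨C₃, c₃, hC₃, hc₃, H₃⟩ := dualNorm_prob (hP.mono hMM')
  have hM'0 : 0 < M' := by linarith
  set c := min c₁ (min c₂ c₃) with hc
  have hcc1 : c ≤ c₁ := min_le_left _ _
  have hcc2 : c ≤ c₂ := (min_le_right _ _).trans (min_le_left _ _)
  have hcc3 : c ≤ c₃ := (min_le_right _ _).trans (min_le_right _ _)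
  have hc0 : 0 < c := by positivity
  refine ⟨1000 * M' ^ 8, C₁ + C₂ + C₃, c, by positivity, by positivity, hc0, ?_⟩
  intro N n hN hnN θ S hS hSL lam β τ hlam hB t ht0 ht1
  have hN' : (0 : ℝ) < N := by exact_mod_cast hN
  have p1 := H₁ N n hN hnN θ S hS hSL
  have p2 := H₂ N n hN hnN θ lam β τ hlam hB t ht0 ht1
  have p3 := H₃ N n hN hnN θ lam β τ hlam (hB.mono hMM' hlam.le) t ht0 ht1
  have hNt : 0 ≤ N * t ^ 2 := by positivity
  have q1 : C₁ * Real.exp (-c₁ * N) ≤ C₁ * Real.exp (-c * N * t ^ 2) := by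
    refine mul_le_mul_of_nonneg_left (Real.exp_le_exp.mpr ?_) hC₁.le
    have e1 : c * N * t ^ 2 ≤ c₁ * N * 1 := by
      gcongr
      exact pow_le_one₀ ht0.le ht1
    linarith
  have q2 : C₂ * Real.exp (-c₂ * N * t ^ 2) ≤ C₂ * Real.exp (-c * N * t ^ 2) := by
    refine mul_le_mul_of_nonneg_left (Real.exp_le_exp.mpr ?_) hC₂.le
    have := mul_le_mul_of_nonneg_right hcc2 hNt
    linarith
  have q3 : C₃ * Real.exp (-c₃ * N * t ^ 2) ≤ C₃ * Real.exp (-c * N * t ^ 2) := by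
    refine mul_le_mul_of_nonneg_left (Real.exp_le_exp.mpr ?_) hC₃.le
    have := mul_le_mul_of_nonneg_right hcc3 hNt
    linarith
  rw [add_mul, add_mul]
  refine (measureReal_mono ?_).trans ((measureReal_union_le _ _).trans (add_le_add
    ((measureReal_union_le _ _).trans (add_le_add (p1.trans q1) (p2.trans q2))) (p3.trans q3)))
  rintro ω ⟨lam', hlam', hd, w, hw, hfar⟩
  by_contra hcon
  simp only [Set.mem_union, not_or] at hcon
  obtain ⟨⟨h1, h2⟩, h3⟩ := hcon
  have hlam'0 : 0 < lam' := hl.trans_le hlam'.1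
  have hwK : √((∑ j, w j ^ 2) / (n : ℝ)) ≤ K := by
    by_contra! hcon
    exact h1 ⟨lam', hlam', w, hw 0, hcon⟩
  have hlow : limitCost δ θ lam β τ - A * t ≤ excessCost σ θ lam ω w := by
    by_contra! hcon
    exact h2 ⟨w, hwK, hcon⟩
  have hτσ : 0 ≤ τ := hB.evo.2.1.le
  have hRM : √(τ ^ 2 - σ ^ 2 + t) ≤ M + 1 := by
    rw [Real.sqrt_le_iff]
    refine ⟨by linarith, ?_⟩
    have := mul_le_mul hB.tau_le hB.tau_le hτσ (by linarith)
    nlinarith only [this, sq_nonneg σ, ht1, hM]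
  obtain ⟨hv1, hval⟩ := dual_value_le hN hδ hnN (lam := lam) (R := √(τ ^ 2 - σ ^ 2 + t)) hlam'0
    (Real.sqrt_nonneg _) (v := subgradientVec σ lam' ω w)
    (u := fun i => σ * ω.2 i - ∑ k, ω.1 i k * w k) hw (fun _ => rfl)
    (fun j => by unfold subgradientVec; field_simp) hwK
  refine h3 ⟨(fun i => σ * ω.2 i - ∑ k, ω.1 i k * w k, subgradientVec σ lam' ω w), hv1, hfar, ?_⟩
  refine hval.trans_lt ?_
  have e1 : |lam - lam'| * (√(1 / δ) * (√(τ ^ 2 - σ ^ 2 + t) + K)) ≤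
      t * (√(1 / δ) * (M + 1 + K)) := by gcongr
  have e2 : (M' - 1) * t = M * t + A * t + t * (√(1 / δ) * (M + 1 + K)) + t := by
    rw [hM']; ring
  have e3 : 0 < M * t := by positivity
  linarith

/-- Solutions of the fixed point equations are uniformly bounded over approximately sparse
signals and a compact range of penalties. -/
lemma exists_boundedSolution {δ σ α s L lmin lmax : ℝ} (hδ : 0 < δ) (hσ : 0 < σ) (hα : 0 < α)
    (hs0 : 0 ≤ s) (hs1 : s ≤ 1) (hL : 0 ≤ L) (hsα : s * (1 + α ^ 2) + (1 - s) * tailRisk α < δ)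
    (hl : 0 < lmin) (hll : lmin ≤ lmax) :
    ∃ M m : ℝ, ParamBounds δ σ M m ∧ ∀ N : ℕ, 0 < N → ∀ (θ : Fin N → ℝ) (S : Finset (Fin N)),
      (S.card : ℝ) ≤ s * N → ∑ j ∈ Sᶜ, |θ j| ≤ L * N → ∀ lam ∈ Set.Icc lmin lmax,
      ∀ β τ : ℝ, StateEvo δ σ (empDist θ) lam β τ → BoundedSolution δ σ M m θ lam β τ := by
  have hT := tailRisk_nonneg (α := α)
  have hlM : 0 < lmax := hl.trans_le hll
  set δ' := s * (1 + α ^ 2) + (1 - s) * tailRisk α with hδ'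
  have hsδ' : s ≤ δ' := by
    have h1 : 0 ≤ s * α ^ 2 := by positivity
    have h2 : 0 ≤ (1 - s) * tailRisk α := mul_nonneg (by linarith) hT
    rw [hδ']; linarith
  set r := √((δ' + δ) / (2 * δ)) with hr
  have hrpos : 0 < (δ' + δ) / (2 * δ) := by
    have : 0 < δ' + δ := by linarith
    positivity
  have hr0 : 0 < r := Real.sqrt_pos.2 hrpos
  have hr1 : r < 1 := by
    rw [hr, Real.sqrt_lt' one_pos, div_lt_iff₀ (by positivity)]
    linarith
  have hr2 : δ' ≤ r ^ 2 * δ := by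
    have e : r ^ 2 * δ = (δ' + δ) / 2 := by
      rw [hr, Real.sq_sqrt hrpos.le]; field_simp
    rw [e]; linarith
  have hr1' : 0 < 1 - r := by linarith
  set T := (2 * α * L / δ + (lmax + α * σ) ^ 2 / (4 * α * lmin)) / (1 - r) with hTdef
  have hT0 : 0 ≤ T := by positivity
  set B := (δ - s) / (δ / σ + 4 * T / lmin ^ 2 + 2 * L / (σ * lmin)) with hB
  have hden : 0 < δ / σ + 4 * T / lmin ^ 2 + 2 * L / (σ * lmin) := by positivity
  have hB0 : 0 < B := div_pos (by linarith) hden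
  obtain ⟨m, hm, Hm⟩ := exists_activeErr_lower σ (lmax / B) hσ
  set M := 1 + σ + 1 / σ + δ + 1 / δ + 2 / m + T + lmax / B + lmax + 1 / lmin with hM
  have p1 : 0 < 1 / σ := by positivity
  have p2 : 0 < 1 / δ := by positivity
  have p3 : 0 < 2 / m := by positivity
  have p4 : 0 < lmax / B := by positivity
  have p5 : 0 < 1 / lmin := by positivity
  refine ⟨M, m, ⟨hδ, hσ, hm, by linarith, by linarith, ?_, by linarith, ?_, ?_⟩, ?_⟩
  · rw [← div_le_iff₀ hσ]; linarith
  · rw [← div_le_iff₀ hδ]; linarith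
  · rw [← div_le_iff₀ (by positivity)]
    have : 1 / (m / 2) = 2 / m := by field_simp
    linarith
  intro N hN θ S hS hSL lam hlam β τ h
  have hlam0 : 0 < lam := hl.trans_le hlam.1
  have hβ := h.1
  have hτT : τ ≤ T := by
    have h1 := h.tau_bound hN hδ hσ hlam0 hα S hS hSL hr0 hr2
    rw [hTdef, le_div_iff₀ hr1']
    have h2 : (lam + α * σ) ^ 2 / (4 * α) ≤
        lam * ((lmax + α * σ) ^ 2 / (4 * α * lmin)) := by
      have e : (lmax + α * σ) ^ 2 / (4 * α) = lmin * ((lmax + α * σ) ^ 2 / (4 * α * lmin)) := by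
        field_simp
      calc (lam + α * σ) ^ 2 / (4 * α) ≤ (lmax + α * σ) ^ 2 / (4 * α) := by
            have := hlam.2
            gcongr
        _ = lmin * ((lmax + α * σ) ^ 2 / (4 * α * lmin)) := e
        _ ≤ _ := mul_le_mul_of_nonneg_right hlam.1 (by positivity)
    refine le_of_mul_le_mul_left ?_ hlam0
    calc lam * (τ * (1 - r)) = lam * (1 - r) * τ := by ring
      _ ≤ _ := h1
      _ ≤ 2 * lam * α * L / δ + lam * ((lmax + α * σ) ^ 2 / (4 * α * lmin)) := by linarith
      _ = _ := by ring
  have hβB : B ≤ β := by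
    have h1 := h.beta_bound hN hδ hσ hlam0 S hS hSL
    rw [hB, div_le_iff₀ hden]
    refine h1.trans (mul_le_mul_of_nonneg_left ?_ hβ.le)
    have := hlam.1
    gcongr
  have hlβ : lam / β ≤ lmax / B := div_le_div₀ hlM.le hlam.2 hB0 hβB
  refine ⟨h, by linarith, ?_, fun j => ?_, by linarith [hlam.2], ?_⟩
  · rw [← div_le_iff₀ hβ]; linarith
  · rw [mul_div_assoc]
    exact Hm τ (lam / β) (θ j) (h.sigma_le hδ hσ) (by positivity) hlβ
  · rw [← div_le_iff₀ hlam0]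
    have : 1 / lam ≤ 1 / lmin := one_div_le_one_div_of_le hl hlam.1
    linarith

lemma excessCost_le_of_isMinOn {n N : ℕ} {σ lam : ℝ} {θ θ' : Fin N → ℝ}
    {ω : (Fin n → Fin N → ℝ) × (Fin n → ℝ)}
    (h : IsMinOn (lassoCost ω.1 (yvec σ θ ω.1 ω.2) lam) Set.univ θ') (w : Fin N → ℝ) :
    excessCost σ θ lam ω (θ' - θ) ≤ excessCost σ θ lam ω w := by
  have h1 := isMinOn_univ_iff.1 h (fun j => w j + θ j)
  have h2 := lassoCost_yvec_eq σ θ lam ω (θ' - θ)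
  simp only [Pi.sub_apply, sub_add_cancel] at h2
  rw [lassoCost_yvec_eq] at h1
  linarith [h2.symm.le, h2.le]

lemma subgradientVec_sub {n N : ℕ} (σ lam : ℝ) (θ θ' : Fin N → ℝ)
    (ω : (Fin n → Fin N → ℝ) × (Fin n → ℝ)) (j : Fin N) :
    subgradientVec σ lam ω (θ' - θ) j = (1 / lam) * ∑ i, ω.1 i j *
      (yvec σ θ ω.1 ω.2 i - ∑ k, ω.1 i k * θ' k) := by
  unfold subgradientVec yvec
  congr 1
  refine Finset.sum_congr rfl fun i _ => ?_
  congr 1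
  simp only [Pi.sub_apply, mul_sub, Finset.sum_sub_distrib]
  ring

/-- A uniform deviation bound over a compact interval, from local uniform deviation bounds. -/
lemma exists_uniform_of_local {Ω : Type*} [MeasurableSpace Ω] (P : Measure Ω)
    [IsProbabilityMeasure P] {lmin lmax t d p : ℝ} (hll : lmin ≤ lmax) (ht : 0 < t)
    (f : ℝ → Ω → ℝ) (κ : ℝ → ℝ) (hp : 2 * p < 1)
    (h : ∀ l ∈ Set.Icc lmin lmax, P.real {ω | ∃ l' ∈ Set.Icc lmin lmax, |l - l'| ≤ t ∧
      d < |f l' ω - κ l|} ≤ p) :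
    P.real {ω | ∃ l ∈ Set.Icc lmin lmax, 3 * d < |f l ω - κ l|} ≤
      ((lmax - lmin) / t + 1) * p := by
  set E : ℝ → Set Ω := fun l => {ω | ∃ l' ∈ Set.Icc lmin lmax, |l - l'| ≤ t ∧
      d < |f l' ω - κ l|} with hE
  have hκ : ∀ l ∈ Set.Icc lmin lmax, ∀ l' ∈ Set.Icc lmin lmax, |l - l'| ≤ t →
      |κ l - κ l'| ≤ 2 * d := by
    intro l hl l' hl' hd
    obtain ⟨ω, hω⟩ : ∃ ω, ω ∉ E l ∪ E l' := by
      by_contra! hcon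
      have h1 : P.real (E l ∪ E l') = 1 := by
        rw [Set.eq_univ_of_forall hcon, probReal_univ]
      have h2 := measureReal_union_le (μ := P) (E l) (E l')
      have h3 := h l hl
      have h4 := h l' hl'
      linarith
    simp only [Set.mem_union, not_or] at hω
    have h1 : |f l' ω - κ l| ≤ d := by
      by_contra! hcon
      exact hω.1 ⟨l', hl', hd, hcon⟩
    have h2 : |f l' ω - κ l'| ≤ d := by
      by_contra! hcon
      exact hω.2 ⟨l', hl', by simpa using ht.le, hcon⟩
    rw [abs_le] at h1 h2 ⊢
    constructor <;> linarith
  set x := (lmax - lmin) / t with hx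
  have hx0 : 0 ≤ x := div_nonneg (by linarith) ht.le
  have hp0 : 0 ≤ p := measureReal_nonneg.trans (h lmin ⟨le_rfl, hll⟩)
  have hnet : ∀ k ∈ Finset.range (⌊x⌋₊ + 1), lmin + k * t ∈ Set.Icc lmin lmax := by
    intro k hk
    have h1 : (k : ℝ) ≤ x := by
      refine le_trans ?_ (Nat.floor_le hx0)
      exact_mod_cast Nat.lt_succ_iff.1 (Finset.mem_range.1 hk)
    rw [hx, le_div_iff₀ ht] at h1
    have : 0 ≤ (k : ℝ) * t := by positivity
    exact ⟨by linarith, by linarith⟩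
  have hsub : {ω | ∃ l ∈ Set.Icc lmin lmax, 3 * d < |f l ω - κ l|} ⊆
      ⋃ k ∈ Finset.range (⌊x⌋₊ + 1), E (lmin + k * t) := by
    rintro ω ⟨l, hl, hfar⟩
    set y := (l - lmin) / t with hy
    have hy0 : 0 ≤ y := div_nonneg (by linarith [hl.1]) ht.le
    have hyx : y ≤ x := div_le_div_of_nonneg_right (by linarith [hl.2]) ht.le
    have hk : ⌊y⌋₊ ∈ Finset.range (⌊x⌋₊ + 1) :=
      Finset.mem_range.2 (Nat.lt_succ_of_le (Nat.floor_le_floor hyx))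
    have hlk : l = lmin + y * t := by rw [hy]; field_simp; ring
    have hd : |lmin + ⌊y⌋₊ * t - l| ≤ t := by
      have h1 := Nat.floor_le hy0
      have h2 := (Nat.lt_floor_add_one y).le
      have h3 := mul_le_mul_of_nonneg_right h1 ht.le
      have h4 := mul_le_mul_of_nonneg_right h2 ht.le
      rw [hlk, abs_le]
      constructor <;> nlinarith only [h3, h4, ht]
    refine Set.mem_biUnion hk ⟨l, hl, hd, ?_⟩
    have h1 := hκ _ (hnet _ hk) l hl hd
    have h2 := abs_sub_le (f l ω) (κ (lmin + ⌊y⌋₊ * t)) (κ l)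
    linarith
  calc P.real _ ≤ P.real (⋃ k ∈ Finset.range (⌊x⌋₊ + 1), E (lmin + k * t)) :=
        measureReal_mono hsub (measure_ne_top _ _)
    _ ≤ ∑ k ∈ Finset.range (⌊x⌋₊ + 1), P.real (E (lmin + k * t)) :=
        measureReal_biUnion_finset_le _ _
    _ ≤ ∑ _k ∈ Finset.range (⌊x⌋₊ + 1), p := Finset.sum_le_sum fun k hk => h _ (hnet k hk)
    _ = (⌊x⌋₊ + 1) * p := by simp
    _ ≤ (x + 1) * p := by
        have := Nat.floor_le hx0
        gcongr

/-- Theorem (uniform control of the norm of the subgradient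
v̂_λ = (1/λ)Xᵀ(y − Xθ̂_λ)). -/
theorem stmt15 (δ σ lmin lmax q : ℝ)
    (hδ : 0 < δ) (hσ : 0 < σ) (hl : 0 < lmin) (hll : lmin ≤ lmax)
    (Dfam : (M : ℕ) → Set (Fin M → ℝ))
    (hD : DFamSpec δ Dfam q) :
    ∃ C c : ℝ, 0 < C ∧ 0 < c ∧
      ∀ (N n : ℕ), 0 < N → (n : ℝ) = δ * N →
      ∀ θstar ∈ Dfam N,
      ∀ βstar τstar : ℝ → ℝ,
      (∀ lam ∈ Set.Icc lmin lmax,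
        StateEvo δ σ (empDist θstar) lam (βstar lam) (τstar lam)) →
      ∀ θhat : ℝ → (Fin n → Fin N → ℝ) → (Fin n → ℝ) → (Fin N → ℝ),
      (∀ lam ∈ Set.Icc lmin lmax, ∀ (X : Fin n → Fin N → ℝ) (z : Fin n → ℝ),
        IsMinOn (lassoCost X (yvec σ θstar X z) lam) Set.univ (θhat lam X z)) →
      ∀ ε : ℝ, ε ∈ Set.Ioc (0 : ℝ) 1 →
      Pmodel n N
        {ω | ∃ lam ∈ Set.Icc lmin lmax,
          ε ≤ ((1 / (N : ℝ)) *
              ∑ j, ((1 / lam) * ∑ i, ω.1 i j *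
                (yvec σ θstar ω.1 ω.2 i - ∑ j', ω.1 i j' * θhat lam ω.1 ω.2 j')) ^ 2
            - (βstar lam) ^ 2 / lam ^ 2 *
                (1 + δ - 2 * sStar (empDist θstar) (τstar lam) (lam / βstar lam)
                 - δ * σ ^ 2 / (τstar lam) ^ 2)) ^ 2}
      ≤ ENNReal.ofReal (C / ε ^ 2 * (N : ℝ) ^ q * Real.exp (-c * n * ε ^ 2)) := by
  obtain ⟨α, s, L, hα, hs0, hs1, hL, hsα, hsp⟩ := hD.exists_sparse hδ
  obtain ⟨M, m, hP, hB⟩ := exists_boundedSolution hδ hσ hα hs0 hs1 hL hsα hl hll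
  obtain ⟨D, C₀, c₀, hD0, hC₀, hc₀, H⟩ := subgradient_norm_prob hP hα hs0 hs1 hL hsα hl hll
  set K := 9 * D ^ 2 + 1 with hK
  have hK1 : 1 ≤ K := by rw [hK]; nlinarith only [sq_nonneg D]
  have hK0 : 0 < K := by linarith
  have hll' : 0 ≤ lmax - lmin := by linarith
  refine ⟨C₀ * ((lmax - lmin) * K + 2), c₀ / (δ * K ^ 2), by positivity, by positivity, ?_⟩
  intro N n hN hnN θ hθ β τ hevo θhat hmin ε hε
  obtain ⟨hε0, hε1⟩ := hε
  obtain ⟨S, hS, hSL⟩ := hsp N θ hθ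
  have hN1 : (1 : ℝ) ≤ N := by exact_mod_cast hN
  have hN' : (0 : ℝ) < N := by linarith
  set t := ε / K with ht
  have ht0 : 0 < t := by positivity
  have ht1 : t ≤ 1 := by rw [ht, div_le_one hK0]; linarith
  have hexp : -(c₀ / (δ * K ^ 2)) * n * ε ^ 2 = -c₀ * N * t ^ 2 := by
    rw [hnN, ht]; field_simp
  rw [hexp, ← ofReal_measureReal]
  refine ENNReal.ofReal_le_ofReal ?_
  set p := C₀ * Real.exp (-c₀ * N * t ^ 2) with hp
  have hp0 : 0 < p := by positivity
  have hNq : 1 ≤ (N : ℝ) ^ q := Real.one_le_rpow hN1 hD.exponent_nonneg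
  have hε2 : ε ^ 2 ≤ ε := by nlinarith only [hε0, hε1]
  have hbound : ((lmax - lmin) * K + 2) / ε ^ 2 * p ≤
      C₀ * ((lmax - lmin) * K + 2) / ε ^ 2 * (N : ℝ) ^ q * Real.exp (-c₀ * N * t ^ 2) := by
    calc ((lmax - lmin) * K + 2) / ε ^ 2 * p
        = C₀ * ((lmax - lmin) * K + 2) / ε ^ 2 * 1 * Real.exp (-c₀ * N * t ^ 2) := by
          rw [hp]; ring
      _ ≤ _ := by gcongr
  refine le_trans ?_ hbound
  rcases le_or_gt 1 (2 * p) with h2p | h2p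
  · refine measureReal_le_one.trans (h2p.trans (mul_le_mul_of_nonneg_right ?_ hp0.le))
    rw [le_div_iff₀ (by positivity)]
    nlinarith only [hε2, hε1, mul_nonneg hll' hK0.le]
  have hκ : ∀ lam ∈ Set.Icc lmin lmax, (β lam) ^ 2 / lam ^ 2 *
      (1 + δ - 2 * sStar (empDist θ) (τ lam) (lam / β lam) - δ * σ ^ 2 / (τ lam) ^ 2) =
      dualNorm δ σ lam (β lam) (τ lam) := fun lam hlam => (hevo lam hlam).dualNorm_eq hN hδ
  have key := exists_uniform_of_local (Pmodel n N) hll ht0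
    (fun lam ω => (∑ j, subgradientVec σ lam ω (θhat lam ω.1 ω.2 - θ) j ^ 2) / (N : ℝ))
    (fun lam => dualNorm δ σ lam (β lam) (τ lam)) h2p (d := D * √t) (fun lam hlam => by
      refine (measureReal_mono ?_).trans (H N n hN hnN θ S hS hSL lam (β lam) (τ lam)
        (hl.trans_le hlam.1) (hB N hN θ S hS hSL lam hlam _ _ (hevo lam hlam)) t ht0 ht1)
      rintro ω ⟨lam', hlam', hd, hfar⟩
      exact ⟨lam', hlam', hd, _, excessCost_le_of_isMinOn (hmin lam' hlam' ω.1 ω.2), hfar⟩)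
  refine (measureReal_mono ?_).trans (key.trans (mul_le_mul_of_nonneg_right ?_ hp0.le))
  · rintro ω ⟨lam, hlam, hfar⟩
    refine ⟨lam, hlam, ?_⟩
    rw [hκ lam hlam] at hfar
    simp only [subgradientVec_sub]
    rw [one_div_mul_eq_div] at hfar
    refine lt_of_pow_lt_pow_left₀ 2 (abs_nonneg _) ?_
    rw [sq_abs]
    refine lt_of_lt_of_le ?_ hfar
    have e : (3 * (D * √t)) ^ 2 = 9 * D ^ 2 * t := by
      rw [mul_pow, mul_pow, Real.sq_sqrt ht0.le]; ring
    have e2 : K * t = ε := by rw [ht]; field_simp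
    rw [e, ← e2, hK]
    linarith
  · have e : (lmax - lmin) / t = (lmax - lmin) * K / ε := by rw [ht]; field_simp
    rw [e, le_div_iff₀ (by positivity)]
    have e3 : ((lmax - lmin) * K / ε + 1) * ε ^ 2 = (lmax - lmin) * K * ε + ε ^ 2 := by
      field_simp
    rw [e3]
    have := mul_le_mul_of_nonneg_left hε1 (mul_nonneg hll' hK0.le)
    linarith
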